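/- arXiv:1907.10123 — 3 statements merged into one kernel-verified Lean document; each statement's English description precedes it below -/
import Mathlib

section
/- For every n ≥ 0, I_n(q,t) = F_n(q,t); that is, for all j, k ∈ ℕ the number of trees T ∈ T_n with inv(T) = j and coinv(T) = k equals the number of minimal factorizations f ∈ F_n with area_L(f) = j and area_U(f) = k. In other words, the bi-statistics (inv, coinv) on T_n and (area_L, area_U) on F_n have the same joint distribution. -/
open Finset

/-- `j` is a descendant of `i` in the graph `G` (viewed as a tree rooted at `0`):
`i ≠ j` and `i` lies on the (unique) path from `j` to `0`. -/
def IsDesc {n : ℕ} (G : SimpleGraph (Fin (n+1))) (i j : Fin (n+1)) : Prop :=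
  j ≠ i ∧ ∀ p : G.Path j 0, i ∈ p.1.support

/-- The number of inversions of a tree: pairs `(i,j)` with `j` a descendant of `i`
and `i > j`. -/
noncomputable def treeInv {n : ℕ} (G : SimpleGraph (Fin (n+1))) : ℕ :=
  Nat.card {p : Fin (n+1) × Fin (n+1) // IsDesc G p.1 p.2 ∧ p.2 < p.1}

/-- The number of coinversions of a tree: pairs `(i,j)` with `j` a descendant of `i`
and `i < j`. -/
noncomputable def treeCoinv {n : ℕ} (G : SimpleGraph (Fin (n+1))) : ℕ :=
  Nat.card {p : Fin (n+1) × Fin (n+1) // IsDesc G p.1 p.2 ∧ p.1 < p.2}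
/-- The smaller endpoint of a transposition (as a natural number). -/
def swapLow {m : ℕ} (τ : Equiv.Perm (Fin m)) : ℕ :=
  ((τ.support.image Fin.val).min).getD 0

/-- The larger endpoint of a transposition (as a natural number). -/
def swapHigh {m : ℕ} (τ : Equiv.Perm (Fin m)) : ℕ :=
  ((τ.support.image Fin.val).max).getD 0

/-- Minimal factorizations of the full cycle `σ_n = (0 1 ⋯ n)` into `n` transpositions.
Permutations are multiplied left to right, i.e. `τ₁τ₂⋯τₙ` sends `x` to `τₙ(⋯τ₂(τ₁(x))⋯)`,
which is the product of the reversed list in Mathlib's convention. -/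
def FactSet (n : ℕ) : Set (Fin n → Equiv.Perm (Fin (n+1))) :=
  {f | (∀ i, (f i).IsSwap) ∧ ((List.ofFn f).reverse).prod = finRotate (n+1)}

/-- The lower sequence `L(f) = (a₁, …, aₙ)` of a factorization. -/
def lowerSeq {n : ℕ} (f : Fin n → Equiv.Perm (Fin (n+1))) : Fin n → ℕ :=
  fun i => swapLow (f i)

/-- The upper sequence `U(f) = (b₁, …, bₙ)` of a factorization. -/
def upperSeq {n : ℕ} (f : Fin n → Equiv.Perm (Fin (n+1))) : Fin n → ℕ :=
  fun i => swapHigh (f i)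

/-- The lower area `area_L(f) = C(n,2) - (a₁ + ⋯ + aₙ)`. -/
def areaL {n : ℕ} (f : Fin n → Equiv.Perm (Fin (n+1))) : ℕ :=
  n.choose 2 - ∑ i, swapLow (f i)

/-- The upper area `area_U(f) = (b₁ + ⋯ + bₙ) - C(n,2)`. -/
def areaU {n : ℕ} (f : Fin n → Equiv.Perm (Fin (n+1))) : ℕ :=
  (∑ i, swapHigh (f i)) - n.choose 2

/-- `p` is the parent map of a tree on `Fin (n+1)` rooted at `0`, with the convention `p 0 = 0`. -/
def IsParentMap {n : ℕ} (p : Fin (n+1) → Fin (n+1)) : Prop :=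
  p 0 = 0 ∧ ∃ d : Fin (n+1) → ℕ, ∀ v, v ≠ 0 → d (p v) < d v

namespace IsParentMap

variable {n : ℕ} {p : Fin (n+1) → Fin (n+1)}

open Classical in
/-- The vertices `u` whose path to the root passes through `v` (including `v` itself). -/
noncomputable def subtree (p : Fin (n+1) → Fin (n+1)) (v : Fin (n+1)) : Finset (Fin (n+1)) :=
  univ.filter fun u => ∃ k, p^[k] u = v

/-- The number of vertices of the subtree hanging from `v`. -/
noncomputable def size (p : Fin (n+1) → Fin (n+1)) (v : Fin (n+1)) : ℕ := (subtree p v).card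

/-- The children of `v`. -/
def children (p : Fin (n+1) → Fin (n+1)) (v : Fin (n+1)) : Finset (Fin (n+1)) :=
  univ.filter fun c => c ≠ 0 ∧ p c = v

/-- The proper descendants of `v`. -/
noncomputable def desc (p : Fin (n+1) → Fin (n+1)) (v : Fin (n+1)) : Finset (Fin (n+1)) :=
  (subtree p v).erase v

theorem mem_subtree {u v : Fin (n+1)} : u ∈ subtree p v ↔ ∃ k, p^[k] u = v := by
  simp [subtree]

theorem mem_children {c v : Fin (n+1)} : c ∈ children p v ↔ c ≠ 0 ∧ p c = v := by
  simp [children]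

theorem mem_desc {u v : Fin (n+1)} : u ∈ desc p v ↔ u ≠ v ∧ u ∈ subtree p v := by
  simp [desc]

theorem self_mem_subtree (v : Fin (n+1)) : v ∈ subtree p v := mem_subtree.2 ⟨0, rfl⟩

theorem subtree_trans {u v w : Fin (n+1)} (h : u ∈ subtree p v) (h' : v ∈ subtree p w) :
    u ∈ subtree p w := by
  obtain ⟨k, rfl⟩ := mem_subtree.1 h
  obtain ⟨l, rfl⟩ := mem_subtree.1 h'
  exact mem_subtree.2 ⟨l + k, Function.iterate_add_apply p l k u⟩

theorem subtree_total {u v w : Fin (n+1)} (h : u ∈ subtree p v) (h' : u ∈ subtree p w) :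
    v ∈ subtree p w ∨ w ∈ subtree p v := by
  obtain ⟨k, rfl⟩ := mem_subtree.1 h
  obtain ⟨l, rfl⟩ := mem_subtree.1 h'
  rcases le_total k l with hkl | hkl <;> obtain ⟨m, rfl⟩ := Nat.exists_eq_add_of_le hkl
  · exact Or.inl (mem_subtree.2 ⟨m, by rw [← Function.iterate_add_apply, add_comm m]⟩)
  · exact Or.inr (mem_subtree.2 ⟨m, by rw [← Function.iterate_add_apply, add_comm m]⟩)

theorem mem_subtree_iff (hp : IsParentMap p) {u v : Fin (n+1)} :
    u ∈ subtree p v ↔ u = v ∨ (u ≠ 0 ∧ p u ∈ subtree p v) := by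
  constructor
  · intro h
    obtain ⟨k, hk⟩ := mem_subtree.1 h
    by_cases hu : u = 0
    · left
      rw [← hk, hu, Function.iterate_fixed hp.1]
    · cases k with
      | zero => exact Or.inl hk
      | succ k => exact Or.inr ⟨hu, mem_subtree.2 ⟨k, hk⟩⟩
  · rintro (rfl | ⟨-, h⟩)
    · exact self_mem_subtree u
    · exact subtree_trans (mem_subtree.2 ⟨1, rfl⟩) h

theorem subtree_antisymm (hp : IsParentMap p) {u v : Fin (n+1)} (h : u ∈ subtree p v)
    (h' : v ∈ subtree p u) : u = v := by
  obtain ⟨d, hd⟩ := hp.2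
  have key : ∀ m (u v : Fin (n+1)), d u = m → u ∈ subtree p v → u = v ∨ d v < d u := by
    intro m
    induction m using Nat.strong_induction_on with
    | _ m ih =>
      intro u v hm huv
      rcases (mem_subtree_iff hp).1 huv with h | ⟨h0, h⟩
      · exact Or.inl h
      · have h1 := hd u h0
        rcases ih _ (hm ▸ h1) _ _ rfl h with h2 | h2
        · right; rwa [← h2]
        · right; omega
  rcases key _ u v rfl h with h1 | h1
  · exact h1
  · rcases key _ v u rfl h' with h2 | h2
    · exact h2.symm
    · omega

theorem zero_mem_subtree (hp : IsParentMap p) {v : Fin (n+1)} : (0 : Fin (n+1)) ∈ subtree p v ↔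
    v = 0 := by
  rw [mem_subtree_iff hp]
  simp [eq_comm]

theorem mem_subtree_zero (hp : IsParentMap p) (v : Fin (n+1)) : v ∈ subtree p 0 := by
  obtain ⟨d, hd⟩ := hp.2
  induction hm : d v using Nat.strong_induction_on generalizing v with
  | _ m ih =>
    rw [mem_subtree_iff hp]
    by_cases hv : v = 0
    · exact Or.inl hv
    · exact Or.inr ⟨hv, ih _ (hm ▸ hd v hv) _ rfl⟩

theorem notMem_subtree_parent (hp : IsParentMap p) {c : Fin (n+1)} (hc : c ≠ 0) :
    p c ∉ subtree p c := fun h => by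
  have h1 : c = p c := subtree_antisymm hp (mem_subtree.2 ⟨1, rfl⟩) h
  obtain ⟨d, hd⟩ := hp.2
  have := hd c hc
  rw [← h1] at this
  exact lt_irrefl _ this

theorem mem_desc_iff (hp : IsParentMap p) {u v : Fin (n+1)} :
    u ∈ desc p v ↔ u ≠ 0 ∧ p u ∈ subtree p v := by
  rw [mem_desc, mem_subtree_iff hp]
  constructor
  · rintro ⟨h, h' | h'⟩
    · exact absurd h' h
    · exact h'
  · intro h
    refine ⟨?_, Or.inr h⟩
    rintro rfl
    exact notMem_subtree_parent hp h.1 h.2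

theorem desc_eq_biUnion (hp : IsParentMap p) (v : Fin (n+1)) :
    desc p v = (children p v).biUnion (subtree p) := by
  ext u
  rw [mem_biUnion]
  constructor
  · intro h
    obtain ⟨hne, hu⟩ := mem_desc.1 h
    obtain ⟨k, hk⟩ := mem_subtree.1 hu
    induction k generalizing u with
    | zero => exact absurd hk hne
    | succ k ih =>
      have h0 := ((mem_desc_iff hp).1 h).1
      rw [Function.iterate_succ_apply] at hk
      by_cases h1 : p u = v
      · exact ⟨u, mem_children.2 ⟨h0, h1⟩, self_mem_subtree u⟩
      · have h2 : p u ∈ subtree p v := mem_subtree.2 ⟨k, hk⟩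
        obtain ⟨c, hc, hc'⟩ := ih (p u) (mem_desc.2 ⟨h1, h2⟩) h1 h2 hk
        exact ⟨c, hc, (mem_subtree_iff hp).2 (Or.inr ⟨h0, hc'⟩)⟩
  · rintro ⟨c, hc, hu⟩
    obtain ⟨h0, rfl⟩ := mem_children.1 hc
    have h1 : u ∈ subtree p (p c) := subtree_trans hu (mem_subtree.2 ⟨1, rfl⟩)
    refine mem_desc.2 ⟨?_, h1⟩
    rintro rfl
    exact notMem_subtree_parent hp h0 hu

theorem children_disjoint (hp : IsParentMap p) (v : Fin (n+1)) :
    (children p v : Set (Fin (n+1))).PairwiseDisjoint (subtree p) := by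
  have key : ∀ c c', c ∈ children p v → c' ∈ children p v → c ∈ subtree p c' → c = c' := by
    intro c c' hc hc' h
    obtain ⟨h0, h1⟩ := mem_children.1 hc
    obtain ⟨h0', h1'⟩ := mem_children.1 hc'
    rcases (mem_subtree_iff hp).1 h with h | ⟨-, h⟩
    · exact h
    · rw [h1, ← h1'] at h
      exact absurd h (notMem_subtree_parent hp h0')
  intro c hc c' hc' hne
  rw [Function.onFun, Finset.disjoint_left]
  intro u hu hu'
  rcases subtree_total hu hu' with h | h
  · exact hne (key _ _ hc hc' h)
  · exact hne (key _ _ hc' hc h).symm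

theorem card_desc (hp : IsParentMap p) (v : Fin (n+1)) :
    (desc p v).card = ∑ c ∈ children p v, size p c := by
  rw [desc_eq_biUnion hp, card_biUnion (children_disjoint hp v)]
  rfl

theorem size_eq_card_desc (v : Fin (n+1)) : size p v = (desc p v).card + 1 := by
  rw [desc, card_erase_add_one (self_mem_subtree v), size]

theorem size_eq (hp : IsParentMap p) (v : Fin (n+1)) :
    size p v = ∑ c ∈ children p v, size p c + 1 := by
  rw [size_eq_card_desc, card_desc hp]

theorem sum_nonroot (g : Fin (n+1) → Fin (n+1) → ℕ) :
    ∑ c with c ≠ 0, g (p c) c = ∑ v, ∑ c ∈ children p v, g v c := by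
  rw [← sum_fiberwise_of_maps_to (s := univ.filter fun c : Fin (n+1) => c ≠ 0) (t := univ) (g := p)
    (fun _ _ => mem_univ _)]
  refine sum_congr rfl fun v _ => ?_
  rw [filter_filter]
  refine sum_congr rfl fun c hc => ?_
  rw [(mem_filter.1 hc).2.2]

theorem sum_size_nonroot (hp : IsParentMap p) :
    ∑ c with c ≠ 0, size p c = ∑ v, (desc p v).card := by
  rw [sum_nonroot (p := p) fun _ c => size p c]
  exact sum_congr rfl fun v _ => (card_desc hp v).symm

/-- Inversions of the tree whose vertices are relabelled by `ω`. -/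
noncomputable def invStat (p : Fin (n+1) → Fin (n+1)) (ω : Equiv.Perm (Fin (n+1))) : ℕ :=
  ∑ v, ((desc p v).filter fun u => ω u < ω v).card

/-- Coinversions of the tree whose vertices are relabelled by `ω`. -/
noncomputable def coinvStat (p : Fin (n+1) → Fin (n+1)) (ω : Equiv.Perm (Fin (n+1))) : ℕ :=
  ∑ v, ((desc p v).filter fun u => ω v < ω u).card

/-- Total size of the subtrees hanging from descents of the tree relabelled by `ω`. -/
noncomputable def majStat (p : Fin (n+1) → Fin (n+1)) (ω : Equiv.Perm (Fin (n+1))) : ℕ :=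
  ∑ c with c ≠ 0, if ω c < ω (p c) then size p c else 0

/-- Total size of the subtrees hanging from ascents of the tree relabelled by `ω`. -/
noncomputable def comajStat (p : Fin (n+1) → Fin (n+1)) (ω : Equiv.Perm (Fin (n+1))) : ℕ :=
  ∑ c with c ≠ 0, if ω (p c) < ω c then size p c else 0

theorem ne_parent (hp : IsParentMap p) {c : Fin (n+1)} (hc : c ≠ 0) : p c ≠ c := fun h =>
  notMem_subtree_parent hp hc (h.symm ▸ self_mem_subtree c)

theorem invStat_add_coinvStat (ω : Equiv.Perm (Fin (n+1))) :
    invStat p ω + coinvStat p ω = ∑ v, (desc p v).card := by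
  rw [invStat, coinvStat, ← sum_add_distrib]
  refine sum_congr rfl fun v _ => ?_
  rw [← card_filter_add_card_filter_not (s := desc p v) fun u => ω u < ω v]
  congr 2
  refine filter_congr fun u hu => ?_
  have : ω u ≠ ω v := fun h => (mem_desc.1 hu).1 (ω.injective h)
  rw [not_lt]
  exact ⟨le_of_lt, fun h => lt_of_le_of_ne h this.symm⟩

theorem majStat_add_comajStat (hp : IsParentMap p) (ω : Equiv.Perm (Fin (n+1))) :
    majStat p ω + comajStat p ω = ∑ v, (desc p v).card := by
  rw [majStat, comajStat, ← sum_add_distrib, ← sum_size_nonroot hp]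
  refine sum_congr rfl fun c hc => ?_
  have : ω c ≠ ω (p c) := fun h => ne_parent hp (mem_filter.1 hc).2 (ω.injective h).symm
  rcases lt_or_gt_of_ne this with h | h <;> simp [h, h.not_gt]

theorem exists_perm_strictMonoOn {m : ℕ} {α : Type*} [LinearOrder α] (L : Finset (Fin m))
    (κ : Fin m → α) (hκ : Function.Injective κ) :
    ∃ ρ : Equiv.Perm (Fin m), (∀ x, x ∉ L → ρ x = x) ∧ (∀ x ∈ L, ρ x ∈ L) ∧
      ∀ x ∈ L, ∀ y ∈ L, κ x < κ y → ρ x < ρ y := by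
  have hcard : (L.image κ).card = L.card := card_image_of_injective _ hκ
  let e := (L.image κ).orderIsoOfFin hcard
  let e' := L.orderIsoOfFin rfl
  have hmem : ∀ x ∈ L, κ x ∈ L.image κ := fun x hx => mem_image_of_mem κ hx
  let r : Fin m → Fin m := fun x =>
    if h : x ∈ L then (e' (e.symm ⟨κ x, hmem x h⟩) : Fin m) else x
  have hr : ∀ x (h : x ∈ L), r x = e' (e.symm ⟨κ x, hmem x h⟩) := fun x h => dif_pos h
  have hr' : ∀ x, x ∉ L → r x = x := fun x h => dif_neg h
  have hrL : ∀ x ∈ L, r x ∈ L := fun x h => by rw [hr x h]; exact (e' _).2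
  have hmono : ∀ x ∈ L, ∀ y ∈ L, κ x < κ y → r x < r y := by
    intro x hx y hy h
    rw [hr x hx, hr y hy, Subtype.coe_lt_coe, e'.lt_iff_lt, e.symm.lt_iff_lt]
    exact h
  have hinj : Function.Injective r := by
    intro x y hxy
    by_cases hx : x ∈ L <;> by_cases hy : y ∈ L
    · by_contra hne
      rcases lt_or_gt_of_ne (hκ.ne hne) with h | h
      · exact (hmono x hx y hy h).ne hxy
      · exact (hmono y hy x hx h).ne hxy.symm
    · exact absurd (hr' y hy ▸ hxy ▸ hrL x hx) hy
    · exact absurd (hr' x hx ▸ hxy.symm ▸ hrL y hy) hx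
    · rwa [hr' x hx, hr' y hy] at hxy
  exact ⟨Equiv.ofBijective r (Finite.injective_iff_bijective.1 hinj), hr', hrL, hmono⟩

/-- Rotating, for each relabelling `ω`, the labels of the proper descendants of `v` so that those
exceeding the label of `v` become the smallest ones. -/
theorem exists_rotation (p : Fin (n+1) → Fin (n+1)) (v : Fin (n+1)) :
    ∃ Ψ : Equiv.Perm (Fin (n+1)) → Equiv.Perm (Fin (n+1)), Function.Injective Ψ ∧ ∀ ω,
      (∀ u, u ∉ desc p v → Ψ ω u = ω u) ∧
      ((desc p v).image (Ψ ω) = (desc p v).image ω) ∧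
      ∀ u ∈ desc p v, ∀ w ∈ desc p v,
        (ω u < ω v → ¬ ω w < ω v → Ψ ω w < Ψ ω u) ∧
        ((ω u < ω v ↔ ω w < ω v) → ω u < ω w → Ψ ω u < Ψ ω w) := by
  let κ : Fin (n+1) → Fin (n+1) → Bool ×ₗ Fin (n+1) := fun s x => toLex (decide (x < s), x)
  have hκ : ∀ s, Function.Injective (κ s) := fun s x y h => (Prod.mk.inj (toLex_inj.1 h)).2
  choose ρ hρ1 hρ2 hρ3 using fun (L : Finset (Fin (n+1))) (s : Fin (n+1)) =>
    exists_perm_strictMonoOn L (κ s) (hκ s)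
  have himg : ∀ (L : Finset (Fin (n+1))) (s : Fin (n+1)), L.image (ρ L s) = L := fun L s =>
    eq_of_subset_of_card_le (fun y hy => by
      obtain ⟨x, hx, rfl⟩ := mem_image.1 hy
      exact hρ2 L s x hx) (card_image_of_injective _ (ρ L s).injective).ge
  let Ψ : Equiv.Perm (Fin (n+1)) → Equiv.Perm (Fin (n+1)) := fun ω =>
    ρ ((desc p v).image ω) (ω v) * ω
  have h1 : ∀ ω u, u ∉ desc p v → Ψ ω u = ω u := by
    intro ω u hu
    refine hρ1 _ _ _ fun h => hu ?_
    obtain ⟨w, hw, hwu⟩ := mem_image.1 h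
    exact ω.injective hwu ▸ hw
  have h2 : ∀ ω, (desc p v).image (Ψ ω) = (desc p v).image ω := fun ω => by
    have : (desc p v).image (Ψ ω) = ((desc p v).image ω).image (ρ ((desc p v).image ω) (ω v)) := by
      rw [image_image]; rfl
    rw [this, himg]
  have hv : v ∉ desc p v := fun h => (mem_desc.1 h).1 rfl
  refine ⟨Ψ, ?_, fun ω => ⟨h1 ω, h2 ω, fun u hu w hw => ⟨fun hu' hw' => ?_, fun h h' => ?_⟩⟩⟩
  · intro ω ω' h
    have e1 : ω v = ω' v := by rw [← h1 ω v hv, ← h1 ω' v hv, h]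
    have e2 : (desc p v).image ω = (desc p v).image ω' := by rw [← h2 ω, ← h2 ω', h]
    have h' : ρ ((desc p v).image ω) (ω v) * ω = ρ ((desc p v).image ω') (ω' v) * ω' := h
    rw [e1, e2] at h'
    exact mul_left_cancel h'
  · refine hρ3 _ _ _ (mem_image_of_mem ω hw) _ (mem_image_of_mem ω hu) ?_
    rw [Prod.Lex.toLex_lt_toLex]
    simp [hu', hw']
  · refine hρ3 _ _ _ (mem_image_of_mem ω hu) _ (mem_image_of_mem ω hw) ?_
    rw [Prod.Lex.toLex_lt_toLex]
    simp [h, h']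

/-- The statistic that counts inversions below the vertices of `U` and descents elsewhere. -/
noncomputable def mixStat (p : Fin (n+1) → Fin (n+1)) (U : Finset (Fin (n+1)))
    (ω : Equiv.Perm (Fin (n+1))) : ℕ :=
  ∑ v ∈ U, ((desc p v).filter fun u => ω u < ω v).card +
    ∑ c with c ≠ 0 ∧ p c ∉ U, if ω c < ω (p c) then size p c else 0

theorem mixStat_empty (ω : Equiv.Perm (Fin (n+1))) : mixStat p ∅ ω = majStat p ω := by
  simp [mixStat, majStat]

theorem mixStat_univ (ω : Equiv.Perm (Fin (n+1))) : mixStat p univ ω = invStat p ω := by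
  simp [mixStat, invStat]

theorem sum_size_rotation (hp : IsParentMap p) {v : Fin (n+1)} {ω ω' : Equiv.Perm (Fin (n+1))}
    (h : ∀ u ∈ desc p v, ∀ w ∈ desc p v,
        (ω u < ω v → ¬ ω w < ω v → ω' w < ω' u) ∧
        ((ω u < ω v ↔ ω w < ω v) → ω u < ω w → ω' u < ω' w)) :
    ∑ c ∈ desc p v, (if ω c < ω (p c) then size p c else 0) =
      ((desc p v).filter fun u => ω u < ω v).card +
        ∑ c ∈ desc p v, if p c ≠ v ∧ ω' c < ω' (p c) then size p c else 0 := by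
  let s : Fin (n+1) → ℕ := fun u => if ω u < ω v then 1 else 0
  have hsv : s v = 0 := by simp [s]
  have hedge : ∀ c ∈ desc p v, (if ω c < ω (p c) then size p c else 0) + s (p c) * size p c =
      (if p c ≠ v ∧ ω' c < ω' (p c) then size p c else 0) + s c * size p c := by
    intro c hc
    obtain ⟨hc0, hpc⟩ := (mem_desc_iff hp).1 hc
    by_cases hv : p c = v
    · simp [hv, s]
    · have hpc' : p c ∈ desc p v := mem_desc.2 ⟨hv, hpc⟩
      have a1 := h c hc _ hpc'
      have a2 := h _ hpc' c hc
      have hne : ω c ≠ ω (p c) := fun e => ne_parent hp hc0 (ω.injective e).symm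
      by_cases b1 : ω c < ω v <;> by_cases b2 : ω (p c) < ω v
      · rcases lt_or_gt_of_ne hne with h' | h'
        · have := a1.2 (by simp [b1, b2]) h'
          simp [s, b1, b2, hv, h', this]
        · have := a2.2 (by simp [b1, b2]) h'
          simp [s, b1, b2, h'.not_gt, this.not_gt]
      · have h' := lt_of_lt_of_le b1 (not_lt.1 b2)
        have := a1.1 b1 b2
        simp [s, b1, b2, h', this.not_gt]
      · have h' := lt_of_lt_of_le b2 (not_lt.1 b1)
        have := a2.1 b2 b1
        simp [s, b1, b2, h'.not_gt, this, hv]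
      · rcases lt_or_gt_of_ne hne with h' | h'
        · have := a1.2 (by simp [b1, b2]) h'
          simp [s, b1, b2, hv, h', this]
        · have := a2.2 (by simp [b1, b2]) h'
          simp [s, b1, b2, h'.not_gt, this.not_gt]
  have hsum := sum_congr rfl hedge
  rw [sum_add_distrib, sum_add_distrib] at hsum
  have hfib : ∑ c ∈ desc p v, s (p c) * size p c + ∑ u ∈ desc p v, s u =
      ∑ u ∈ desc p v, s u * size p u := by
    rw [← sum_fiberwise_of_maps_to (s := desc p v) (t := subtree p v) (g := p)
      (fun c hc => ((mem_desc_iff hp).1 hc).2)]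
    have : ∀ u ∈ subtree p v, ∑ c ∈ desc p v with p c = u, s (p c) * size p c =
        s u * (desc p u).card := by
      intro u hu
      rw [card_desc hp, mul_sum]
      have : (desc p v).filter (fun c => p c = u) = children p u := by
        ext c
        rw [mem_filter, mem_children, mem_desc_iff hp]
        constructor
        · rintro ⟨⟨h0, -⟩, h1⟩
          exact ⟨h0, h1⟩
        · rintro ⟨h0, rfl⟩
          exact ⟨⟨h0, hu⟩, rfl⟩
      rw [this]
      exact sum_congr rfl fun c hc => by rw [(mem_children.1 hc).2]
    rw [sum_congr rfl this, ← add_sum_erase _ _ (self_mem_subtree v), hsv, zero_mul, zero_add,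
      ← desc, ← sum_add_distrib]
    exact sum_congr rfl fun u _ => by rw [size_eq_card_desc, mul_add, mul_one]
  have hcard : ((desc p v).filter fun u => ω u < ω v).card = ∑ u ∈ desc p v, s u := by
    rw [card_filter]
  omega

theorem card_filter_lt_eq_of_image_eq {D : Finset (Fin (n+1))} {v : Fin (n+1)}
    {ω ω' : Equiv.Perm (Fin (n+1))} (hD : D.image ω' = D.image ω) (hv : ω' v = ω v) :
    (D.filter fun u => ω' u < ω' v).card = (D.filter fun u => ω u < ω v).card := by
  have : ∀ τ : Equiv.Perm (Fin (n+1)), (D.filter fun u => τ u < τ v).card =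
      ((D.image τ).filter fun x => x < τ v).card := by
    intro τ
    rw [filter_image, card_image_of_injective _ τ.injective]
  rw [this, this, hD, hv]

theorem mixStat_insert (hp : IsParentMap p) {U : Finset (Fin (n+1))}
    (hU : ∀ u ∈ U, p u ∈ U) {v : Fin (n+1)} (hv : v ∉ U) {ω ω' : Equiv.Perm (Fin (n+1))}
    (h1 : ∀ u, u ∉ desc p v → ω' u = ω u)
    (h2 : (desc p v).image ω' = (desc p v).image ω)
    (h3 : ∀ u ∈ desc p v, ∀ w ∈ desc p v,
        (ω u < ω v → ¬ ω w < ω v → ω' w < ω' u) ∧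
        ((ω u < ω v ↔ ω w < ω v) → ω u < ω w → ω' u < ω' w)) :
    mixStat p (insert v U) ω' = mixStat p U ω := by
  have hv' : v ∉ desc p v := fun h => (mem_desc.1 h).1 rfl
  have hUanc : ∀ u ∈ U, ∀ w, u ∈ subtree p w → w ∈ U := by
    intro u hu w hw
    obtain ⟨k, rfl⟩ := mem_subtree.1 hw
    clear hw
    induction k generalizing u with
    | zero => exact hu
    | succ k ih => exact ih (p u) (hU u hu)
  have hUd : ∀ u ∈ U, u ∉ subtree p v := fun u hu h => hv (hUanc u hu v h)
  have himg : ∀ u ∈ U, (desc p u).image ω' = (desc p u).image ω := by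
    intro u hu
    by_cases hvu : v ∈ subtree p u
    · have hsub : desc p v ⊆ desc p u := by
        intro w hw
        obtain ⟨-, hw⟩ := mem_desc.1 hw
        refine mem_desc.2 ⟨?_, subtree_trans hw hvu⟩
        rintro rfl
        exact hUd _ hu hw
      rw [← union_sdiff_of_subset hsub, image_union, image_union, h2]
      congr 1
      exact image_congr fun w hw => h1 w (mem_sdiff.1 hw).2
    · refine image_congr fun w hw => h1 w fun hw' => ?_
      rcases subtree_total (mem_desc.1 hw).2 (mem_desc.1 hw').2 with h | h
      · exact hUd u hu h
      · exact hvu h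
  have hsplit : ∀ g : Fin (n+1) → ℕ, ∑ c with c ≠ 0 ∧ p c ∉ U, g c =
      ∑ c ∈ desc p v, g c + ∑ c with c ≠ 0 ∧ p c ∉ U ∧ c ∉ desc p v, g c := by
    intro g
    rw [← sum_filter_add_sum_filter_not (univ.filter fun c => c ≠ 0 ∧ p c ∉ U)
      (fun c => c ∈ desc p v), filter_filter, filter_filter]
    congr 1
    · refine sum_congr ?_ fun _ _ => rfl
      ext c
      simp only [mem_filter, mem_univ, true_and]
      refine ⟨fun h => h.2, fun h => ⟨⟨((mem_desc_iff hp).1 h).1, fun h' => ?_⟩, h⟩⟩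
      exact hUd _ h' ((mem_desc_iff hp).1 h).2
    · refine sum_congr ?_ fun _ _ => rfl
      ext c
      simp only [mem_filter, mem_univ, true_and, and_assoc]
  have hinsert : ∑ c with c ≠ 0 ∧ p c ∉ insert v U, (if ω' c < ω' (p c) then size p c else 0) =
      ∑ c with c ≠ 0 ∧ p c ∉ U, if p c ≠ v ∧ ω' c < ω' (p c) then size p c else 0 := by
    rw [sum_filter, sum_filter]
    refine sum_congr rfl fun c _ => ?_
    by_cases a : p c = v <;> by_cases b : p c ∈ U <;> simp [a, b]
  rw [mixStat, mixStat, sum_insert hv, hinsert, hsplit, hsplit, sum_size_rotation hp h3,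
    card_filter_lt_eq_of_image_eq h2 (h1 v hv')]
  have e1 : ∑ u ∈ U, ((desc p u).filter fun w => ω' w < ω' u).card =
      ∑ u ∈ U, ((desc p u).filter fun w => ω w < ω u).card :=
    sum_congr rfl fun u hu => card_filter_lt_eq_of_image_eq (himg u hu)
      (h1 u fun h => hUd u hu (mem_desc.1 h).2)
  have e2 : ∑ c with c ≠ 0 ∧ p c ∉ U ∧ c ∉ desc p v,
        (if p c ≠ v ∧ ω' c < ω' (p c) then size p c else 0) =
      ∑ c with c ≠ 0 ∧ p c ∉ U ∧ c ∉ desc p v, if ω c < ω (p c) then size p c else 0 := by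
    refine sum_congr rfl fun c hc => ?_
    obtain ⟨-, h0, -, hd⟩ := mem_filter.1 hc
    have hpc : p c ∉ subtree p v := fun h => hd ((mem_desc_iff hp).2 ⟨h0, h⟩)
    have hne : p c ≠ v := fun h => hpc (h ▸ self_mem_subtree _)
    rw [h1 c hd, h1 (p c) fun h => hpc (mem_desc.1 h).2]
    simp [hne]
  omega

/-- For a fixed shape, `inv` and `maj` are equidistributed over the labellings fixing the root. -/
theorem card_majStat_eq_card_invStat (hp : IsParentMap p) (j : ℕ) :
    (univ.filter fun ω : Equiv.Perm (Fin (n+1)) => ω 0 = 0 ∧ majStat p ω = j).card =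
      (univ.filter fun ω : Equiv.Perm (Fin (n+1)) => ω 0 = 0 ∧ invStat p ω = j).card := by
  classical
  have step : ∀ U : Finset (Fin (n+1)), (∀ u ∈ U, p u ∈ U) → ∀ v, v ∉ U → 
      (univ.filter fun ω : Equiv.Perm (Fin (n+1)) => ω 0 = 0 ∧ mixStat p U ω = j).card =
      (univ.filter fun ω : Equiv.Perm (Fin (n+1)) =>
        ω 0 = 0 ∧ mixStat p (insert v U) ω = j).card := by
    intro U hU v hv
    obtain ⟨Ψ, hinj, hΨ⟩ := exists_rotation p v
    refine card_bijective Ψ (Finite.injective_iff_bijective.1 hinj) fun ω => ?_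
    obtain ⟨h1, h2, h3⟩ := hΨ ω
    have h0 : Ψ ω 0 = ω 0 := h1 0 fun h => ((mem_desc_iff hp).1 h).1 rfl
    simp only [mem_filter, mem_univ, true_and]
    rw [h0, mixStat_insert hp hU hv h1 h2 h3]
  have key : ∀ m (U : Finset (Fin (n+1))), (∀ u ∈ U, p u ∈ U) → (Uᶜ).card = m →
      (univ.filter fun ω : Equiv.Perm (Fin (n+1)) => ω 0 = 0 ∧ mixStat p U ω = j).card =
      (univ.filter fun ω : Equiv.Perm (Fin (n+1)) => ω 0 = 0 ∧ invStat p ω = j).card := by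
    intro m
    induction m with
    | zero =>
      intro U _ hm
      obtain rfl : U = univ := by rwa [card_eq_zero, compl_eq_empty_iff] at hm
      simp only [mixStat_univ]
    | succ m ih =>
      intro U hU hm
      have hex : ∃ v, v ∉ U ∧ (p v ∈ U ∨ p v = v) := by
        obtain ⟨d, hd⟩ := hp.2
        have hne : (Uᶜ).Nonempty := card_pos.1 (by omega)
        obtain ⟨v, hv, hmin⟩ := exists_min_image _ d hne
        refine ⟨v, mem_compl.1 hv, ?_⟩
        by_cases h0 : v = 0
        · exact Or.inr (h0 ▸ hp.1)
        · refine Or.inl (by_contra fun h => ?_)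
          exact absurd (hmin _ (mem_compl.2 h)) (not_le.2 (hd v h0))
      obtain ⟨v, hv, hpv⟩ := hex
      rw [step U hU v hv]
      refine ih _ ?_ ?_
      · intro u hu
        rcases mem_insert.1 hu with rfl | hu
        · rcases hpv with h | h
          · exact mem_insert_of_mem h
          · rw [h]; exact mem_insert_self _ _
        · exact mem_insert_of_mem (hU u hu)
      · rw [compl_insert, card_erase_of_mem (mem_compl.2 hv), hm, Nat.add_sub_cancel]
  have := key _ ∅ (by simp) rfl
  simpa only [mixStat_empty] using this

/-- Relabelling the vertices of the tree by `ω`. -/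
def conj (ω : Equiv.Perm (Fin (n+1))) (p : Fin (n+1) → Fin (n+1)) : Fin (n+1) → Fin (n+1) :=
  fun v => ω (p (ω.symm v))

theorem conj_apply (ω : Equiv.Perm (Fin (n+1))) (v : Fin (n+1)) : conj ω p (ω v) = ω (p v) := by
  simp [conj]

theorem iterate_conj_apply (ω : Equiv.Perm (Fin (n+1))) (k : ℕ) (v : Fin (n+1)) :
    (conj ω p)^[k] (ω v) = ω (p^[k] v) := by
  induction k generalizing v with
  | zero => rfl
  | succ k ih => rw [Function.iterate_succ_apply, conj_apply, ih, Function.iterate_succ_apply]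

theorem subtree_conj (ω : Equiv.Perm (Fin (n+1))) (v : Fin (n+1)) :
    subtree (conj ω p) (ω v) = (subtree p v).map ω.toEmbedding := by
  ext u
  obtain ⟨u, rfl⟩ := ω.surjective u
  rw [mem_subtree, mem_map_equiv, Equiv.symm_apply_apply, mem_subtree]
  simp only [iterate_conj_apply, ω.injective.eq_iff]

theorem desc_conj (ω : Equiv.Perm (Fin (n+1))) (v : Fin (n+1)) :
    desc (conj ω p) (ω v) = (desc p v).map ω.toEmbedding := by
  rw [desc, subtree_conj, desc, map_erase]
  rfl

theorem size_conj (ω : Equiv.Perm (Fin (n+1))) (v : Fin (n+1)) :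
    size (conj ω p) (ω v) = size p v := by
  rw [size, subtree_conj, card_map, size]

theorem invStat_conj (ω : Equiv.Perm (Fin (n+1))) :
    invStat (conj ω p) 1 = invStat p ω := by
  rw [invStat, ← Equiv.sum_comp ω]
  refine sum_congr rfl fun v _ => ?_
  rw [desc_conj, filter_map, card_map]
  rfl

theorem coinvStat_conj (ω : Equiv.Perm (Fin (n+1))) :
    coinvStat (conj ω p) 1 = coinvStat p ω := by
  rw [coinvStat, ← Equiv.sum_comp ω]
  refine sum_congr rfl fun v _ => ?_
  rw [desc_conj, filter_map, card_map]
  rfl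

theorem majStat_conj {ω : Equiv.Perm (Fin (n+1))} (hω : ω 0 = 0) :
    majStat (conj ω p) 1 = majStat p ω := by
  rw [majStat, majStat, sum_filter, sum_filter, ← Equiv.sum_comp ω]
  refine sum_congr rfl fun v _ => ?_
  have : ω v = 0 ↔ v = 0 := by rw [← ω.injective.eq_iff (a := v), hω]
  simp [conj_apply, size_conj, this]

theorem comajStat_conj {ω : Equiv.Perm (Fin (n+1))} (hω : ω 0 = 0) :
    comajStat (conj ω p) 1 = comajStat p ω := by
  rw [comajStat, comajStat, sum_filter, sum_filter, ← Equiv.sum_comp ω]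
  refine sum_congr rfl fun v _ => ?_
  have : ω v = 0 ↔ v = 0 := by rw [← ω.injective.eq_iff (a := v), hω]
  simp [conj_apply, size_conj, this]

theorem conj_bijective (ω : Equiv.Perm (Fin (n+1))) : Function.Bijective (conj ω) := by
  refine Function.bijective_iff_has_inverse.2 ⟨conj ω.symm, fun p => ?_, fun p => ?_⟩ <;>
    funext v <;> simp [conj]

theorem isParentMap_conj_iff {ω : Equiv.Perm (Fin (n+1))} (hω : ω 0 = 0) :
    IsParentMap (conj ω p) ↔ IsParentMap p := by
  have h0 : ∀ v, ω v = 0 ↔ v = 0 := fun v => by rw [← ω.injective.eq_iff (a := v), hω]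
  constructor
  · rintro ⟨h, d, hd⟩
    refine ⟨?_, d ∘ ω, fun v hv => ?_⟩
    · rw [← hω, conj_apply] at h
      rw [← h0, h, hω]
    · have := hd (ω v) (mt (h0 v).1 hv)
      rwa [conj_apply] at this
  · rintro ⟨h, d, hd⟩
    refine ⟨?_, d ∘ ω.symm, fun v hv => ?_⟩
    · rw [← hω, conj_apply, h]
    · obtain ⟨v, rfl⟩ := ω.surjective v
      have := hd v (mt (h0 v).2 hv)
      simpa [conj_apply] using this

open Classical in
theorem sum_card_relabelling
    (P : (Fin (n+1) → Fin (n+1)) → Equiv.Perm (Fin (n+1)) → Prop)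
    (hP : ∀ ω, ω 0 = 0 → ∀ p, P (conj ω p) 1 ↔ P p ω) :
    ∑ p : Fin (n+1) → Fin (n+1) with IsParentMap p,
        (univ.filter fun ω : Equiv.Perm (Fin (n+1)) => ω 0 = 0 ∧ P p ω).card =
      (univ.filter fun ω : Equiv.Perm (Fin (n+1)) => ω 0 = 0).card *
        (univ.filter fun p : Fin (n+1) → Fin (n+1) => IsParentMap p ∧ P p 1).card := by
  have h1 : ∀ p : Fin (n+1) → Fin (n+1),
      (univ.filter fun ω : Equiv.Perm (Fin (n+1)) => ω 0 = 0 ∧ P p ω).card =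
      ∑ ω : Equiv.Perm (Fin (n+1)) with ω 0 = 0, if P p ω then 1 else 0 := fun p => by
    rw [← filter_filter, card_filter]
  rw [sum_congr rfl fun p _ => h1 p, sum_comm, ← smul_eq_mul, ← sum_const]
  refine sum_congr rfl fun ω hω => ?_
  have hω := (mem_filter.1 hω).2
  rw [← card_filter, filter_filter]
  refine card_bijective (conj ω) (conj_bijective ω) fun p => ?_
  simp only [mem_filter, mem_univ, true_and]
  rw [isParentMap_conj_iff hω, hP ω hω]

open Classical in
theorem card_maj_comaj_eq_card_inv_coinv (n j k : ℕ) :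
    (univ.filter fun p : Fin (n+1) → Fin (n+1) =>
        IsParentMap p ∧ majStat p 1 = j ∧ comajStat p 1 = k).card =
      (univ.filter fun p : Fin (n+1) → Fin (n+1) =>
        IsParentMap p ∧ invStat p 1 = j ∧ coinvStat p 1 = k).card := by
  have hpos : 0 < (univ.filter fun ω : Equiv.Perm (Fin (n+1)) => ω 0 = 0).card :=
    card_pos.2 ⟨1, by simp⟩
  refine Nat.eq_of_mul_eq_mul_left hpos ?_
  have h1 := sum_card_relabelling (n := n) (fun p ω => majStat p ω = j ∧ comajStat p ω = k)
    (fun ω hω p => by rw [majStat_conj hω, comajStat_conj hω])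
  have h2 := sum_card_relabelling (n := n) (fun p ω => invStat p ω = j ∧ coinvStat p ω = k)
    (fun ω _ p => by rw [invStat_conj, coinvStat_conj])
  refine Eq.trans ?_ (h1.symm.trans (Eq.trans ?_ (h2.trans ?_)))
  · congr!
  swap
  · congr!
  refine sum_congr rfl fun p hp => ?_
  have hp := (mem_filter.1 hp).2
  by_cases hK : j + k = ∑ v, (desc p v).card
  · have e1 : ∀ ω, (majStat p ω = j ∧ comajStat p ω = k) ↔ majStat p ω = j := fun ω => by
      have := majStat_add_comajStat hp ω
      omega
    have e2 : ∀ ω, (invStat p ω = j ∧ coinvStat p ω = k) ↔ invStat p ω = j := fun ω => by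
      have := invStat_add_coinvStat (p := p) ω
      omega
    simp only [e1, e2]
    convert card_majStat_eq_card_invStat hp j
  · have e1 : ∀ ω, ¬ (majStat p ω = j ∧ comajStat p ω = k) := fun ω => by
      have := majStat_add_comajStat hp ω
      omega
    have e2 : ∀ ω, ¬ (invStat p ω = j ∧ coinvStat p ω = k) := fun ω => by
      have := invStat_add_coinvStat (p := p) ω
      omega
    simp only [e1, e2, and_false]

/-- Displacement, after the first `k` transpositions, of the element whose trajectory is the
vertex `v`, where `ℓ c` is the length of the jump made along the edge from `c` to its parent. -/
def offset (p : Fin (n+1) → Fin (n+1)) (ℓ : Fin (n+1) → ℤ) (v : Fin (n+1)) (k : ℕ) : ℤ :=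
  (if v.val ≤ k then ℓ v else 0) - ∑ c ∈ children p v with c.val ≤ k, ℓ c

theorem offset_zero (p : Fin (n+1) → Fin (n+1)) {ℓ : Fin (n+1) → ℤ} (hℓ : ℓ 0 = 0)
    (v : Fin (n+1)) : offset p ℓ v 0 = 0 := by
  have h1 : (if v.val ≤ 0 then ℓ v else 0) = 0 := by
    split_ifs with h
    · rw [show v = 0 from Fin.ext (Nat.le_zero.1 h), hℓ]
    · rfl
  have h2 : (children p v).filter (fun c => c.val ≤ 0) = ∅ := by
    refine filter_eq_empty_iff.2 fun c hc h => (mem_children.1 hc).1 (Fin.ext (Nat.le_zero.1 h))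
  rw [offset, h1, h2, sum_empty, sub_zero]

theorem offset_succ (p : Fin (n+1) → Fin (n+1)) (ℓ : Fin (n+1) → ℤ) (v : Fin (n+1)) (e : Fin n) :
    offset p ℓ v ((e : ℕ) + 1) = offset p ℓ v e + (if v = e.succ then ℓ e.succ else 0) -
      (if p e.succ = v then ℓ e.succ else 0) := by
  have h1 : (if v.val ≤ (e : ℕ) + 1 then ℓ v else 0) =
      (if v.val ≤ (e : ℕ) then ℓ v else 0) + (if v = e.succ then ℓ e.succ else 0) := by
    by_cases h : v = e.succ
    · subst h
      simp
    · have : v.val ≠ (e : ℕ) + 1 := fun h' => h (Fin.ext h')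
      by_cases h' : v.val ≤ e
      · simp [h, h', h'.trans (Nat.le_succ _)]
      · simp [h, h', show ¬ v.val ≤ (e : ℕ) + 1 by omega]
  have h2 : ∑ c ∈ children p v with c.val ≤ (e : ℕ) + 1, ℓ c =
      ∑ c ∈ children p v with c.val ≤ (e : ℕ), ℓ c + (if p e.succ = v then ℓ e.succ else 0) := by
    by_cases h : p e.succ = v
    · have : (children p v).filter (fun c => c.val ≤ (e : ℕ) + 1) =
          insert e.succ ((children p v).filter (fun c => c.val ≤ (e : ℕ))) := by
        ext c
        simp only [mem_filter, mem_insert, mem_children, Fin.ext_iff, Fin.val_succ]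
        constructor
        · rintro ⟨hc, hle⟩
          rcases Nat.lt_or_ge e c with h' | h'
          · exact Or.inl (by omega)
          · exact Or.inr ⟨hc, h'⟩
        · rintro (hc | ⟨hc, hle⟩)
          · obtain rfl : c = e.succ := Fin.ext hc
            refine ⟨⟨by simp, congrArg _ h⟩, le_rfl⟩
          · exact ⟨hc, by omega⟩
      rw [this, sum_insert (by simp), if_pos h, add_comm]
    · rw [if_neg h, add_zero]
      refine sum_congr (filter_congr fun c hc => ?_) fun _ _ => rfl
      have : c.val ≠ (e : ℕ) + 1 := fun h' =>
        h ((Fin.ext h' : c = e.succ) ▸ (mem_children.1 hc).2)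
      omega
  rw [offset, offset, h1, h2]
  ring

theorem offset_last (p : Fin (n+1) → Fin (n+1)) (ℓ : Fin (n+1) → ℤ) (v : Fin (n+1)) :
    offset p ℓ v n = ℓ v - ∑ c ∈ children p v, ℓ c := by
  have h : (children p v).filter (fun c => c.val ≤ n) = children p v :=
    filter_true_of_mem fun c _ => Nat.lt_succ_iff.1 c.2
  rw [offset, if_pos (Nat.lt_succ_iff.1 v.2), h]

/-- The product of the first `k` transpositions `(a₁ b₁), …, (aₖ bₖ)`, performed in this order. -/
def partialProd (a b : Fin n → Fin (n+1)) : ℕ → Equiv.Perm (Fin (n+1))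
  | 0 => 1
  | k + 1 => if h : k < n then Equiv.swap (a ⟨k, h⟩) (b ⟨k, h⟩) * partialProd a b k
      else partialProd a b k

theorem partialProd_succ (a b : Fin n → Fin (n+1)) (e : Fin n) :
    partialProd a b ((e : ℕ) + 1) = Equiv.swap (a e) (b e) * partialProd a b e := by
  rw [partialProd, dif_pos e.2]

/-- `(a₁ b₁) ⋯ (aₙ bₙ)` is a minimal factorization of the full cycle, with `aᵢ < bᵢ`. -/
def IsFact (a b : Fin n → Fin (n+1)) : Prop :=
  (∀ e, a e < b e) ∧ partialProd a b n = finRotate (n+1)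

/-- The element that is moved up by the transposition with a given label, all other transpositions
moving it down; the label `0` stands for no transposition. -/
def start (a b : Fin n → Fin (n+1)) : Fin (n+1) → Fin (n+1) :=
  Fin.cases (Fin.last n) fun e => (partialProd a b e).symm (a e)

/-- The parent of a label `e` is the label of the element moved down by the `e`-th transposition. -/
noncomputable def parent (a b : Fin n → Fin (n+1)) : Fin (n+1) → Fin (n+1) :=
  Fin.cases 0 fun e => Function.invFun (start a b) ((partialProd a b e).symm (b e))

/-- The length of the transposition with a given label. -/
def jump (a b : Fin n → Fin (n+1)) : Fin (n+1) → ℤ :=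
  Fin.cases 0 fun e => (b e : ℤ) - a e

section Fact

variable {a b : Fin n → Fin (n+1)}

@[simp] theorem start_zero : start a b 0 = Fin.last n := rfl

@[simp] theorem jump_zero : jump a b 0 = 0 := rfl

@[simp] theorem jump_succ (e : Fin n) : jump a b e.succ = (b e : ℤ) - a e := rfl

theorem partialProd_start (e : Fin n) : partialProd a b e (start a b e.succ) = a e :=
  Equiv.apply_symm_apply _ _

theorem start_bijective (h : IsFact a b) : Function.Bijective (start a b) := by
  refine Finite.surjective_iff_bijective.1 fun x => ?_
  by_contra! hx
  have hxn : x ≠ Fin.last n := fun h' => hx 0 h'.symm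
  have hdesc : ∀ k ≤ n, partialProd a b k x ≤ x := by
    intro k
    induction k with
    | zero => intro _; exact le_rfl
    | succ k ih =>
      intro hk
      have ih := ih (by omega)
      rw [show k = ((⟨k, hk⟩ : Fin n) : ℕ) from rfl, partialProd_succ, Equiv.Perm.mul_apply]
      set e : Fin n := ⟨k, hk⟩ with he
      have hne : partialProd a b e x ≠ a e := fun h' =>
        hx e.succ ((Equiv.symm_apply_eq _).2 h'.symm)
      by_cases hb : partialProd a b e x = b e
      · rw [hb, Equiv.swap_apply_right]
        exact (h.1 e).le.trans (hb ▸ ih)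
      · rw [Equiv.swap_apply_of_ne_of_ne hne hb]
        exact ih
  have h1 := hdesc n le_rfl
  have hlt : x.val < n := lt_of_le_of_ne (Nat.lt_succ_iff.1 x.2) fun h' => hxn (Fin.ext h')
  rw [h.2, Fin.le_def, finRotate_of_lt hlt] at h1
  simp at h1

theorem partialProd_start_parent (h : IsFact a b) (e : Fin n) :
    partialProd a b e (start a b (parent a b e.succ)) = b e := by
  have : start a b (parent a b e.succ) = (partialProd a b e).symm (b e) :=
    Function.invFun_eq ((start_bijective h).2 _)
  rw [this, Equiv.apply_symm_apply]

theorem trajectory_step {s : Fin (n+1) → Fin (n+1)} (hs : Function.Injective s)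
    {ℓ : Fin (n+1) → ℤ} {e : Fin n} (hab : a e ≠ b e) (hℓ : ℓ e.succ = b e - a e)
    (h1 : partialProd a b e (s e.succ) = a e) (h2 : partialProd a b e (s (p e.succ)) = b e)
    {v : Fin (n+1)} (ih : (partialProd a b e (s v) : ℤ) = s v + offset p ℓ v e) :
    (partialProd a b ((e : ℕ) + 1) (s v) : ℤ) = s v + offset p ℓ v ((e : ℕ) + 1) := by
  have hinj : ∀ w, partialProd a b e (s v) = partialProd a b e (s w) → v = w :=
    fun w hw => hs ((partialProd a b e).injective hw)
  rw [offset_succ, partialProd_succ, Equiv.Perm.mul_apply]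
  by_cases hv : v = e.succ
  · have hpv : p e.succ ≠ v := fun h' => by
      rw [h', hv, h1] at h2
      exact hab h2
    rw [if_pos hv, if_neg hpv]
    rw [hv, h1] at ih
    rw [hv, h1, Equiv.swap_apply_left, hℓ]
    linarith
  · by_cases hpv : p e.succ = v
    · rw [if_neg hv, if_pos hpv]
      rw [← hpv, h2] at ih
      rw [← hpv, h2, Equiv.swap_apply_right, hℓ]
      linarith
    · rw [if_neg hv, if_neg hpv, Equiv.swap_apply_of_ne_of_ne, ih]
      · ring
      · exact fun h' => hv (hinj _ (h'.trans h1.symm))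
      · exact fun h' => hpv (hinj _ (h'.trans h2.symm)).symm

theorem trajectory (h : IsFact a b) (v : Fin (n+1)) {k : ℕ} (hk : k ≤ n) :
    (partialProd a b k (start a b v) : ℤ) =
      start a b v + offset (parent a b) (jump a b) v k := by
  induction k with
  | zero => rw [offset_zero _ jump_zero, add_zero]; rfl
  | succ k ih =>
    exact trajectory_step (e := ⟨k, hk⟩) (start_bijective h).1 (h.1 _).ne (jump_succ _)
      (partialProd_start _) (partialProd_start_parent h _) (ih (by omega))

theorem lower_eq (h : IsFact a b) (e : Fin n) :
    (a e : ℤ) = start a b e.succ + offset (parent a b) (jump a b) e.succ e := by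
  rw [← trajectory h _ e.2.le, partialProd_start]

theorem upper_eq (h : IsFact a b) (e : Fin n) :
    (b e : ℤ) = start a b (parent a b e.succ) +
      offset (parent a b) (jump a b) (parent a b e.succ) e := by
  rw [← trajectory h _ e.2.le, partialProd_start_parent h]

theorem jump_eq (h : IsFact a b) {v : Fin (n+1)} (hv : v ≠ 0) :
    jump a b v = ∑ c ∈ children (parent a b) v, jump a b c + 1 := by
  have h1 := trajectory h v le_rfl
  have hne : start a b v ≠ Fin.last n := fun h' => hv ((start_bijective h).1 h')
  have hlt : (start a b v).val < n :=
    lt_of_le_of_ne (Nat.lt_succ_iff.1 (start a b v).2) fun h' => hne (Fin.ext h')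
  rw [offset_last, h.2, finRotate_of_lt hlt] at h1
  push_cast at h1
  linarith

theorem jump_pos (h : IsFact a b) {v : Fin (n+1)} (hv : v ≠ 0) : 0 < jump a b v := by
  obtain ⟨e, rfl⟩ := Fin.exists_succ_eq.2 hv
  have := h.1 e
  rw [Fin.lt_def] at this
  rw [jump_succ]
  omega

theorem isParentMap_parent (h : IsFact a b) : IsParentMap (parent a b) := by
  refine ⟨rfl, fun v => if v = 0 then 0 else (n + 1 - jump a b v).toNat, fun v hv => ?_⟩
  have hle : jump a b v ≤ n := by
    obtain ⟨e, rfl⟩ := Fin.exists_succ_eq.2 hv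
    have := (b e).2
    rw [jump_succ]
    omega
  dsimp only
  rw [if_neg hv]
  split_ifs with hp
  · omega
  · have h1 := jump_eq h hp
    have h2 : jump a b v ≤ ∑ c ∈ children (parent a b) (parent a b v), jump a b c :=
      single_le_sum (f := jump a b) (fun c hc => (jump_pos h (mem_children.1 hc).1).le)
        (mem_children.2 ⟨hv, rfl⟩)
    omega

theorem jump_eq_size (h : IsFact a b) {v : Fin (n+1)} (hv : v ≠ 0) :
    jump a b v = size (parent a b) v := by
  induction hm : (jump a b v).toNat using Nat.strong_induction_on generalizing v with
  | _ m ih =>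
    rw [jump_eq h hv, size_eq (isParentMap_parent h)]
    push_cast
    congr 1
    refine sum_congr rfl fun c hc => ?_
    have hc0 := (mem_children.1 hc).1
    have h2 : jump a b c ≤ ∑ c ∈ children (parent a b) v, jump a b c :=
      single_le_sum (f := jump a b) (fun c hc => (jump_pos h (mem_children.1 hc).1).le) hc
    have h3 := jump_eq h hv
    have h4 := jump_pos h hc0
    exact ih _ (by omega) hc0 rfl

end Fact

/-- The length of the jump along the edge from a vertex to its parent. -/
noncomputable def weight (p : Fin (n+1) → Fin (n+1)) (v : Fin (n+1)) : ℤ :=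
  if v = 0 then 0 else size p v

theorem weight_of_ne {v : Fin (n+1)} (hv : v ≠ 0) : weight p v = size p v := if_neg hv

theorem weight_zero : weight p 0 = 0 := if_pos rfl

theorem jump_eq_weight {a b : Fin n → Fin (n+1)} (h : IsFact a b) :
    jump a b = weight (parent a b) := by
  funext v
  by_cases hv : v = 0
  · rw [hv, jump_zero, weight_zero]
  · rw [jump_eq_size h hv, weight_of_ne hv]

theorem parent_injective {a b a' b' : Fin n → Fin (n+1)} (h : IsFact a b) (h' : IsFact a' b')
    (hp : parent a b = parent a' b') : a = a' ∧ b = b' := by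
  have hj : jump a b = jump a' b' := by rw [jump_eq_weight h, jump_eq_weight h', hp]
  have hs : ∀ v, start a b v = start a' b' v := by
    intro v
    obtain ⟨d, hd⟩ := (isParentMap_parent h).2
    induction hm : d v using Nat.strong_induction_on generalizing v with
    | _ m ih =>
      by_cases hv : v = 0
      · rw [hv]; rfl
      · have ih := ih _ (hm ▸ hd v hv) _ rfl
        obtain ⟨e, rfl⟩ := Fin.exists_succ_eq.2 hv
        have e1 := lower_eq h e
        have e2 := lower_eq h' e
        have e3 := upper_eq h e
        have e4 := upper_eq h' e
        have e5 : jump a b e.succ = jump a' b' e.succ := by rw [hj]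
        rw [jump_succ, jump_succ] at e5
        rw [← hp, ← hj] at e2 e4
        rw [ih] at e3
        refine Fin.ext ?_
        omega
  constructor <;> funext e <;> refine Fin.ext ?_
  · have e1 := lower_eq h e
    have e2 := lower_eq h' e
    rw [← hp, ← hj, ← hs] at e2
    omega
  · have e1 := upper_eq h e
    have e2 := upper_eq h' e
    rw [← hp, ← hj, ← hs] at e2
    omega

theorem sum_lower {a b : Fin n → Fin (n+1)} (h : IsFact a b) :
    ∑ e, (a e : ℕ) + majStat (parent a b) 1 = n.choose 2 := by
  have h1 : ∀ e : Fin n, (a e : ℕ) + ∑ c ∈ children (parent a b) e.succ,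
      (if c < e.succ then size (parent a b) c else 0) = start a b e.succ := by
    intro e
    have := lower_eq h e
    rw [offset, if_neg (by simp), sum_filter] at this
    zify
    rw [this]
    have : ∀ c ∈ children (parent a b) e.succ, (if c.val ≤ e then jump a b c else 0) =
        if c < e.succ then (size (parent a b) c : ℤ) else 0 := by
      intro c hc
      rw [jump_eq_size h (mem_children.1 hc).1]
      simp [Fin.lt_def]
    rw [sum_congr rfl this]
    ring
  have h2 := sum_congr (rfl : (univ : Finset (Fin n)) = univ) fun e _ => h1 e
  rw [sum_add_distrib] at h2
  have h3 : majStat (parent a b) 1 = ∑ e : Fin n, ∑ c ∈ children (parent a b) e.succ,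
      (if c < e.succ then size (parent a b) c else 0) := by
    have := sum_nonroot (p := parent a b) fun v c => if c < v then size (parent a b) c else 0
    rw [majStat]
    refine this.trans ?_
    rw [Fin.sum_univ_succ]
    simp
  have h4 : ∑ v : Fin (n+1), (start a b v : ℕ) = (n+1).choose 2 := by
    refine (Equiv.sum_comp (Equiv.ofBijective _ (start_bijective h))
      fun x : Fin (n+1) => (x : ℕ)).trans ?_
    rw [Fin.sum_univ_eq_sum_range (fun i => i), sum_range_id, Nat.choose_two_right]
  have h5 : (n+1).choose 2 = n + n.choose 2 := by
    rw [Nat.choose_succ_succ' n 1, Nat.choose_one_right]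
  rw [Fin.sum_univ_succ, start_zero, Fin.val_last, h5] at h4
  omega

theorem sum_upper {a b : Fin n → Fin (n+1)} (h : IsFact a b) :
    ∑ e, (b e : ℕ) = n.choose 2 + comajStat (parent a b) 1 := by
  have h1 := sum_lower h
  have h2 := majStat_add_comajStat (isParentMap_parent h) 1
  rw [← sum_size_nonroot (isParentMap_parent h), sum_filter, Fin.sum_univ_succ] at h2
  simp only [ne_eq, not_true_eq_false, if_false, zero_add, Fin.succ_ne_zero, not_false_eq_true,
    if_true] at h2
  have h3 : ∑ e, (b e : ℕ) = ∑ e, (a e : ℕ) + ∑ e : Fin n, size (parent a b) e.succ := by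
    rw [← sum_add_distrib]
    refine sum_congr rfl fun e _ => ?_
    have := jump_eq_size h (Fin.succ_ne_zero e)
    rw [jump_succ] at this
    omega
  omega

/-- The total size of the subtrees hanging from the children of `v` that are less than `c`. -/
noncomputable def sizeBelow (p : Fin (n+1) → Fin (n+1)) (v c : Fin (n+1)) : ℤ :=
  ∑ d ∈ children p v with d < c, (size p d : ℤ)

theorem sizeBelow_nonneg (v c : Fin (n+1)) : 0 ≤ sizeBelow p v c :=
  sum_nonneg fun _ _ => Int.natCast_nonneg _

theorem sizeBelow_le (hp : IsParentMap p) (v c : Fin (n+1)) : sizeBelow p v c + 1 ≤ size p v := by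
  rw [size_eq hp, sizeBelow]
  push_cast
  exact add_le_add_left (sum_le_sum_of_subset_of_nonneg (filter_subset _ _)
    fun _ _ _ => Int.natCast_nonneg _) 1

theorem sizeBelow_mono (v : Fin (n+1)) {c c' : Fin (n+1)} (h : c ≤ c') :
    sizeBelow p v c ≤ sizeBelow p v c' :=
  sum_le_sum_of_subset_of_nonneg (fun d hd => by
    rw [mem_filter] at hd ⊢
    exact ⟨hd.1, hd.2.trans_le h⟩) fun _ _ _ => Int.natCast_nonneg _

theorem insert_filter_subset {v c : Fin (n+1)} (hc : c ∈ children p v) :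
    insert c ((children p v).filter (· < c)) ⊆ children p v := by
  intro d hd
  rcases mem_insert.1 hd with rfl | hd
  · exact hc
  · exact (mem_filter.1 hd).1

theorem sizeBelow_add_le {v c c' : Fin (n+1)} (hc : c ∈ children p v) (h : c < c') :
    sizeBelow p v c + size p c ≤ sizeBelow p v c' := by
  have hn : c ∉ (children p v).filter (· < c) := by simp
  rw [sizeBelow, add_comm, ← sum_insert (f := fun d => (size p d : ℤ)) hn]
  refine sum_le_sum_of_subset_of_nonneg (fun d hd => mem_filter.2 ⟨insert_filter_subset hc hd, ?_⟩)
    fun _ _ _ => Int.natCast_nonneg _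
  rcases mem_insert.1 hd with rfl | hd
  · exact h
  · exact (mem_filter.1 hd).2.trans h

theorem sizeBelow_add_size_le (hp : IsParentMap p) {v c : Fin (n+1)} (hc : c ∈ children p v) :
    sizeBelow p v c + size p c + 1 ≤ size p v := by
  have hn : c ∉ (children p v).filter (· < c) := by simp
  rw [size_eq hp v, sizeBelow, add_comm _ (size p c : ℤ),
    ← sum_insert (f := fun d => (size p d : ℤ)) hn]
  push_cast
  exact add_le_add_left (sum_le_sum_of_subset_of_nonneg (insert_filter_subset hc)
    fun _ _ _ => Int.natCast_nonneg _) 1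

theorem offset_weight (v : Fin (n+1)) (e : Fin n) :
    offset p (weight p) v e = (if v < e.succ then weight p v else 0) - sizeBelow p v e.succ := by
  have h : ∀ c : Fin (n+1), c.val ≤ (e : ℕ) ↔ c < e.succ := fun c => by
    simp [Fin.lt_def]
  rw [offset, sizeBelow]
  simp only [h]
  congr 1
  exact sum_congr rfl fun c hc => weight_of_ne (mem_children.1 (mem_filter.1 hc).1).1

/-- The position of a vertex, from which the parent of each vertex is `size` away at the time of
the jump along the edge joining them. -/
noncomputable def position (p : Fin (n+1) → Fin (n+1)) (v : Fin (n+1)) : ℤ :=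
  n + ∑ c with c ≠ 0 ∧ v ∈ subtree p c, ((if p c < c then weight p (p c) else 0) -
    sizeBelow p (p c) c - size p c + sizeBelow p c c)

theorem position_zero (hp : IsParentMap p) : position p 0 = n := by
  rw [position, filter_eq_empty_iff.2, sum_empty, add_zero]
  rintro c - ⟨hc, h⟩
  exact hc ((zero_mem_subtree hp).1 h)

theorem position_eq (hp : IsParentMap p) {c : Fin (n+1)} (hc : c ≠ 0) :
    position p c - sizeBelow p c c + size p c =
      position p (p c) + (if p c < c then weight p (p c) else 0) - sizeBelow p (p c) c := by
  classical
  have h : univ.filter (fun u => u ≠ 0 ∧ c ∈ subtree p u) =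
      insert c (univ.filter fun u => u ≠ 0 ∧ p c ∈ subtree p u) := by
    ext u
    rw [mem_filter, mem_insert, mem_filter, mem_subtree_iff hp]
    constructor
    · rintro ⟨-, h0, rfl | ⟨-, h⟩⟩
      · exact Or.inl rfl
      · exact Or.inr ⟨mem_univ _, h0, h⟩
    · rintro (rfl | ⟨-, h0, h⟩)
      · exact ⟨mem_univ _, hc, Or.inl rfl⟩
      · exact ⟨mem_univ _, h0, Or.inr ⟨hc, h⟩⟩
  rw [position, position, h, sum_insert (by simp [notMem_subtree_parent hp hc])]
  ring

/-- The lowest position in the subtree hanging from a vertex. -/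
noncomputable def lowest (p : Fin (n+1) → Fin (n+1)) (v : Fin (n+1)) : ℤ :=
  position p v - sizeBelow p v v

theorem lowest_le (v : Fin (n+1)) : lowest p v ≤ position p v :=
  sub_le_self _ (sizeBelow_nonneg _ _)

theorem position_lt (hp : IsParentMap p) (v : Fin (n+1)) :
    position p v < lowest p v + size p v := by
  have := sizeBelow_le hp v v
  rw [lowest]
  linarith

theorem lowest_eq (hp : IsParentMap p) {c v : Fin (n+1)} (hc : c ∈ children p v) :
    lowest p c + size p c =
      position p v + (if v < c then weight p v else 0) - sizeBelow p v c := by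
  obtain ⟨h0, rfl⟩ := mem_children.1 hc
  exact position_eq hp h0

theorem size_zero (hp : IsParentMap p) : size p 0 = n + 1 := by
  rw [size, eq_univ_of_forall (mem_subtree_zero hp), card_univ, Fintype.card_fin]

theorem nested_root (hp : IsParentMap p) {c : Fin (n+1)} (hc : c ∈ children p 0) :
    0 ≤ lowest p c ∧ lowest p c + size p c ≤ n := by
  have h1 := lowest_eq hp hc
  have h2 := sizeBelow_add_size_le hp hc
  have h3 := sizeBelow_nonneg (p := p) 0 c
  rw [weight_zero, ite_self, position_zero hp] at h1
  rw [size_zero hp] at h2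
  push_cast at h2
  constructor <;> linarith

theorem nested_left (hp : IsParentMap p) {c v : Fin (n+1)} (hc : c ∈ children p v) (h : c < v) :
    lowest p v ≤ lowest p c ∧ lowest p c + size p c ≤ position p v := by
  have h1 := lowest_eq hp hc
  have h2 := sizeBelow_add_le hc h
  have h3 := sizeBelow_nonneg (p := p) v c
  rw [if_neg h.not_gt] at h1
  rw [lowest] at h1 ⊢
  rw [lowest]
  constructor <;> linarith

theorem nested_right (hp : IsParentMap p) {c v : Fin (n+1)} (hc : c ∈ children p v) (h : v < c)
    (hv : v ≠ 0) :
    position p v < lowest p c ∧ lowest p c + size p c ≤ lowest p v + size p v := by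
  have h1 := lowest_eq hp hc
  have h2 := sizeBelow_add_size_le hp hc
  have h3 := sizeBelow_mono (p := p) v h.le
  rw [if_pos h, weight_of_ne hv] at h1
  rw [lowest] at h1 ⊢
  rw [lowest]
  constructor <;> linarith

theorem siblings (hp : IsParentMap p) {c c' v : Fin (n+1)} (hc : c ∈ children p v)
    (hc' : c' ∈ children p v) (h : c < c') :
    lowest p c' + size p c' ≤ lowest p c ∨ lowest p c + size p c ≤ lowest p c' := by
  have ne : ∀ {c}, c ∈ children p v → c ≠ v := fun hc h => ne_parent hp (mem_children.1 hc).1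
    ((mem_children.1 hc).2.trans h.symm)
  have h1 := lowest_eq hp hc
  have h2 := lowest_eq hp hc'
  have h3 := sizeBelow_add_le hc h
  by_cases hv : v = 0
  · left
    subst hv
    rw [weight_zero, ite_self] at h1 h2
    linarith
  rcases lt_or_gt_of_ne (ne hc) with h4 | h4 <;> rcases lt_or_gt_of_ne (ne hc') with h5 | h5
  · left
    rw [if_neg h4.not_gt] at h1
    rw [if_neg h5.not_gt] at h2
    linarith
  · right
    exact (nested_left hp hc h4).2.trans (nested_right hp hc' h5 hv).1.le
  · exact absurd (h.trans h5) h4.not_gt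
  · left
    rw [if_pos h4] at h1
    rw [if_pos h5] at h2
    linarith

theorem position_mem (hp : IsParentMap p) {u v : Fin (n+1)} (hv : v ≠ 0) (h : u ∈ subtree p v) :
    lowest p v ≤ position p u ∧ position p u < lowest p v + size p v := by
  induction hm : size p v using Nat.strong_induction_on generalizing v with
  | _ m ih =>
    subst hm
    by_cases huv : u = v
    · subst huv
      exact ⟨lowest_le _, position_lt hp _⟩
    · have hu : u ∈ desc p v := mem_desc.2 ⟨huv, h⟩
      rw [desc_eq_biUnion hp, mem_biUnion] at hu
      obtain ⟨c, hc, hu⟩ := hu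
      have hs := sizeBelow_add_size_le hp hc
      have hs' := sizeBelow_nonneg (p := p) v c
      have := ih _ (by omega) (mem_children.1 hc).1 hu rfl
      have hne : c ≠ v := fun h => ne_parent hp (mem_children.1 hc).1
        ((mem_children.1 hc).2.trans h.symm)
      have hl := lowest_le (p := p) v
      have hl' := position_lt hp v
      rcases lt_or_gt_of_ne hne with h' | h'
      · have := nested_left hp hc h'
        constructor <;> linarith
      · have := nested_right hp hc h' hv
        constructor <;> linarith

theorem lowest_nonneg (hp : IsParentMap p) {v : Fin (n+1)} (hv : v ≠ 0) :
    0 ≤ lowest p v ∧ lowest p v + size p v ≤ n := by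
  obtain ⟨d, hd⟩ := hp.2
  induction hm : d v using Nat.strong_induction_on generalizing v with
  | _ m ih =>
    have hc : v ∈ children p (p v) := mem_children.2 ⟨hv, rfl⟩
    by_cases h0 : p v = 0
    · exact nested_root hp (h0 ▸ hc)
    · have := ih _ (hm ▸ hd v hv) h0 rfl
      have hl := lowest_le (p := p) (p v)
      have hl' := position_lt hp (p v)
      rcases lt_or_gt_of_ne (ne_parent hp hv) with h' | h'
      · have := nested_right hp hc h' h0
        constructor <;> linarith
      · have := nested_left hp hc h'
        constructor <;> linarith

theorem position_ne (hp : IsParentMap p) {u v : Fin (n+1)} (h : u ∈ desc p v) :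
    position p u ≠ position p v := by
  rw [desc_eq_biUnion hp, mem_biUnion] at h
  obtain ⟨c, hc, hu⟩ := h
  have hc0 := (mem_children.1 hc).1
  have hne : c ≠ v := fun h => ne_parent hp hc0 ((mem_children.1 hc).2.trans h.symm)
  have h1 := position_mem hp hc0 hu
  by_cases hv : v = 0
  · subst hv
    have h2 := nested_root hp hc
    rw [position_zero hp]
    exact (h1.2.trans_le h2.2).ne
  · rcases lt_or_gt_of_ne hne with h' | h'
    · exact (h1.2.trans_le (nested_left hp hc h').2).ne
    · exact ((nested_right hp hc h' hv).1.trans_le h1.1).ne'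

theorem position_injective (hp : IsParentMap p) : Function.Injective (position p) := by
  have key : ∀ m v, size p v = m → Set.InjOn (position p) (subtree p v) := by
    intro m
    induction m using Nat.strong_induction_on with
    | _ m ih =>
      intro v hm u hu u' hu' h
      by_contra hne
      by_cases huv : u = v
      · subst huv
        exact position_ne hp (mem_desc.2 ⟨Ne.symm hne, hu'⟩) h.symm
      by_cases huv' : u' = v
      · subst huv'
        exact position_ne hp (mem_desc.2 ⟨hne, hu⟩) h
      have hu := mem_desc.2 ⟨huv, hu⟩
      have hu' := mem_desc.2 ⟨huv', hu'⟩
      rw [desc_eq_biUnion hp, mem_biUnion] at hu hu'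
      obtain ⟨c, hc, hu⟩ := hu
      obtain ⟨c', hc', hu'⟩ := hu'
      have h1 := position_mem hp (mem_children.1 hc).1 hu
      have h2 := position_mem hp (mem_children.1 hc').1 hu'
      rcases lt_trichotomy c c' with hlt | rfl | hlt
      · rcases siblings hp hc hc' hlt with h3 | h3 <;> linarith
      · have hs := sizeBelow_add_size_le hp hc
        have hs' := sizeBelow_nonneg (p := p) v c
        exact hne (ih _ (by omega) c rfl hu hu' h)
      · rcases siblings hp hc' hc hlt with h3 | h3 <;> linarith
  exact fun u u' h => key _ 0 rfl (mem_subtree_zero hp u) (mem_subtree_zero hp u') h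

theorem exists_factorization (hp : IsParentMap p) : ∃ a b, IsFact a b ∧ parent a b = p := by
  have hrange : ∀ v, ∃ x : Fin (n+1), (x : ℤ) = position p v := by
    intro v
    have : 0 ≤ position p v ∧ position p v ≤ n := by
      by_cases hv : v = 0
      · subst hv
        rw [position_zero hp]
        exact ⟨Int.natCast_nonneg _, le_rfl⟩
      · have h1 := lowest_nonneg hp hv
        have h2 := lowest_le (p := p) v
        have h3 := position_lt hp v
        constructor <;> linarith
    exact ⟨⟨(position p v).toNat, by omega⟩, by simp; omega⟩
  choose s hs using hrange
  have hinj : Function.Injective s := fun u v h => position_injective hp (by rw [← hs, ← hs, h])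
  have hb : ∀ e : Fin n, ∃ x : Fin (n+1), (x : ℤ) = lowest p e.succ := by
    intro e
    have := lowest_nonneg hp (Fin.succ_ne_zero e)
    exact ⟨⟨(lowest p e.succ).toNat, by omega⟩, by simp; omega⟩
  have hb' : ∀ e : Fin n, ∃ x : Fin (n+1), (x : ℤ) = lowest p e.succ + size p e.succ := by
    intro e
    have := lowest_nonneg hp (Fin.succ_ne_zero e)
    exact ⟨⟨(lowest p e.succ + size p e.succ).toNat, by omega⟩, by simp; omega⟩
  choose a ha using hb
  choose b hb using hb'
  have hlt : ∀ e, a e < b e := fun e => by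
    have h1 := ha e
    have h2 := hb e
    have h3 := size_eq_card_desc (p := p) e.succ
    rw [Fin.lt_def]
    omega
  have hjump : ∀ e : Fin n, weight p e.succ = b e - a e := fun e => by
    rw [ha, hb, weight_of_ne (Fin.succ_ne_zero e)]
    ring
  have hlower : ∀ e : Fin n, (a e : ℤ) = s e.succ + offset p (weight p) e.succ e := fun e => by
    rw [ha, offset_weight, if_neg (lt_irrefl _), hs, lowest]
    ring
  have hupper : ∀ e : Fin n, (b e : ℤ) = s (p e.succ) + offset p (weight p) (p e.succ) e :=
    fun e => by
      rw [hb, offset_weight, hs, lowest_eq hp (mem_children.2 ⟨Fin.succ_ne_zero e, rfl⟩)]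
      ring
  have traj : ∀ k ≤ n, ∀ v, (partialProd a b k (s v) : ℤ) = s v + offset p (weight p) v k := by
    intro k
    induction k with
    | zero => intro _ v; rw [offset_zero _ weight_zero, add_zero]; rfl
    | succ k ih =>
      intro hk v
      have ih := ih (by omega)
      refine trajectory_step (e := ⟨k, hk⟩) hinj (hlt _).ne (hjump _) (Fin.ext ?_) (Fin.ext ?_)
        (ih v)
      · exact_mod_cast (ih _).trans (hlower ⟨k, hk⟩).symm
      · exact_mod_cast (ih _).trans (hupper ⟨k, hk⟩).symm
  have hfact : IsFact a b := by
    refine ⟨hlt, Equiv.ext fun x => ?_⟩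
    obtain ⟨v, rfl⟩ := Finite.injective_iff_surjective.1 hinj x
    have h1 := traj n le_rfl v
    rw [offset_last, sum_congr rfl fun c hc => weight_of_ne (p := p) (mem_children.1 hc).1] at h1
    have h2 := size_eq hp v
    zify at h2
    by_cases hv : v = 0
    · subst hv
      have h3 : s 0 = Fin.last n := Fin.ext (by
        have := hs 0
        rw [position_zero hp] at this
        exact_mod_cast this)
      rw [h3, finRotate_last]
      rw [size_zero hp] at h2
      rw [weight_zero, h3] at h1
      rw [Fin.val_last] at h1
      have h4 : (partialProd a b n (Fin.last n) : ℤ) = 0 := by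
        push_cast at h2
        linarith
      exact Fin.ext (by rw [Fin.val_zero]; omega)
    · have h3 : (s v : ℤ) < n := by
        rw [hs]
        linarith [lowest_nonneg hp hv, position_lt hp v]
      rw [weight_of_ne hv] at h1
      refine Fin.ext ?_
      rw [finRotate_of_lt (by omega)]
      simp only
      omega
  refine ⟨a, b, hfact, ?_⟩
  have hst : ∀ v, start a b v = s v := by
    intro v
    refine Fin.cases ?_ (fun e => ?_) v
    · refine Fin.ext ?_
      have := hs 0
      rw [position_zero hp] at this
      simp
      omega
    · refine (Equiv.symm_apply_eq _).2 (Fin.ext ?_)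
      have := traj e e.2.le e.succ
      rw [← hlower] at this
      exact_mod_cast this.symm
  funext v
  refine Fin.cases hp.1.symm (fun e => ?_) v
  refine (start_bijective hfact).1 ((partialProd a b e).injective ?_)
  rw [partialProd_start_parent hfact, hst]
  refine Fin.ext ?_
  have := traj e e.2.le (p e.succ)
  rw [← hupper] at this
  exact_mod_cast this.symm

theorem swapLow_swap {m : ℕ} {a b : Fin m} (h : a < b) : swapLow (Equiv.swap a b) = a := by
  have h' : a.val < b.val := h
  rw [swapLow, Equiv.Perm.support_swap h.ne, image_insert, image_singleton, min_insert,
    min_singleton]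
  rw [← WithTop.coe_min, min_eq_left h'.le]
  rfl

theorem swapHigh_swap {m : ℕ} {a b : Fin m} (h : a < b) : swapHigh (Equiv.swap a b) = b := by
  have h' : a.val < b.val := h
  rw [swapHigh, Equiv.Perm.support_swap h.ne, image_insert, image_singleton, max_insert,
    max_singleton]
  rw [← WithBot.coe_max, max_eq_right h'.le]
  rfl

theorem partialProd_eq_prod (a b : Fin n → Fin (n+1)) :
    partialProd a b n = (List.ofFn fun e => Equiv.swap (a e) (b e)).reverse.prod := by
  have key : ∀ k ≤ n, partialProd a b k =
      ((List.ofFn fun e => Equiv.swap (a e) (b e)).take k).reverse.prod := by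
    intro k
    induction k with
    | zero => intro _; rfl
    | succ k ih =>
      intro hk
      have hl : k < (List.ofFn fun e => Equiv.swap (a e) (b e)).length := by simpa using hk
      rw [List.take_succ_eq_append_getElem hl, List.reverse_append, List.prod_append,
        ← ih (by omega), partialProd, dif_pos (Nat.lt_of_succ_le hk)]
      simp
  rw [key n le_rfl, List.take_of_length_le (by simp)]

theorem card_factorizations (n j k : ℕ) :
    Nat.card {f : Fin n → Equiv.Perm (Fin (n+1)) // f ∈ FactSet n ∧ areaL f = j ∧ areaU f = k} =
      Nat.card {p : Fin (n+1) → Fin (n+1) //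
        IsParentMap p ∧ majStat p 1 = j ∧ comajStat p 1 = k} := by
  have harea : ∀ a b : Fin n → Fin (n+1), IsFact a b →
      areaL (fun e => Equiv.swap (a e) (b e)) = majStat (parent a b) 1 ∧
      areaU (fun e => Equiv.swap (a e) (b e)) = comajStat (parent a b) 1 := by
    intro a b h
    have h1 := sum_lower h
    have h2 := sum_upper h
    rw [areaL, areaU, sum_congr rfl fun e _ => swapLow_swap (h.1 e),
      sum_congr rfl fun e _ => swapHigh_swap (h.1 e)]
    omega
  have hmem : ∀ a b : Fin n → Fin (n+1), IsFact a b →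
      (fun e => Equiv.swap (a e) (b e)) ∈ FactSet n := fun a b h =>
    ⟨fun e => ⟨_, _, (h.1 e).ne, rfl⟩, (partialProd_eq_prod a b).symm.trans h.2⟩
  have hex : ∀ f ∈ FactSet n, ∃ a b : Fin n → Fin (n+1),
      IsFact a b ∧ f = fun e => Equiv.swap (a e) (b e) := by
    rintro f ⟨hf, hprod⟩
    have : ∀ e, ∃ x y, x < y ∧ f e = Equiv.swap x y := by
      intro e
      obtain ⟨x, y, hne, h⟩ := hf e
      rcases lt_or_gt_of_ne hne with hlt | hlt
      · exact ⟨x, y, hlt, h⟩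
      · exact ⟨y, x, hlt, h.trans (Equiv.swap_comm _ _)⟩
    choose a b hab hfab using this
    obtain rfl : f = fun e => Equiv.swap (a e) (b e) := funext hfab
    exact ⟨a, b, ⟨hab, (partialProd_eq_prod a b).trans hprod⟩, rfl⟩
  symm
  have hfac : ∀ p : {p : Fin (n+1) → Fin (n+1) // IsParentMap p}, ∃ a b,
    IsFact a b ∧ parent a b = p.1 := fun p => exists_factorization p.2
  choose a b hab hpar using hfac
  refine Nat.card_eq_of_bijective (fun p => ⟨fun e => Equiv.swap (a ⟨p.1, p.2.1⟩ e)
    (b ⟨p.1, p.2.1⟩ e), hmem _ _ (hab _), ?_, ?_⟩) ⟨?_, ?_⟩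
  · rw [(harea _ _ (hab _)).1, hpar, p.2.2.1]
  · rw [(harea _ _ (hab _)).2, hpar, p.2.2.2]
  · intro p p' h
    have h := Subtype.ext_iff.1 h
    have h1 : a ⟨p.1, p.2.1⟩ = a ⟨p'.1, p'.2.1⟩ := funext fun e => Fin.ext <| by
      rw [← swapLow_swap ((hab _).1 e), ← swapLow_swap ((hab _).1 e)]
      exact congrArg swapLow (congrFun h e)
    have h2 : b ⟨p.1, p.2.1⟩ = b ⟨p'.1, p'.2.1⟩ := funext fun e => Fin.ext <| by
      rw [← swapHigh_swap ((hab _).1 e), ← swapHigh_swap ((hab _).1 e)]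
      exact congrArg swapHigh (congrFun h e)
    refine Subtype.ext ?_
    have h3 := hpar ⟨p.1, p.2.1⟩
    have h4 := hpar ⟨p'.1, p'.2.1⟩
    rw [h1, h2, h4] at h3
    exact h3.symm
  · rintro ⟨f, hf, hj, hk⟩
    obtain ⟨a', b', h, rfl⟩ := hex f hf
    rw [(harea _ _ h).1] at hj
    rw [(harea _ _ h).2] at hk
    have hp := isParentMap_parent h
    refine ⟨⟨parent a' b', hp, hj, hk⟩, Subtype.ext ?_⟩
    obtain ⟨h1, h2⟩ := parent_injective (hab ⟨_, hp⟩) h (hpar _)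
    simp only [h1, h2]

/-- The tree in which each vertex other than the root is joined to its parent. -/
def graph (p : Fin (n+1) → Fin (n+1)) : SimpleGraph (Fin (n+1)) :=
  SimpleGraph.fromRel fun u v => p u = v

theorem graph_adj {u v : Fin (n+1)} : (graph p).Adj u v ↔ u ≠ v ∧ (p u = v ∨ p v = u) :=
  SimpleGraph.fromRel_adj _ _ _

theorem adj_parent (hp : IsParentMap p) {v : Fin (n+1)} (hv : v ≠ 0) : (graph p).Adj v (p v) :=
  graph_adj.2 ⟨(ne_parent hp hv).symm, Or.inl rfl⟩

theorem exists_path (hp : IsParentMap p) (v : Fin (n+1)) :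
    ∃ q : (graph p).Path v 0, ∀ i, i ∈ q.1.support ↔ v ∈ subtree p i := by
  obtain ⟨d, hd⟩ := hp.2
  induction hm : d v using Nat.strong_induction_on generalizing v with
  | _ m ih =>
    by_cases hv : v = 0
    · subst hv
      refine ⟨SimpleGraph.Path.nil, fun i => ?_⟩
      rw [zero_mem_subtree hp]
      simp [SimpleGraph.Path.nil]
    · obtain ⟨q, hq⟩ := ih _ (hm ▸ hd v hv) (p v) rfl
      refine ⟨⟨SimpleGraph.Walk.cons (adj_parent hp hv) q.1, q.2.cons fun h =>
        notMem_subtree_parent hp hv ((hq v).1 h)⟩, fun i => ?_⟩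
      rw [SimpleGraph.Walk.support_cons, List.mem_cons, hq, mem_subtree_iff hp (u := v), eq_comm]
      tauto

theorem graph_connected (hp : IsParentMap p) : (graph p).Connected :=
  SimpleGraph.Connected.mk fun u v =>
    ((exists_path hp u).choose.1.reachable).trans (exists_path hp v).choose.1.reachable.symm

theorem graph_isTree (hp : IsParentMap p) : (graph p).IsTree := by
  classical
  rw [SimpleGraph.isTree_iff_connected_and_card]
  have hconn := graph_connected hp
  refine ⟨hconn, le_antisymm ?_ hconn.card_vert_le_card_edgeSet_add_one⟩
  have hsub : (graph p).edgeSet ⊆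
      ((univ.image fun e : Fin n => s(e.succ, p e.succ) : Finset (Sym2 (Fin (n+1)))) :
        Set (Sym2 (Fin (n+1)))) := by
    intro x
    refine Sym2.ind (fun u v => ?_) x
    intro h
    rw [SimpleGraph.mem_edgeSet, graph_adj] at h
    have key : ∀ u v : Fin (n+1), u ≠ v → p u = v → ∃ e : Fin n, s(e.succ, p e.succ) = s(u, v) := by
      rintro u v hne rfl
      have hu : u ≠ 0 := fun h => hne (by rw [h, hp.1])
      obtain ⟨e, rfl⟩ := Fin.exists_succ_eq.2 hu
      exact ⟨e, rfl⟩
    rw [mem_coe, mem_image]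
    rcases h with ⟨hne, h | h⟩
    · obtain ⟨e, he⟩ := key u v hne h
      exact ⟨e, mem_univ _, he⟩
    · obtain ⟨e, he⟩ := key v u hne.symm h
      exact ⟨e, mem_univ _, he.trans Sym2.eq_swap⟩
  rw [Nat.card_eq_fintype_card (α := Fin (n+1)), Fintype.card_fin]
  refine Nat.succ_le_succ ?_
  have h1 := Set.ncard_le_ncard hsub (Finset.finite_toSet _)
  rw [Set.ncard_coe_finset] at h1
  exact (Nat.card_coe_set_eq _).trans_le (h1.trans (card_image_le.trans (by simp)))

theorem isDesc_graph_iff (hp : IsParentMap p) {i j : Fin (n+1)} :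
    IsDesc (graph p) i j ↔ j ∈ desc p i := by
  obtain ⟨q, hq⟩ := exists_path hp j
  rw [IsDesc, mem_desc, ← hq]
  refine and_congr_right fun _ => ⟨fun h => h q, fun h q' => ?_⟩
  rwa [((graph_isTree hp).isAcyclic.subsingleton_path _ _).elim q' q]

theorem treeInv_graph (hp : IsParentMap p) : treeInv (graph p) = invStat p 1 := by
  rw [treeInv, invStat, ← card_sigma, ← Nat.card_eq_finsetCard]
  refine Nat.card_congr ⟨fun x => ⟨⟨x.1.1, x.1.2⟩, ?_⟩, fun x => ⟨(x.1.1, x.1.2), ?_⟩,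
    fun _ => rfl, fun _ => rfl⟩
  · exact mem_sigma.2 ⟨mem_univ _, mem_filter.2 ⟨(isDesc_graph_iff hp).1 x.2.1, x.2.2⟩⟩
  · have := mem_filter.1 (mem_sigma.1 x.2).2
    exact ⟨(isDesc_graph_iff hp).2 this.1, this.2⟩

theorem treeCoinv_graph (hp : IsParentMap p) : treeCoinv (graph p) = coinvStat p 1 := by
  rw [treeCoinv, coinvStat, ← card_sigma, ← Nat.card_eq_finsetCard]
  refine Nat.card_congr ⟨fun x => ⟨⟨x.1.1, x.1.2⟩, ?_⟩, fun x => ⟨(x.1.1, x.1.2), ?_⟩,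
    fun _ => rfl, fun _ => rfl⟩
  · exact mem_sigma.2 ⟨mem_univ _, mem_filter.2 ⟨(isDesc_graph_iff hp).1 x.2.1, x.2.2⟩⟩
  · have := mem_filter.1 (mem_sigma.1 x.2).2
    exact ⟨(isDesc_graph_iff hp).2 this.1, this.2⟩

theorem graph_injective {p' : Fin (n+1) → Fin (n+1)} (hp : IsParentMap p) (hp' : IsParentMap p')
    (h : graph p = graph p') : p = p' := by
  have hdesc : ∀ i, desc p i = desc p' i := fun i => by
    ext j
    rw [← isDesc_graph_iff hp, ← isDesc_graph_iff hp', h]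
  have key : ∀ {p p' : Fin (n+1) → Fin (n+1)}, IsParentMap p → IsParentMap p' →
      (∀ i, desc p i = desc p' i) → ∀ {v}, v ≠ 0 → p v ∈ subtree p (p' v) := by
    intro p p' hp hp' hdesc v hv
    have : v ∈ desc p' (p' v) := (mem_desc_iff hp').2 ⟨hv, self_mem_subtree _⟩
    rw [← hdesc] at this
    exact ((mem_desc_iff hp).1 this).2
  have hsub : ∀ i, subtree p i = subtree p' i := fun i => by
    rw [← insert_erase (self_mem_subtree (p := p) i), ← insert_erase (self_mem_subtree (p := p') i)]
    exact congrArg _ (hdesc i)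
  funext v
  by_cases hv : v = 0
  · rw [hv, hp.1, hp'.1]
  · refine subtree_antisymm hp (key hp hp' hdesc hv) ?_
    rw [hsub]
    exact key hp' hp (fun i => (hdesc i).symm) hv

theorem exists_graph_eq {T : SimpleGraph (Fin (n+1))} (hT : T.IsTree) :
    ∃ p, IsParentMap p ∧ graph p = T := by
  have hnext : ∀ v, v ≠ 0 → ∃ w, T.Adj v w ∧ T.dist w 0 < T.dist v 0 := by
    intro v hv
    obtain ⟨q, hq⟩ := hT.connected.exists_walk_length_eq_dist v 0
    cases q with
    | nil => exact absurd rfl hv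
    | cons hadj q' =>
      refine ⟨_, hadj, ?_⟩
      have := SimpleGraph.dist_le q'
      rw [SimpleGraph.Walk.length_cons] at hq
      omega
  choose! g hadj hdist using hnext
  have hg : ∀ v, v ≠ 0 → Function.update g 0 0 v = g v := fun v hv => Function.update_of_ne hv _ _
  have hp : IsParentMap (Function.update g 0 0) :=
    ⟨Function.update_self _ _ _, fun v => T.dist v 0, fun v hv => by
      rw [hg v hv]
      exact hdist v hv⟩
  refine ⟨_, hp, ?_⟩
  have hle : graph (Function.update g 0 0) ≤ T := by
    intro u v h
    obtain ⟨hne, h⟩ := graph_adj.1 h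
    have key : ∀ u v, u ≠ v → Function.update g 0 0 u = v → T.Adj u v := by
      rintro u v hne h
      have hu : u ≠ 0 := fun h' => hne (by rw [← h, h', hp.1])
      rw [hg u hu] at h
      exact h ▸ hadj u hu
    rcases h with h | h
    · exact key u v hne h
    · exact (key v u hne.symm h).symm
  exact le_antisymm hle
    ((SimpleGraph.isTree_iff_minimal_connected.1 hT).2 (graph_connected hp) hle)

theorem card_trees (n j k : ℕ) :
    Nat.card {T : SimpleGraph (Fin (n+1)) // T.IsTree ∧ treeInv T = j ∧ treeCoinv T = k} =
      Nat.card {p : Fin (n+1) → Fin (n+1) //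
        IsParentMap p ∧ invStat p 1 = j ∧ coinvStat p 1 = k} := by
  symm
  refine Nat.card_eq_of_bijective (fun p => ⟨graph p.1, graph_isTree p.2.1,
    (treeInv_graph p.2.1).trans p.2.2.1, (treeCoinv_graph p.2.1).trans p.2.2.2⟩) ⟨?_, ?_⟩
  · exact fun p p' h => Subtype.ext (graph_injective p.2.1 p'.2.1 (Subtype.ext_iff.1 h))
  · rintro ⟨T, hT, hj, hk⟩
    obtain ⟨p, hp, rfl⟩ := exists_graph_eq hT
    exact ⟨⟨p, hp, (treeInv_graph hp).symm.trans hj, (treeCoinv_graph hp).symm.trans hk⟩, rfl⟩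

theorem card_maj_comaj_subtype (n j k : ℕ) :
    Nat.card {p : Fin (n+1) → Fin (n+1) // IsParentMap p ∧ majStat p 1 = j ∧ comajStat p 1 = k} =
      Nat.card {p : Fin (n+1) → Fin (n+1) //
        IsParentMap p ∧ invStat p 1 = j ∧ coinvStat p 1 = k} := by
  classical
  rw [Nat.card_eq_fintype_card, Nat.card_eq_fintype_card, Fintype.card_subtype,
    Fintype.card_subtype]
  convert card_maj_comaj_eq_card_inv_coinv n j k

end IsParentMap

/-- **Main theorem.** For every `n ≥ 0` and all `j, k`, the number of trees on `{0,…,n}`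
with `inv(T) = j` and `coinv(T) = k` equals the number of minimal factorizations
`f` of `σ_n` with `area_L(f) = j` and `area_U(f) = k`; i.e. the bi-statistics
`(inv, coinv)` and `(area_L, area_U)` have the same joint distribution. -/
theorem inv_coinv_jointly_equidistributed_with_areaL_areaU (n j k : ℕ) :
    Nat.card {T : SimpleGraph (Fin (n+1)) //
        T.IsTree ∧ treeInv T = j ∧ treeCoinv T = k} =
      Nat.card {f : Fin n → Equiv.Perm (Fin (n+1)) //
        f ∈ FactSet n ∧ areaL f = j ∧ areaU f = k} := by
  rw [IsParentMap.card_trees, IsParentMap.card_factorizations, IsParentMap.card_maj_comaj_subtype]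
end

section
/- The bivariate inversion enumerators of trees satisfy the recursion I_{n+1}(q,t) = ∑_{i=0}^n C(n,i) · t · (t^i + t^{i−1}q + t^{i−2}q^2 + ⋯ + q^i) · I_i(q,t) · I_{n−i}(q,t) for all n ≥ 0, with I_0(q,t) = 1. -/
open Finset MvPolynomial

attribute [local instance] Classical.propDecidable

/-- The bivariate inversion enumerator `I_n(q,t) = ∑_{T ∈ T_n} q^{inv T} t^{coinv T}`,
an element of `ℤ[q,t]` with `q = X 0` and `t = X 1`. -/
noncomputable def Ipoly (n : ℕ) : MvPolynomial (Fin 2) ℤ :=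
  ∑ T : {T : SimpleGraph (Fin (n+1)) // T.IsTree},
    X 0 ^ treeInv T.1 * X 1 ^ treeCoinv T.1

/-- In the graph `G`, the vertex `i` separates `j ≠ i` from the root `r`. -/
def IsDescOf {V : Type*} (G : SimpleGraph V) (r j i : V) : Prop :=
  j ≠ i ∧ ∀ p : G.Path j r, i ∈ p.1.support

/-- A strict order with greatest element `r` in which the elements above any given one
form a chain. -/
structure IsTreeOrder {V : Type*} (r : V) (L : V → V → Prop) : Prop where
  irrefl : ∀ a, ¬ L a a
  trans : ∀ a b c, L a b → L b c → L a c
  chain : ∀ a b c, L a b → L a c → b = c ∨ L b c ∨ L c b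
  top : ∀ a, a ≠ r → L a r

/-- `b` covers `a` with respect to the strict order `L`. -/
def Covers {V : Type*} (L : V → V → Prop) (a b : V) : Prop :=
  L a b ∧ ∀ c, L a c → ¬ L c b

namespace IsDescOf

variable {V : Type*} {G : SimpleGraph V} {r : V}

lemma irrefl (a : V) : ¬ IsDescOf G r a a := fun h => h.1 rfl

lemma not_root (i : V) : ¬ IsDescOf G r r i := by
  rintro ⟨h1, h2⟩
  have := h2 SimpleGraph.Path.nil
  rw [SimpleGraph.Path.nil_coe, SimpleGraph.Walk.support_nil, List.mem_singleton] at this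
  exact h1 this.symm

lemma to_root {a : V} (ha : a ≠ r) : IsDescOf G r a r :=
  ⟨ha, fun p => p.1.end_mem_support⟩

lemma iff_of_adj (hG : G.IsTree) {a b : V} (hab : G.Adj a b) (h : ¬ IsDescOf G r b a) (i : V) :
    IsDescOf G r a i ↔ i = b ∨ IsDescOf G r b i := by
  have h' : ∃ p : G.Path b r, a ∉ p.1.support := by
    by_contra! hc
    exact h ⟨hab.ne', hc⟩
  obtain ⟨p, hp⟩ := h'
  have hb : ∀ p' : G.Path b r, p' = p := fun p' => (hG.isAcyclic.subsingleton_path b r).elim p' p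
  have ha : ∀ p' : G.Path a r, p' = ⟨_, p.2.cons hp (h := hab)⟩ := fun p' =>
    (hG.isAcyclic.subsingleton_path a r).elim p' _
  constructor
  · rintro ⟨h1, h2⟩
    have := h2 ⟨_, p.2.cons hp (h := hab)⟩
    simp only [SimpleGraph.Walk.support_cons, List.mem_cons] at this
    by_cases hib : i = b
    · exact Or.inl hib
    · refine Or.inr ⟨fun h => hib h.symm, fun p' => ?_⟩
      rw [hb p']
      exact this.resolve_left (fun h => h1 h.symm)
  · rintro (rfl | ⟨h1, h2⟩)
    · refine ⟨hab.ne, fun p' => ?_⟩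
      rw [ha p']
      simp
    · refine ⟨fun hai => hp (hai ▸ h2 p), fun p' => ?_⟩
      rw [ha p']
      simp [h2 p]

lemma exists_parent (hG : G.IsTree) {a : V} (ha : a ≠ r) :
    ∃ b, G.Adj a b ∧ ∀ i, IsDescOf G r a i ↔ i = b ∨ IsDescOf G r b i := by
  obtain ⟨p, hp⟩ := (hG.connected.preconnected a r).exists_isPath
  cases p with
  | nil => exact absurd rfl ha
  | @cons _ b _ h p =>
    rw [SimpleGraph.Walk.cons_isPath_iff] at hp
    exact ⟨b, h, iff_of_adj hG h fun hd => hp.2 (hd.2 ⟨p, hp.1⟩)⟩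

lemma induction [Finite V] (hG : G.IsTree) {P : V → Prop} (root : P r)
    (step : ∀ a b, G.Adj a b → (∀ i, IsDescOf G r a i ↔ i = b ∨ IsDescOf G r b i) → P b → P a)
    (a : V) : P a := by
  induction hn : {i | IsDescOf G r a i}.ncard using Nat.strong_induction_on generalizing a with
  | _ n ih =>
    by_cases ha : a = r
    · exact ha ▸ root
    · obtain ⟨b, hab, h⟩ := exists_parent hG ha
      refine step a b hab h (ih _ ?_ b rfl)
      rw [← hn]
      refine Set.ncard_lt_ncard ⟨fun i hi => (h i).2 (Or.inr hi), fun hs => ?_⟩ (Set.toFinite _)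
      exact irrefl b (hs ((h b).2 (Or.inl rfl)))

lemma isTreeOrder [Finite V] (hG : G.IsTree) : IsTreeOrder r (IsDescOf G r) where
  irrefl := irrefl
  top _ := to_root
  trans a b c hab hbc := by
    induction a using induction hG (r := r) with
    | root => exact absurd hab (not_root b)
    | step a u _ h ih =>
      rcases (h b).1 hab with rfl | hub
      · exact (h c).2 (Or.inr hbc)
      · exact (h c).2 (Or.inr (ih hub))
  chain a b c hab hac := by
    induction a using induction hG (r := r) with
    | root => exact absurd hab (not_root b)
    | step a u _ h ih =>
      rcases (h b).1 hab with rfl | hub <;> rcases (h c).1 hac with rfl | huc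
      · exact Or.inl rfl
      · exact Or.inr (Or.inl huc)
      · exact Or.inr (Or.inr hub)
      · exact ih hub huc

lemma adj_iff_covers [Finite V] (hG : G.IsTree) (a b : V) :
    G.Adj a b ↔ Covers (IsDescOf G r) a b ∨ Covers (IsDescOf G r) b a := by
  have hT := isTreeOrder (r := r) hG
  have key : ∀ a b, G.Adj a b → ¬ IsDescOf G r b a → Covers (IsDescOf G r) a b := by
    intro a b hab hn
    have h := iff_of_adj hG hab hn
    refine ⟨(h b).2 (Or.inl rfl), fun c hac hcb => ?_⟩
    rcases (h c).1 hac with rfl | hbc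
    · exact irrefl _ hcb
    · exact irrefl _ (hT.trans _ _ _ hbc hcb)
  have key' : ∀ a b, Covers (IsDescOf G r) a b → G.Adj a b := by
    rintro a b ⟨hab, hc⟩
    have ha : a ≠ r := by rintro rfl; exact not_root b hab
    obtain ⟨u, hau, h⟩ := exists_parent hG ha
    rcases (h b).1 hab with rfl | hub
    · exact hau
    · exact absurd hub (hc u ((h u).2 (Or.inl rfl)))
  constructor
  · intro hab
    by_cases hn : IsDescOf G r b a
    · exact Or.inr (key b a hab.symm fun h => irrefl _ (hT.trans _ _ _ hn h))
    · exact Or.inl (key a b hab hn)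
  · rintro (h | h)
    · exact key' a b h
    · exact (key' b a h).symm

end IsDescOf

namespace IsTreeOrder

variable {V : Type*} {r : V} {L : V → V → Prop}

/-- The graph joining each element of a tree order to the elements covering it. -/
def graph (L : V → V → Prop) (irrefl : ∀ a, ¬ L a a) : SimpleGraph V where
  Adj a b := Covers L a b ∨ Covers L b a
  symm := ⟨fun _ _ h => h.symm⟩
  loopless := ⟨fun a h => irrefl a (h.elim And.left And.left)⟩

lemma eq_of_adj (h : IsTreeOrder r L) {a b i : V} (hab : (graph L h.irrefl).Adj a b)
    (ha : a = i ∨ L a i) (hb : ¬ (b = i ∨ L b i)) : a = i ∧ Covers L a b := by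
  push Not at hb
  rcases hab with hab | hba
  · refine ⟨?_, hab⟩
    by_contra hai
    have hL := ha.resolve_left hai
    rcases h.chain a b i hab.1 hL with h1 | h1 | h1
    · exact hb.1 h1
    · exact hb.2 h1
    · exact hab.2 i hL h1
  · rcases ha with rfl | ha
    · exact absurd hba.1 hb.2
    · exact absurd (h.trans _ _ _ hba.1 ha) hb.2

lemma not_root (h : IsTreeOrder r L) (a : V) : ¬ L r a := by
  intro hr
  by_cases ha : a = r
  · exact h.irrefl r (ha ▸ hr)
  · exact h.irrefl r (h.trans _ _ _ hr (h.top a ha))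

lemma wellFounded_swap [Finite V] (h : IsTreeOrder r L) : WellFounded (fun a b => L b a) :=
  haveI : IsTrans V (fun a b => L b a) := ⟨fun _ _ _ h1 h2 => h.trans _ _ _ h2 h1⟩
  haveI : Std.Irrefl (fun a b => L b a) := ⟨h.irrefl⟩
  Finite.wellFounded_of_trans_of_irrefl _

lemma wellFounded [Finite V] (h : IsTreeOrder r L) : WellFounded L :=
  haveI : IsTrans V L := ⟨h.trans⟩
  haveI : Std.Irrefl L := ⟨h.irrefl⟩
  Finite.wellFounded_of_trans_of_irrefl _

lemma exists_covers [Finite V] (h : IsTreeOrder r L) {a : V} (ha : a ≠ r) : ∃ b, Covers L a b := by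
  obtain ⟨b, hb, hmin⟩ := h.wellFounded.has_min {b | L a b} ⟨r, h.top a ha⟩
  exact ⟨b, hb, hmin⟩

lemma exists_walk [Finite V] (h : IsTreeOrder r L) (a : V) :
    ∃ p : (graph L h.irrefl).Walk a r, ∀ i ∈ p.support, i = a ∨ L a i := by
  induction a using h.wellFounded_swap.induction with
  | _ a ih =>
    by_cases ha : a = r
    · subst ha
      exact ⟨.nil, by simp⟩
    · obtain ⟨b, hb⟩ := h.exists_covers ha
      obtain ⟨p, hp⟩ := ih b hb.1
      have hab : (graph L h.irrefl).Adj a b := Or.inl hb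
      refine ⟨.cons hab p, fun i hi => ?_⟩
      rw [SimpleGraph.Walk.support_cons, List.mem_cons] at hi
      rcases hi with hi | hi
      · exact Or.inl hi
      · rcases hp i hi with rfl | hi
        · exact Or.inr hb.1
        · exact Or.inr (h.trans _ _ _ hb.1 hi)

lemma mem_support (h : IsTreeOrder r L) {a b i : V} (p : (graph L h.irrefl).Walk a b)
    (ha : a = i ∨ L a i) (hb : ¬ L b i) : i ∈ p.support := by
  induction p with
  | nil => simp [ha.resolve_right hb]
  | @cons a c b hac p ih =>
    by_cases hc : c = i ∨ L c i
    · exact List.mem_cons_of_mem _ (ih hc hb)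
    · simp [(h.eq_of_adj hac ha hc).1]

lemma isDescOf_graph_iff [Finite V] (h : IsTreeOrder r L) (j i : V) :
    IsDescOf (graph L h.irrefl) r j i ↔ L j i := by
  constructor
  · rintro ⟨hne, hp⟩
    obtain ⟨p, hp'⟩ := h.exists_walk j
    have := p.support_toPath_subset_support (hp p.toPath)
    exact (hp' i this).resolve_left fun h => hne h.symm
  · intro hL
    exact ⟨fun e => h.irrefl i (e ▸ hL), fun p => h.mem_support p.1 (Or.inr hL) (h.not_root i)⟩

lemma isTree_graph [Finite V] (h : IsTreeOrder r L) : (graph L h.irrefl).IsTree := by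
  have hr : ∀ a, (graph L h.irrefl).Reachable a r := fun a => ⟨(h.exists_walk a).choose⟩
  refine ⟨{ preconnected := fun a b => (hr a).trans (hr b).symm, nonempty := ⟨r⟩ }, ?_⟩
  rw [SimpleGraph.isAcyclic_iff_forall_adj_isBridge]
  have key : ∀ a b, Covers L a b → (graph L h.irrefl).IsBridge s(a, b) := by
    intro a b hab
    rw [SimpleGraph.isBridge_iff]
    rintro ⟨p⟩
    have hb : ¬ (b = a ∨ L b a) := by
      rintro (rfl | hb)
      · exact h.irrefl _ hab.1
      · exact h.irrefl _ (h.trans _ _ _ hb hab.1)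
    have step : ∀ x y (_ : ((graph L h.irrefl).deleteEdges {s(a, b)}).Walk x y),
        x = a ∨ L x a → y = a ∨ L y a := by
      intro x y p hx
      induction p with
      | nil => exact hx
      | @cons x z y hxz p ih =>
        refine ih ?_
        by_contra hz
        rw [SimpleGraph.deleteEdges_adj] at hxz
        obtain ⟨rfl, hxz'⟩ := h.eq_of_adj hxz.1 hx hz
        rcases h.chain x b z hab.1 hxz'.1 with rfl | h1 | h1
        · exact hxz.2 rfl
        · exact hxz'.2 b hab.1 h1
        · exact hab.2 z hxz'.1 h1
    exact hb (step a b p (Or.inl rfl))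
  rintro a b (hab | hab)
  · exact key a b hab
  · rw [Sym2.eq_swap]
    exact key b a hab

end IsTreeOrder

/-- `R` is a strict order on `S`, given by its set of pairs, in which the elements above any
given one form a chain: the descendant relation of a rooted forest on `S`. -/
structure IsForestOn {α : Type*} (S : Finset α) (R : Finset (α × α)) : Prop where
  subset : R ⊆ S ×ˢ S
  irrefl : ∀ a, (a, a) ∉ R
  trans : ∀ a b c, (a, b) ∈ R → (b, c) ∈ R → (a, c) ∈ R
  chain : ∀ a b c, (a, b) ∈ R → (a, c) ∈ R → b = c ∨ (b, c) ∈ R ∨ (c, b) ∈ R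

/-- The rooted forests on `S`. -/
noncomputable def forests {α : Type*} (S : Finset α) : Finset (Finset (α × α)) :=
  {R ∈ (S ×ˢ S).powerset | IsForestOn S R}

lemma mem_forests {α : Type*} {S : Finset α} {R : Finset (α × α)} :
    R ∈ forests S ↔ IsForestOn S R := by
  simp only [forests, mem_filter, mem_powerset, and_iff_right_iff_imp]
  exact fun h => h.subset

/-- The weight of a pair `(descendant, ancestor)`. -/
noncomputable def pairWeight {α : Type*} [LinearOrder α] (p : α × α) : MvPolynomial (Fin 2) ℤ :=
  if p.1 < p.2 then X 0 else X 1

/-- The bivariate inversion enumerator of the rooted forests on `S`. -/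
noncomputable def forestSum {α : Type*} [LinearOrder α] (S : Finset α) :
    MvPolynomial (Fin 2) ℤ :=
  ∑ R ∈ forests S, ∏ p ∈ R, pairWeight p

lemma prod_pairWeight {α : Type*} [LinearOrder α] (R : Finset (α × α)) :
    ∏ p ∈ R, pairWeight p = X 0 ^ #{p ∈ R | p.1 < p.2} * X 1 ^ #{p ∈ R | ¬ p.1 < p.2} := by
  simp only [pairWeight]
  rw [prod_ite, prod_const, prod_const]

section Glue

variable {α : Type*}

/-- The forest with a tree on `C` rooted at `r`, whose branches form the forest `R₁`, and with
further trees forming the forest `R₂`. -/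
noncomputable def glue (C : Finset α) (r : α) (R₁ R₂ : Finset (α × α)) : Finset (α × α) :=
  (C.erase r ×ˢ {r}) ∪ (R₁ ∪ R₂)

lemma mem_glue {C : Finset α} {r : α} {R₁ R₂ : Finset (α × α)} {a b : α} :
    (a, b) ∈ glue C r R₁ R₂ ↔ (a ≠ r ∧ a ∈ C ∧ b = r) ∨ (a, b) ∈ R₁ ∨ (a, b) ∈ R₂ := by
  simp only [glue, mem_union, mem_product, mem_erase, mem_singleton, and_assoc]

variable {S C : Finset α} {r : α} {R R₁ R₂ : Finset (α × α)}

lemma IsForestOn.mem (h : IsForestOn S R) {a b : α} (hab : (a, b) ∈ R) : a ∈ S ∧ b ∈ S :=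
  mem_product.1 (h.subset hab)

lemma isForestOn_glue (hC : C ⊆ S) (hr : r ∈ C) (h₁ : IsForestOn (C.erase r) R₁)
    (h₂ : IsForestOn (S \ C) R₂) : IsForestOn S (glue C r R₁ R₂) := by
  have m₁ : ∀ a b, (a, b) ∈ R₁ → a ≠ r ∧ a ∈ C ∧ b ≠ r ∧ b ∈ C := by
    intro a b h; have := h₁.mem h; grind
  have m₂ : ∀ a b, (a, b) ∈ R₂ → a ∈ S ∧ a ∉ C ∧ b ∈ S ∧ b ∉ C := by
    intro a b h; have := h₂.mem h; grind
  constructor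
  · rintro ⟨a, b⟩ h
    rw [mem_glue] at h
    rw [mem_product]
    grind
  · intro a
    rw [mem_glue]
    have := h₁.irrefl a
    have := h₂.irrefl a
    grind
  · intro a b c
    simp only [mem_glue]
    have := h₁.trans a b c
    have := h₂.trans a b c
    grind
  · intro a b c
    simp only [mem_glue]
    have := h₁.chain a b c
    have := h₂.chain a b c
    grind

lemma mem_iff_glue (hr : r ∈ C) (h₁ : IsForestOn (C.erase r) R₁)
    (h₂ : IsForestOn (S \ C) R₂) (a : α) : a ∈ C ↔ a = r ∨ (a, r) ∈ glue C r R₁ R₂ := by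
  rw [mem_glue]
  have := h₁.mem (a := a) (b := r)
  have := h₂.mem (a := a) (b := r)
  grind

lemma not_mem_glue (hr : r ∈ C) (h₁ : IsForestOn (C.erase r) R₁)
    (h₂ : IsForestOn (S \ C) R₂) (a : α) : (r, a) ∉ glue C r R₁ R₂ := by
  rw [mem_glue]
  have := h₁.mem (a := r) (b := a)
  have := h₂.mem (a := r) (b := a)
  grind

lemma left_iff_glue (h₁ : IsForestOn (C.erase r) R₁)
    (h₂ : IsForestOn (S \ C) R₂) (a b : α) :
    (a, b) ∈ R₁ ↔ (a, b) ∈ glue C r R₁ R₂ ∧ a ∈ C ∧ b ≠ r := by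
  rw [mem_glue]
  have := h₁.mem (a := a) (b := b)
  have := h₂.mem (a := a) (b := b)
  grind

lemma right_iff_glue (h₁ : IsForestOn (C.erase r) R₁)
    (h₂ : IsForestOn (S \ C) R₂) (a b : α) :
    (a, b) ∈ R₂ ↔ (a, b) ∈ glue C r R₁ R₂ ∧ a ∉ C := by
  rw [mem_glue]
  have := h₁.mem (a := a) (b := b)
  have := h₂.mem (a := a) (b := b)
  grind

lemma glue_injective {m : α} {C' : Finset α} {r' : α} {R₁' R₂' : Finset (α × α)}
    (hm : m ∈ C) (hr : r ∈ C) (h₁ : IsForestOn (C.erase r) R₁) (h₂ : IsForestOn (S \ C) R₂)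
    (hm' : m ∈ C') (hr' : r' ∈ C') (h₁' : IsForestOn (C'.erase r') R₁')
    (h₂' : IsForestOn (S \ C') R₂') (hC : C ⊆ S)
    (h : glue C r R₁ R₂ = glue C' r' R₁' R₂') : C = C' ∧ r = r' ∧ R₁ = R₁' ∧ R₂ = R₂' := by
  have e : r = r' := by
    have f := isForestOn_glue hC hr h₁ h₂
    have a := (mem_iff_glue hr h₁ h₂ m).1 hm
    have a' := (mem_iff_glue hr' h₁' h₂' m).1 hm'
    have b := not_mem_glue hr h₁ h₂ r'
    have b' := not_mem_glue hr' h₁' h₂' r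
    rw [← h] at a' b'
    have c := f.chain m r r'
    grind
  subst e
  have eC : C = C' := by
    ext a
    rw [mem_iff_glue hr h₁ h₂, mem_iff_glue hr' h₁' h₂', h]
  subst eC
  refine ⟨rfl, rfl, ?_, ?_⟩
  · ext ⟨a, b⟩
    rw [left_iff_glue h₁ h₂, left_iff_glue h₁' h₂', h]
  · ext ⟨a, b⟩
    rw [right_iff_glue h₁ h₂, right_iff_glue h₁' h₂', h]

lemma IsForestOn.exists_root (h : IsForestOn S R) {m : α} (hm : m ∈ S) :
    ∃ r ∈ S, (m = r ∨ (m, r) ∈ R) ∧ ∀ a, (r, a) ∉ R := by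
  induction hn : #{a ∈ S | (m, a) ∈ R} using Nat.strong_induction_on generalizing m with
  | _ n ih =>
    by_cases hR : ∃ b, (m, b) ∈ R
    · obtain ⟨b, hb⟩ := hR
      have hbS := (h.mem hb).2
      obtain ⟨r, hrS, hr, hmax⟩ := ih _ (by
        rw [← hn]
        refine card_lt_card ⟨fun a ha => ?_, fun hs => ?_⟩
        · rw [mem_filter] at ha ⊢
          exact ⟨ha.1, h.trans _ _ _ hb ha.2⟩
        · exact h.irrefl b (mem_filter.1 (hs (mem_filter.2 ⟨hbS, hb⟩))).2) hbS rfl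
      refine ⟨r, hrS, Or.inr ?_, hmax⟩
      rcases hr with rfl | hr
      · exact hb
      · exact h.trans _ _ _ hb hr
    · exact ⟨m, hm, Or.inl rfl, fun a ha => hR ⟨a, ha⟩⟩

lemma IsForestOn.filter {T : Finset α} (h : IsForestOn S R) :
    IsForestOn T {p ∈ R | p.1 ∈ T ∧ p.2 ∈ T} where
  subset p hp := by
    rw [mem_filter] at hp
    exact mem_product.2 hp.2
  irrefl a ha := h.irrefl a (mem_filter.1 ha).1
  trans a b c := by
    simp only [mem_filter]
    have := h.trans a b c
    grind
  chain a b c := by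
    simp only [mem_filter]
    have := h.chain a b c
    grind

lemma IsForestOn.eq_glue (h : IsForestOn S R) (hmax : ∀ a, (r, a) ∉ R)
    (hC : ∀ a, a ∈ C ↔ a = r ∨ (a, r) ∈ R) :
    R = glue C r {p ∈ R | p.1 ∈ C.erase r ∧ p.2 ∈ C.erase r}
      {p ∈ R | p.1 ∈ S \ C ∧ p.2 ∈ S \ C} := by
  ext ⟨a, b⟩
  rw [mem_glue]
  simp only [mem_filter, mem_erase, mem_sdiff, hC]
  have := h.trans a b r
  have := h.chain a b r
  have := hmax a
  have := hmax b
  have := h.mem (a := a) (b := b)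
  have := h.irrefl r
  grind

lemma prod_glue {M : Type*} [CommMonoid M] (f : α × α → M)
    (h₁ : IsForestOn (C.erase r) R₁) (h₂ : IsForestOn (S \ C) R₂) :
    ∏ p ∈ glue C r R₁ R₂, f p =
      (∏ a ∈ C.erase r, f (a, r)) * ((∏ p ∈ R₁, f p) * ∏ p ∈ R₂, f p) := by
  rw [glue, prod_union, prod_union, prod_product]
  · simp
  · rw [disjoint_left]
    rintro ⟨a, b⟩ h h'
    have := h₁.mem h
    have := h₂.mem h'
    grind
  · rw [disjoint_left]
    rintro ⟨a, b⟩ h h'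
    rw [mem_union] at h'
    have := h₁.mem (a := a) (b := b)
    have := h₂.mem (a := a) (b := b)
    simp only [mem_product, mem_singleton] at h
    grind

end Glue

lemma isForestOn_map {α β : Type*} (f : α ↪ β) {S : Finset α} {R : Finset (α × α)} :
    IsForestOn (S.map f) (R.map (f.prodMap f)) ↔ IsForestOn S R := by
  have hmem : ∀ a b, (f a, f b) ∈ R.map (f.prodMap f) ↔ (a, b) ∈ R := fun a b =>
    mem_map' (f.prodMap f) (a := (a, b))
  have hsub : R.map (f.prodMap f) ⊆ S.map f ×ˢ S.map f ↔ R ⊆ S ×ˢ S := by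
    constructor
    · rintro h ⟨a, b⟩ hab
      simpa using h ((hmem a b).2 hab)
    · intro h x hx
      obtain ⟨⟨a, b⟩, hab, rfl⟩ := mem_map.1 hx
      simpa using h hab
  have hex : ∀ x y, (x, y) ∈ R.map (f.prodMap f) → ∃ a b, f a = x ∧ f b = y := by
    intro x y h
    obtain ⟨⟨a, b⟩, -, h⟩ := mem_map.1 h
    exact ⟨a, b, congrArg Prod.fst h, congrArg Prod.snd h⟩
  constructor
  · intro h
    refine ⟨hsub.1 h.subset, fun a ha => h.irrefl (f a) ((hmem a a).2 ha), fun a b c hab hbc => ?_,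
      fun a b c hab hac => ?_⟩
    · exact (hmem _ _).1 (h.trans _ _ _ ((hmem _ _).2 hab) ((hmem _ _).2 hbc))
    · simpa only [hmem, f.injective.eq_iff] using
        h.chain _ _ _ ((hmem _ _).2 hab) ((hmem _ _).2 hac)
  · intro h
    refine ⟨hsub.2 h.subset, fun x hx => ?_, fun x y z hxy hyz => ?_, fun x y z hxy hxz => ?_⟩
    · obtain ⟨a, -, rfl, -⟩ := hex _ _ hx
      exact h.irrefl a ((hmem a a).1 hx)
    · obtain ⟨a, b, rfl, rfl⟩ := hex _ _ hxy
      obtain ⟨-, c, -, rfl⟩ := hex _ _ hyz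
      rw [hmem] at hxy hyz ⊢
      exact h.trans _ _ _ hxy hyz
    · obtain ⟨a, b, rfl, rfl⟩ := hex _ _ hxy
      obtain ⟨-, c, -, rfl⟩ := hex _ _ hxz
      simp only [hmem, f.injective.eq_iff] at hxy hxz ⊢
      exact h.chain _ _ _ hxy hxz

section ForestSum

variable {α β : Type*} [LinearOrder α] [LinearOrder β]

lemma forestSum_eq (S : Finset α) {m : α} (hm : m ∈ S) :
    forestSum S = ∑ C ∈ S.powerset with m ∈ C, ∑ r ∈ C,
      (∏ a ∈ C.erase r, pairWeight (a, r)) * (forestSum (C.erase r) * forestSum (S \ C)) := by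
  simp_rw [forestSum, sum_mul_sum, ← sum_product', mul_sum]
  rw [sum_sigma', sum_sigma']
  symm
  refine sum_bij (fun x _ => glue x.1.1 x.1.2 x.2.1 x.2.2) ?_ ?_ ?_ ?_
  · rintro ⟨⟨C, r⟩, R₁, R₂⟩ hx
    simp only [mem_sigma, mem_filter, mem_powerset, mem_product, mem_forests] at hx ⊢
    exact isForestOn_glue hx.1.1.1 hx.1.2 hx.2.1 hx.2.2
  · rintro ⟨⟨C, r⟩, R₁, R₂⟩ hx ⟨⟨C', r'⟩, R₁', R₂'⟩ hx' h
    simp only [mem_sigma, mem_filter, mem_powerset, mem_product, mem_forests] at hx hx'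
    obtain ⟨rfl, rfl, rfl, rfl⟩ := glue_injective hx.1.1.2 hx.1.2 hx.2.1 hx.2.2
      hx'.1.1.2 hx'.1.2 hx'.2.1 hx'.2.2 hx.1.1.1 h
    rfl
  · intro R hR
    rw [mem_forests] at hR
    obtain ⟨r, hrS, hr, hmax⟩ := hR.exists_root hm
    have hC : ∀ a, a ∈ ({a ∈ S | a = r ∨ (a, r) ∈ R} : Finset α) ↔ a = r ∨ (a, r) ∈ R := by
      intro a
      have := hR.mem (a := a) (b := r)
      rw [mem_filter]
      grind
    refine ⟨⟨⟨_, r⟩, _, _⟩, ?_, (hR.eq_glue hmax hC).symm⟩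
    simp only [mem_sigma, mem_filter, mem_powerset, mem_product, mem_forests]
    exact ⟨⟨⟨filter_subset _ _, (hC m).2 hr⟩, (hC r).2 (Or.inl rfl)⟩, hR.filter, hR.filter⟩
  · rintro ⟨⟨C, r⟩, R₁, R₂⟩ hx
    simp only [mem_sigma, mem_product, mem_forests] at hx
    exact (prod_glue _ hx.2.1 hx.2.2).symm

lemma forestSum_map (f : α ↪o β) (S : Finset α) :
    forestSum (S.map f.toEmbedding) = forestSum S := by
  symm
  refine sum_bij (fun R _ => R.map (f.toEmbedding.prodMap f.toEmbedding)) ?_ ?_ ?_ ?_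
  · intro R hR
    rw [mem_forests] at hR ⊢
    exact (isForestOn_map _).2 hR
  · exact fun R _ R' _ h => map_injective _ h
  · intro R hR
    rw [mem_forests] at hR
    have : R ⊆ (S ×ˢ S).map (f.toEmbedding.prodMap f.toEmbedding) := by
      rintro ⟨x, y⟩ hxy
      obtain ⟨⟨a, ha, rfl⟩, b, hb, rfl⟩ := (hR.mem hxy).imp mem_map.1 mem_map.1
      exact mem_map.2 ⟨(a, b), mem_product.2 ⟨ha, hb⟩, rfl⟩
    obtain ⟨R', -, rfl⟩ := subset_map_iff.1 this
    exact ⟨R', mem_forests.2 ((isForestOn_map _).1 hR), rfl⟩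
  · intro R hR
    simp [pairWeight]

lemma forestSum_eq_card (S : Finset α) :
    forestSum S = forestSum (univ : Finset (Fin #S)) := by
  rw [← forestSum_map (S.orderEmbOfFin rfl) univ, map_orderEmbOfFin_univ]

lemma sum_prod_pairWeight (C : Finset α) :
    ∑ r ∈ C, ∏ a ∈ C.erase r, pairWeight (a, r) =
      ∑ j ∈ range #C, X 1 ^ (#C - 1 - j) * X 0 ^ j := by
  induction C using Finset.induction_on_max with
  | empty => simp
  | insert M C hM ih =>
    have hMC : M ∉ C := fun h => lt_irrefl _ (hM M h)
    rw [sum_insert hMC, erase_insert hMC, card_insert_of_notMem hMC, sum_range_succ, add_comm]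
    congr 1
    · calc ∑ r ∈ C, ∏ a ∈ (insert M C).erase r, pairWeight (a, r)
          = ∑ r ∈ C, X 1 * ∏ a ∈ C.erase r, pairWeight (a, r) := by
            refine sum_congr rfl fun r hr => ?_
            have hne : M ≠ r := fun h => hMC (h ▸ hr)
            rw [erase_insert_of_ne hne, prod_insert (fun h => hMC (mem_of_mem_erase h))]
            simp [pairWeight, (hM r hr).le]
        _ = _ := by
            rw [← mul_sum, ih, mul_sum]
            refine sum_congr rfl fun j hj => ?_
            rw [mem_range] at hj
            rw [← mul_assoc, ← pow_succ']
            congr 2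
            lia
    · have hX : ∀ a ∈ C, pairWeight (a, M) = X 0 := fun a ha => if_pos (hM a ha)
      rw [prod_congr rfl hX]
      simp

lemma forestSum_empty : forestSum (∅ : Finset α) = 1 := by
  have : forests (∅ : Finset α) = {∅} := by
    ext R
    rw [mem_forests, mem_singleton]
    constructor
    · exact fun h => by simpa using h.subset
    · rintro rfl
      constructor <;> simp
  simp [forestSum, this]

lemma forestSum_insert (S : Finset α) {m : α} (hm : m ∉ S) :
    forestSum (insert m S) = ∑ i ∈ range (#S + 1),
      ((#S).choose i : MvPolynomial (Fin 2) ℤ) *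
        (∑ j ∈ range (i + 1), X 1 ^ (i - j) * X 0 ^ j) *
        forestSum (univ : Finset (Fin i)) * forestSum (univ : Finset (Fin (#S - i))) := by
  have hterm : ∀ C ⊆ S, ∑ r ∈ insert m C,
      (∏ a ∈ (insert m C).erase r, pairWeight (a, r)) *
        (forestSum ((insert m C).erase r) * forestSum (insert m S \ insert m C)) =
      (fun i => (∑ j ∈ range (i + 1), X 1 ^ (i - j) * X 0 ^ j) *
        forestSum (univ : Finset (Fin i)) * forestSum (univ : Finset (Fin (#S - i)))) #C := by
    intro C hC
    have hmC : m ∉ C := fun h => hm (hC h)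
    have hcard : #(insert m C) = #C + 1 := card_insert_of_notMem hmC
    have h2 : forestSum (insert m S \ insert m C) =
        forestSum (univ : Finset (Fin (#S - #C))) := by
      rw [insert_sdiff_insert, sdiff_insert_of_notMem hm, forestSum_eq_card,
        card_sdiff_of_subset hC]
    have h1 : ∀ r ∈ insert m C, forestSum ((insert m C).erase r) =
        forestSum (univ : Finset (Fin #C)) := by
      intro r hr
      rw [forestSum_eq_card, card_erase_of_mem hr, hcard, Nat.add_sub_cancel]
    rw [sum_congr rfl fun r hr => by rw [h1 r hr, h2], ← sum_mul, sum_prod_pairWeight, hcard,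
      Nat.add_sub_cancel]
    exact (mul_assoc _ _ _).symm
  rw [forestSum_eq _ (mem_insert_self m S)]
  calc _ = ∑ C ∈ S.powerset, ∑ r ∈ insert m C,
      (∏ a ∈ (insert m C).erase r, pairWeight (a, r)) *
        (forestSum ((insert m C).erase r) * forestSum (insert m S \ insert m C)) := by
        symm
        refine sum_nbij' (fun C => insert m C) (fun C => C.erase m) ?_ ?_ ?_ ?_ ?_
        · intro C hC
          rw [mem_powerset] at hC
          simp [insert_subset_insert m hC]
        · intro C hC
          rw [mem_filter, mem_powerset] at hC
          rw [mem_powerset, ← subset_insert_iff]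
          exact hC.1
        · intro C hC
          exact erase_insert fun h => hm (mem_powerset.1 hC h)
        · intro C hC
          exact insert_erase (mem_filter.1 hC).2
        · intro C hC
          rfl
    _ = _ := by
        rw [sum_congr rfl fun C hC => hterm C (mem_powerset.1 hC), sum_powerset_apply_card (fun i =>
          (∑ j ∈ range (i + 1), X 1 ^ (i - j) * X 0 ^ j) * forestSum (univ : Finset (Fin i)) *
            forestSum (univ : Finset (Fin (#S - i))))]
        simp only [nsmul_eq_mul, mul_assoc]

end ForestSum

section Trees

variable {n : ℕ}

/-- The pairs `(descendant, ancestor)` of a tree rooted at `0` with ancestor other than `0`. -/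
noncomputable def descPairs (G : SimpleGraph (Fin (n + 1))) :
    Finset (Fin (n + 1) × Fin (n + 1)) :=
  {p | IsDesc G p.2 p.1 ∧ p.2 ≠ 0}

lemma mem_descPairs {G : SimpleGraph (Fin (n + 1))} {a b : Fin (n + 1)} :
    (a, b) ∈ descPairs G ↔ IsDescOf G 0 a b ∧ b ≠ 0 := by
  simp [descPairs, IsDesc, IsDescOf]

lemma isForestOn_descPairs {G : SimpleGraph (Fin (n + 1))} (hG : G.IsTree) :
    IsForestOn (univ.erase 0) (descPairs G) := by
  have h := IsDescOf.isTreeOrder (r := (0 : Fin (n + 1))) hG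
  constructor
  · rintro ⟨a, b⟩ hab
    rw [mem_descPairs] at hab
    have : a ≠ 0 := by
      rintro rfl
      exact h.not_root _ hab.1
    simp [this, hab.2]
  · exact fun a ha => h.irrefl a (mem_descPairs.1 ha).1
  · intro a b c hab hbc
    rw [mem_descPairs] at *
    exact ⟨h.trans _ _ _ hab.1 hbc.1, hbc.2⟩
  · intro a b c hab hac
    rw [mem_descPairs] at *
    have := h.chain _ _ _ hab.1 hac.1
    simpa [mem_descPairs, hab.2, hac.2] using this

lemma descPairs_injective {G H : SimpleGraph (Fin (n + 1))} (hG : G.IsTree) (hH : H.IsTree)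
    (h : descPairs G = descPairs H) : G = H := by
  have hD : IsDescOf G 0 = IsDescOf H 0 := by
    ext a b
    by_cases hb : b = 0
    · subst hb
      by_cases ha : a = 0
      · subst ha
        simp [IsDescOf.irrefl]
      · simp [IsDescOf.to_root ha]
    · have : (a, b) ∈ descPairs G ↔ (a, b) ∈ descPairs H := by rw [h]
      simpa [mem_descPairs, hb] using this
  ext a b
  rw [IsDescOf.adj_iff_covers (r := 0) hG, IsDescOf.adj_iff_covers (r := 0) hH, hD]

lemma exists_descPairs_eq {R : Finset (Fin (n + 1) × Fin (n + 1))}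
    (hR : IsForestOn (univ.erase 0) R) :
    ∃ G : SimpleGraph (Fin (n + 1)), G.IsTree ∧ descPairs G = R := by
  have hmem : ∀ a b, (a, b) ∈ R → a ≠ 0 ∧ b ≠ 0 := by
    intro a b h
    simpa using hR.mem h
  have hT : IsTreeOrder (0 : Fin (n + 1)) (fun a b => (a, b) ∈ R ∨ (a ≠ 0 ∧ b = 0)) := by
    constructor
    · intro a
      have := hR.irrefl a
      grind
    · intro a b c
      have := hR.trans a b c
      grind
    · intro a b c
      have := hR.chain a b c
      grind
    · grind
  refine ⟨_, hT.isTree_graph, ?_⟩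
  ext ⟨a, b⟩
  rw [mem_descPairs, hT.isDescOf_graph_iff]
  grind

lemma treeInv_eq (G : SimpleGraph (Fin (n + 1))) :
    treeInv G = #{p ∈ descPairs G | p.1 < p.2} := by
  rw [treeInv, Nat.card_eq_fintype_card, Fintype.card_subtype]
  refine card_bij' (fun p _ => p.swap) (fun p _ => p.swap) ?_ ?_ (by simp) (by simp)
  · rintro ⟨a, b⟩ h
    simp only [mem_filter, mem_univ, true_and, descPairs, Prod.swap] at h ⊢
    exact ⟨⟨h.1, Fin.ne_zero_of_lt h.2⟩, h.2⟩
  · rintro ⟨a, b⟩ h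
    simp only [mem_filter, mem_univ, true_and, descPairs, Prod.swap] at h ⊢
    exact ⟨h.1.1, h.2⟩

lemma treeCoinv_eq (G : SimpleGraph (Fin (n + 1))) :
    treeCoinv G = n + #{p ∈ descPairs G | ¬ p.1 < p.2} := by
  have hn : n = #((univ.erase (0 : Fin (n + 1))) ×ˢ {(0 : Fin (n + 1))}) := by simp
  have hd : Disjoint ((univ.erase (0 : Fin (n + 1))) ×ˢ {(0 : Fin (n + 1))})
      {p ∈ descPairs G | ¬ p.1 < p.2} := by
    rw [disjoint_left]
    rintro ⟨a, b⟩ h h'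
    simp only [mem_product, mem_singleton, mem_filter, mem_descPairs] at h h'
    exact h'.1.2 h.2
  rw [treeCoinv, Nat.card_eq_fintype_card, Fintype.card_subtype]
  conv_rhs => lhs; rw [hn]
  rw [← card_union_of_disjoint hd]
  refine card_bij' (fun p _ => p.swap) (fun p _ => p.swap) ?_ ?_ (by simp) (by simp)
  · rintro ⟨a, b⟩ h
    simp only [mem_filter, mem_univ, true_and, mem_union, mem_product, mem_singleton,
      mem_erase, descPairs, Prod.swap] at h ⊢
    by_cases ha : a = 0
    · subst ha
      exact Or.inl ⟨⟨h.1.1, trivial⟩, rfl⟩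
    · exact Or.inr ⟨⟨h.1, ha⟩, h.2.not_gt⟩
  · rintro ⟨a, b⟩ h
    simp only [mem_filter, mem_univ, true_and, mem_union, mem_product, mem_singleton,
      mem_erase, descPairs, Prod.swap] at h ⊢
    rcases h with ⟨⟨ha, -⟩, rfl⟩ | ⟨⟨h, -⟩, hlt⟩
    · exact ⟨IsDescOf.to_root ha, Fin.pos_of_ne_zero ha⟩
    · exact ⟨h, lt_of_le_of_ne (not_lt.1 hlt) h.1.symm⟩

lemma Ipoly_eq (n : ℕ) : Ipoly n = X 1 ^ n * forestSum (univ : Finset (Fin n)) := by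
  have hcard : #((univ : Finset (Fin (n + 1))).erase 0) = n := by simp
  have h : forestSum (univ : Finset (Fin n)) =
      forestSum ((univ : Finset (Fin (n + 1))).erase 0) := by
    rw [forestSum_eq_card (univ.erase _), hcard]
  rw [h, forestSum, mul_sum, Ipoly]
  refine sum_bij (fun T _ => descPairs T.1) ?_ ?_ ?_ ?_
  · exact fun T _ => mem_forests.2 (isForestOn_descPairs T.2)
  · exact fun T _ T' _ h => Subtype.ext (descPairs_injective T.2 T'.2 h)
  · intro R hR
    obtain ⟨G, hG, rfl⟩ := exists_descPairs_eq (mem_forests.1 hR)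
    exact ⟨⟨G, hG⟩, mem_univ _, rfl⟩
  · intro T _
    rw [prod_pairWeight, treeInv_eq, treeCoinv_eq, pow_add, mul_left_comm]
    congr!

end Trees

/-- The bivariate inversion enumerators satisfy `I_0(q,t) = 1` and
`I_{n+1}(q,t) = ∑_{i=0}^n C(n,i) · t · (tⁱ + t^{i-1}q + ⋯ + qⁱ) · I_i(q,t) · I_{n-i}(q,t)`. -/
theorem Ipoly_recursion :
    Ipoly 0 = 1 ∧
    ∀ n : ℕ, Ipoly (n+1) =
      ∑ i ∈ Finset.range (n+1),
        (n.choose i : MvPolynomial (Fin 2) ℤ) * X 1 *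
          (∑ j ∈ Finset.range (i+1), X 1 ^ (i - j) * X 0 ^ j) *
          Ipoly i * Ipoly (n - i) := by
  constructor
  · rw [Ipoly_eq, univ_eq_empty, forestSum_empty, pow_zero, one_mul]
  · intro n
    have hcard : #((univ : Finset (Fin (n + 1))).erase 0) = n := by simp
    have h := forestSum_insert ((univ : Finset (Fin (n + 1))).erase 0) (notMem_erase 0 _)
    have h' := Eq.trans (congrArg forestSum (Eq.symm (eq_univ_iff_forall.2 fun a => by
      simp [em]))) h
    rw [Ipoly_eq, h', hcard, mul_sum]
    refine sum_congr rfl fun i hi => ?_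
    have hi' : n = i + (n - i) := by
      rw [mem_range] at hi
      lia
    have hpow : (X 1 : MvPolynomial (Fin 2) ℤ) ^ (n + 1) = X 1 * X 1 ^ i * X 1 ^ (n - i) := by
      rw [mul_assoc, ← pow_add, ← hi', pow_succ']
    rw [Ipoly_eq i, Ipoly_eq (n - i), hpow]
    ring
end

section
/- The bivariate area enumerators of minimal factorizations satisfy the recursion F_{n+1}(q,t) = ∑_{i=0}^n C(n,i) · t · (t^i + t^{i−1}q + t^{i−2}q^2 + ⋯ + q^i) · F_i(q,t) · F_{n−i}(q,t) for all n ≥ 0, with F_0(q,t) = 1. -/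
open Finset MvPolynomial

attribute [local instance] Classical.propDecidable

/-- The bivariate area enumerator
`F_n(q,t) = ∑_{f ∈ F_n} q^{area_L f} t^{area_U f}`, an element of `ℤ[q,t]`
with `q = X 0` and `t = X 1`. -/
noncomputable def Fpoly (n : ℕ) : MvPolynomial (Fin 2) ℤ :=
  ∑ f : {f : Fin n → Equiv.Perm (Fin (n+1)) // f ∈ FactSet n},
    MvPolynomial.X 0 ^ areaL f.1 * MvPolynomial.X 1 ^ areaU f.1


/-! ### Sums over words -/

/-- The sum of `G` over all words of length `n` with letters in `X`. -/
def wordSum {α R : Type*} [AddCommMonoid R] (X : Finset α) : ℕ → (List α → R) → R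
  | 0, G => G []
  | n + 1, G => ∑ x ∈ X, wordSum X n fun l => G (x :: l)

section WordSum

variable {α R : Type*}

theorem wordSum_congr [AddCommMonoid R] {X : Finset α} {n : ℕ} {G H : List α → R}
    (h : ∀ l : List α, l.length = n → (∀ x ∈ l, x ∈ X) → G l = H l) :
    wordSum X n G = wordSum X n H := by
  induction n generalizing G H with
  | zero => exact h [] rfl (by simp)
  | succ n ih =>
    refine Finset.sum_congr rfl fun x hx => ih fun l hl hX => h _ (by simp [hl]) ?_
    simpa [hx] using hX

theorem wordSum_sub [AddCommGroup R] (X : Finset α) (n : ℕ) (G H : List α → R) :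
    wordSum X n (fun l => G l - H l) = wordSum X n G - wordSum X n H := by
  induction n generalizing G H with
  | zero => rfl
  | succ n ih => simp only [wordSum, ih, Finset.sum_sub_distrib]

theorem wordSum_zero [AddCommMonoid R] (X : Finset α) (n : ℕ) :
    wordSum X n (fun _ => (0 : R)) = 0 := by
  induction n with
  | zero => rfl
  | succ n ih => simp [wordSum, ih]

theorem wordSum_sum [AddCommMonoid R] {ι : Type*} (s : Finset ι) (X : Finset α) (n : ℕ)
    (G : ι → List α → R) :
    wordSum X n (fun l => ∑ i ∈ s, G i l) = ∑ i ∈ s, wordSum X n (G i) := by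
  induction n generalizing G with
  | zero => rfl
  | succ n ih => simp only [wordSum, ih]; exact Finset.sum_comm

theorem wordSum_mul_left [NonUnitalNonAssocSemiring R] (X : Finset α) (n : ℕ) (r : R)
    (G : List α → R) : wordSum X n (fun l => r * G l) = r * wordSum X n G := by
  induction n generalizing G with
  | zero => rfl
  | succ n ih => simp only [wordSum, ih, Finset.mul_sum]

theorem wordSum_mul_right [NonUnitalNonAssocSemiring R] (X : Finset α) (n : ℕ) (r : R)
    (G : List α → R) : wordSum X n (fun l => G l * r) = wordSum X n G * r := by
  induction n generalizing G with
  | zero => rfl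
  | succ n ih => simp only [wordSum, ih, Finset.sum_mul]

theorem wordSum_comm [AddCommMonoid R] (X Y : Finset α) (m n : ℕ) (G : List α → List α → R) :
    wordSum X m (fun l => wordSum Y n fun l' => G l l') =
      wordSum Y n (fun l' => wordSum X m fun l => G l l') := by
  induction m generalizing G with
  | zero => rfl
  | succ m ih => simp only [wordSum, ih, wordSum_sum]

theorem wordSum_append [AddCommMonoid R] (X : Finset α) (m n : ℕ) (G : List α → R) :
    wordSum X (m + n) G = wordSum X m fun l => wordSum X n fun l' => G (l ++ l') := by
  induction m generalizing G with
  | zero => simp [wordSum]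
  | succ m ih => rw [Nat.succ_add]; simp only [wordSum, ih, List.cons_append]

theorem wordSum_succ_snoc [AddCommMonoid R] (X : Finset α) (n : ℕ) (G : List α → R) :
    wordSum X (n + 1) G = wordSum X n fun l => ∑ x ∈ X, G (l ++ [x]) := by
  rw [wordSum_append]; rfl

theorem wordSum_map [AddCommMonoid R] {β : Type*} (X : Finset α) (φ : α ↪ β) (n : ℕ)
    (G : List β → R) : wordSum (X.map φ) n G = wordSum X n fun l => G (l.map φ) := by
  induction n generalizing G with
  | zero => rfl
  | succ n ih => simp only [wordSum, ih, Finset.sum_map, List.map_cons]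

theorem wordSum_subset [AddCommMonoid R] {X Y : Finset α} (hXY : X ⊆ Y) (n : ℕ) {G : List α → R}
    (h : ∀ l : List α, l.length = n → (∀ x ∈ l, x ∈ Y) → G l ≠ 0 → ∀ x ∈ l, x ∈ X) :
    wordSum Y n G = wordSum X n G := by
  induction n generalizing G with
  | zero => rfl
  | succ n ih =>
    simp only [wordSum]
    rw [← Finset.sum_subset hXY]
    · refine Finset.sum_congr rfl fun x hx => ih fun l hl hY hG y hy => ?_
      exact h _ (by simp [hl]) (by simpa [hXY hx] using hY) hG y (by simp [hy])
    · intro x hx hx'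
      rw [← wordSum_zero Y n]
      refine wordSum_congr fun l hl hY => ?_
      by_contra hG
      exact hx' (h _ (by simp [hl]) (by simpa [hx] using hY) hG x (by simp))

/-- Words over a two-part alphabet are shuffles of words over the parts. -/
theorem wordSum_filter [CommSemiring R] (X : Finset α) (p : α → Bool) (n : ℕ)
    (G : List α → List α → R) :
    wordSum X n (fun l => G (l.filter p) (l.filter fun x => !p x)) =
      ∑ ij ∈ HasAntidiagonal.antidiagonal n, (n.choose ij.1 : R) *
        wordSum (X.filter fun x => p x = true) ij.1 fun l =>
          wordSum (X.filter fun x => ¬ p x = true) ij.2 fun l' => G l l' := by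
  induction n generalizing G with
  | zero => simp [wordSum]
  | succ n ih =>
    rw [Finset.sum_antidiagonal_choose_succ_mul (fun i j =>
      wordSum (X.filter fun x => p x = true) i fun l =>
          wordSum (X.filter fun x => ¬ p x = true) j fun l' => G l l')]
    rw [wordSum, ← Finset.sum_filter_add_sum_filter_not X (fun x => p x = true), add_comm]
    congr 1
    · have : ∀ x ∈ X.filter (fun x => ¬ p x = true),
          wordSum X n (fun l => G ((x :: l).filter p) ((x :: l).filter fun x => !p x)) =
          ∑ ij ∈ HasAntidiagonal.antidiagonal n, (n.choose ij.1 : R) *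
            wordSum (X.filter fun x => p x = true) ij.1 fun l =>
              wordSum (X.filter fun x => ¬ p x = true) ij.2 fun l' => G l (x :: l') := by
        intro x hx
        rw [← ih fun l l' => G l (x :: l')]
        have : p x = false := by simpa using (Finset.mem_filter.1 hx).2
        simp [this]
      rw [Finset.sum_congr rfl this, Finset.sum_comm]
      refine Finset.sum_congr rfl fun ij _ => ?_
      rw [← Finset.mul_sum, ← wordSum_sum]
      rfl
    · have : ∀ x ∈ X.filter (fun x => p x = true),
          wordSum X n (fun l => G ((x :: l).filter p) ((x :: l).filter fun x => !p x)) =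
          ∑ ij ∈ HasAntidiagonal.antidiagonal n, (n.choose ij.1 : R) *
            wordSum (X.filter fun x => p x = true) ij.1 fun l =>
              wordSum (X.filter fun x => ¬ p x = true) ij.2 fun l' => G (x :: l) l' := by
        intro x hx
        rw [← ih fun l l' => G (x :: l) l']
        have : p x = true := by simpa using (Finset.mem_filter.1 hx).2
        simp [this]
      rw [Finset.sum_congr rfl this, Finset.sum_comm]
      refine Finset.sum_congr rfl fun ij hij => ?_
      rw [← Finset.mul_sum]
      rw [← HasAntidiagonal.mem_antidiagonal.1 hij, Nat.choose_symm_add]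
      rfl

end WordSum

/-! ### Words of transpositions -/

/-- The product, from left to right, of the transpositions `(i j)` for `(i, j)` in a word. -/
def act : List (ℕ × ℕ) → Equiv.Perm ℕ
  | [] => 1
  | e :: u => act u * Equiv.swap e.1 e.2

/-- `u` acts on the interval `[lo, hi]` as the cycle `(lo lo+1 ⋯ hi)`. -/
def IsCyc (lo hi : ℕ) (u : List (ℕ × ℕ)) : Prop :=
  (∀ x, lo ≤ x → x < hi → act u x = x + 1) ∧ act u hi = lo

theorem act_append (u v : List (ℕ × ℕ)) : act (u ++ v) = act v * act u := by
  induction u with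
  | nil => simp [act]
  | cons e u ih => simp [act, ih, mul_assoc]

theorem act_insert (u v : List (ℕ × ℕ)) (e : ℕ × ℕ) :
    act (u ++ e :: v) = Equiv.swap (act v e.1) (act v e.2) * act (u ++ v) := by
  rw [act_append, act_append, act, Equiv.mul_swap_eq_swap_mul, mul_assoc]

theorem act_invariant {β : Type*} {h : ℕ → β} {u : List (ℕ × ℕ)}
    (hu : ∀ e ∈ u, h e.1 = h e.2) (x : ℕ) : h (act u x) = h x := by
  induction u generalizing x with
  | nil => rfl
  | cons e u ih =>
    rw [act, Equiv.Perm.mul_apply, ih fun e he => hu e (by simp [he])]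
    have := hu e (by simp)
    rw [Equiv.swap_apply_def]
    split_ifs <;> simp_all

theorem IsCyc.invariant_eq {β : Type*} {h : ℕ → β} {lo hi : ℕ} {u : List (ℕ × ℕ)}
    (hc : IsCyc lo hi u) (hu : ∀ e ∈ u, h e.1 = h e.2) {x : ℕ} (h1 : lo ≤ x) (h2 : x ≤ hi) :
    h x = h lo := by
  induction x, h1 using Nat.le_induction with
  | base => rfl
  | succ x hx ih => rw [← ih (by lia), ← hc.1 x hx (by lia), act_invariant hu]

/-- A graph with too few edges to be connected carries a function which separates components. -/
theorem exists_invariant (u : List (ℕ × ℕ)) (lo k : ℕ) (hk : u.length + 1 < k) :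
    ∃ h : ℕ → ℚ, h lo = 0 ∧ (∀ e ∈ u, h e.1 = h e.2) ∧ ∃ i < k, h (lo + i) ≠ 0 := by
  let ext : (Fin k → ℚ) →ₗ[ℚ] (ℕ → ℚ) :=
    { toFun := fun h x => if hx : lo ≤ x ∧ x - lo < k then h ⟨x - lo, hx.2⟩ else 0
      map_add' := by intro x y; ext z; dsimp; split_ifs <;> simp
      map_smul' := by intro x y; ext z; dsimp; split_ifs <;> simp }
  let f : (Fin k → ℚ) →ₗ[ℚ] (Fin u.length → ℚ) × ℚ :=
    { toFun := fun h => (fun i => ext h (u.get i).1 - ext h (u.get i).2, ext h lo)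
      map_add' := by
        intro x y
        simp only [map_add, Pi.add_apply, Prod.mk_add_mk, Prod.mk.injEq, and_true]
        ext i; simp only [Pi.add_apply]; ring
      map_smul' := by
        intro x y
        simp only [map_smul, Pi.smul_apply, Prod.smul_mk, Prod.mk.injEq, RingHom.id_apply, and_true]
        ext i; simp only [Pi.smul_apply, smul_eq_mul]; ring }
  have hker : LinearMap.ker f ≠ ⊥ := LinearMap.ker_ne_bot_of_finrank_lt (by simpa using hk)
  obtain ⟨h, hh, h0⟩ := Submodule.exists_mem_ne_zero_of_ne_bot hker
  have hh' : f h = 0 := hh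
  refine ⟨ext h, congrArg Prod.snd hh', fun e he => ?_, ?_⟩
  · obtain ⟨i, rfl⟩ := List.get_of_mem he
    exact sub_eq_zero.1 (congrFun (congrArg Prod.fst hh') i)
  · obtain ⟨i, hi⟩ := Function.ne_iff.1 h0
    refine ⟨i, i.2, ?_⟩
    simpa [ext] using hi

theorem IsCyc.le_length {lo hi : ℕ} {u : List (ℕ × ℕ)} (hc : IsCyc lo hi u) :
    hi - lo ≤ u.length := by
  by_contra hlt
  obtain ⟨h, h0, hu, i, hi', hne⟩ := exists_invariant u lo (hi - lo + 1) (by lia)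
  exact hne ((hc.invariant_eq hu (by lia) (by lia)).trans h0)

theorem IsCyc.same_side {m N : ℕ} {u : List (ℕ × ℕ)} (h1 : IsCyc 0 m u) (h2 : IsCyc (m + 1) N u)
    (hN : N = u.length + 1) (hle : ∀ e ∈ u, e.1 ≤ N ∧ e.2 ≤ N) :
    ∀ e ∈ u, (e.1 ≤ m ↔ e.2 ≤ m) := by
  obtain ⟨h, h0, hu, i, hi, hne⟩ := exists_invariant u 0 (N + 1) (by lia)
  have low : ∀ x ≤ m, h x = 0 := fun x hx => (h1.invariant_eq hu (by lia) hx).trans h0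
  have high : ∀ x ≤ N, ¬ x ≤ m → h x ≠ 0 := by
    intro x hx hxm
    have hi' : ¬ i ≤ m := fun hi' => hne (by simpa using low i hi')
    rw [h2.invariant_eq hu (by lia) hx,
      ← h2.invariant_eq (x := 0 + i) hu (by lia) (by lia)]
    exact hne
  intro e he
  have := hu e he
  have h3 := hle e he
  constructor
  · intro h4
    by_contra h5
    exact high _ h3.2 h5 (this ▸ low _ h4)
  · intro h4
    by_contra h5
    exact high _ h3.1 h5 (this ▸ low _ h4)

/-- The pairs `(i, j)` with `i < j ≤ N`. -/
def letters (N : ℕ) : Finset (ℕ × ℕ) :=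
  (range (N + 1) ×ˢ range (N + 1)).filter fun e => e.1 < e.2

theorem mem_letters {N : ℕ} {e : ℕ × ℕ} : e ∈ letters N ↔ e.1 < e.2 ∧ e.2 ≤ N := by
  simp only [letters, Finset.mem_filter, Finset.mem_product, Finset.mem_range]
  lia

/-- The sum of the smaller endpoints of a word. -/
def lowSum (u : List (ℕ × ℕ)) : ℕ := (u.map Prod.fst).sum

/-- The sum of the larger endpoints of a word. -/
def highSum (u : List (ℕ × ℕ)) : ℕ := (u.map Prod.snd).sum

/-- The point which a word moves to `0`. -/
def start (u : List (ℕ × ℕ)) : ℕ := (act u).symm 0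

theorem act_start (u : List (ℕ × ℕ)) : act u (start u) = 0 := Equiv.apply_symm_apply _ _

theorem start_cons (e : ℕ × ℕ) (u : List (ℕ × ℕ)) :
    start (e :: u) = Equiv.swap e.1 e.2 (start u) := by
  rw [start, Equiv.symm_apply_eq, act, Equiv.Perm.mul_apply, Equiv.swap_apply_self, act_start]

theorem act_le_iff {N : ℕ} {u : List (ℕ × ℕ)} (hu : ∀ e ∈ u, (e.1 ≤ N ↔ e.2 ≤ N)) (x : ℕ) :
    act u x ≤ N ↔ x ≤ N :=
  iff_of_eq (act_invariant (h := fun x => x ≤ N) (fun e he => propext (hu e he)) x)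

theorem letters_le_iff {N : ℕ} {u : List (ℕ × ℕ)} (hu : ∀ e ∈ u, e ∈ letters N) :
    ∀ e ∈ u, (e.1 ≤ N ↔ e.2 ≤ N) := by
  intro e he
  have := mem_letters.1 (hu e he)
  lia

theorem start_le {N : ℕ} {u : List (ℕ × ℕ)} (hu : ∀ e ∈ u, e ∈ letters N) : start u ≤ N := by
  rw [← act_le_iff (letters_le_iff hu), act_start]
  exact Nat.zero_le _

theorem IsCyc.start_eq {N : ℕ} {u : List (ℕ × ℕ)} (hu : IsCyc 0 N u) : start u = N := by
  rw [start, Equiv.symm_apply_eq, hu.2]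

/-- `u` acts as the product of the two cycles `(0 ⋯ m)` and `(m+1 ⋯ N)`. -/
def IsSplit (m N : ℕ) (u : List (ℕ × ℕ)) : Prop := IsCyc 0 m u ∧ IsCyc (m + 1) N u

theorem IsSplit.same_side {m N : ℕ} {u : List (ℕ × ℕ)} (h : IsSplit m N u)
    (hN : N = u.length + 1) (hu : ∀ e ∈ u, e ∈ letters N) :
    ∀ e ∈ u, (e.1 ≤ m ↔ e.2 ≤ m) :=
  h.1.same_side h.2 hN fun e he => by have := mem_letters.1 (hu e he); lia

/-- Deleting from a factorization of a full cycle a transposition met by the path to `0`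
leaves a factorization of a product of two cycles. -/
theorem exists_isSplit_of_insert {N : ℕ} {r l : List (ℕ × ℕ)} {e : ℕ × ℕ}
    (hN : N = (r ++ l).length + 1) (hu : ∀ e ∈ r ++ l, e ∈ letters N) (he : e ∈ letters N)
    (hc : IsCyc 0 N (r ++ e :: l)) (hs : start (e :: l) ≠ start l) :
    ∃ m < N, IsSplit m N (r ++ l) ∧ e = (start l, (act l).symm (m + 1)) := by
  have hl : ∀ e ∈ l, e ∈ letters N := fun e he => hu e (by simp [he])
  have he' := mem_letters.1 he
  obtain ⟨o, ho, hor⟩ : ∃ o, o ≤ N ∧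
      (e = (start l, o) ∨ e = (o, start l)) := by
    rw [start_cons, Equiv.swap_apply_ne_self_iff] at hs
    rcases hs.2 with h | h
    · exact ⟨e.2, he'.2, Or.inl (by rw [h])⟩
    · exact ⟨e.1, by lia, Or.inr (by rw [h])⟩
  have hos : o ≠ start l := by rcases hor with h | h <;> rw [h] at he' <;> dsimp at he' <;> lia
  have hact : act (r ++ l) = Equiv.swap 0 (act l o) * act (r ++ e :: l) := by
    rw [act_insert]
    rcases hor with h | h <;> rw [h] <;> simp only [act_start]
    · rw [Equiv.swap_mul_self_mul]
    · rw [Equiv.swap_comm, Equiv.swap_mul_self_mul]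
  have hp0 : act l o ≠ 0 := fun h => hos (by rw [start, Equiv.eq_symm_apply, h])
  have hpN : act l o ≤ N := (act_le_iff (letters_le_iff hl) o).2 ho
  obtain ⟨m, hm⟩ := Nat.exists_eq_succ_of_ne_zero hp0
  have hsplit : IsSplit m N (r ++ l) := by
    rw [hm, Nat.succ_eq_add_one] at hact
    refine ⟨⟨fun x _ hx => ?_, ?_⟩, ⟨fun x h1 hx => ?_, ?_⟩⟩ <;>
      rw [hact, Equiv.Perm.mul_apply]
    · rw [hc.1 x (by lia) (by lia), Equiv.swap_apply_of_ne_of_ne] <;> lia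
    · rw [hc.1 m (by lia) (by lia), Equiv.swap_apply_right]
    · rw [hc.1 x (by lia) (by lia), Equiv.swap_apply_of_ne_of_ne] <;> lia
    · rw [hc.2, Equiv.swap_apply_left]
  have hol : o = (act l).symm (m + 1) := by rw [Equiv.eq_symm_apply, hm]
  refine ⟨m, by lia, hsplit, ?_⟩
  have hside := hsplit.same_side hN hu
  have hside' : ∀ e ∈ l, (e.1 ≤ m ↔ e.2 ≤ m) := fun e he => hside e (by simp [he])
  have h1 : start l ≤ m := by rw [← act_le_iff hside', act_start]; lia
  have h2 : ¬ o ≤ m := by rw [← act_le_iff hside', hm]; lia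
  rw [← hol]
  rcases hor with h | h
  · exact h
  · rw [h] at he'
    dsimp at he'
    lia

theorem IsSplit.insert {m N : ℕ} {r l : List (ℕ × ℕ)} (h : IsSplit m N (r ++ l)) (hm : m < N)
    (hN : N = (r ++ l).length + 1) (hu : ∀ e ∈ r ++ l, e ∈ letters N) :
    start l ≤ m ∧ m < (act l).symm (m + 1) ∧ (act l).symm (m + 1) ≤ N ∧
      IsCyc 0 N (r ++ (start l, (act l).symm (m + 1)) :: l) ∧
      start ((start l, (act l).symm (m + 1)) :: l) = (act l).symm (m + 1) := by
  have hside := h.same_side hN hu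
  have hside' : ∀ e ∈ l, (e.1 ≤ m ↔ e.2 ≤ m) := fun e he => hside e (by simp [he])
  have hl : ∀ e ∈ l, e ∈ letters N := fun e he => hu e (by simp [he])
  refine ⟨by rw [← act_le_iff hside', act_start]; lia, ?_, ?_, ?_, ?_⟩
  · rw [← not_le, ← act_le_iff hside', Equiv.apply_symm_apply]; lia
  · rw [← act_le_iff (letters_le_iff hl), Equiv.apply_symm_apply]; lia
  · refine ⟨fun x _ hx => ?_, ?_⟩ <;>
      rw [act_insert, Equiv.Perm.mul_apply, act_start, Equiv.apply_symm_apply]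
    · rcases lt_trichotomy x m with h1 | rfl | h1
      · rw [h.1.1 x (by lia) h1, Equiv.swap_apply_of_ne_of_ne] <;> lia
      · rw [h.1.2, Equiv.swap_apply_left]
      · rw [h.2.1 x (by lia) hx, Equiv.swap_apply_of_ne_of_ne] <;> lia
    · rw [h.2.2, Equiv.swap_apply_right]
  · rw [start_cons, Equiv.swap_apply_left]

/-- The transpositions lying in the interval `[0, m]`. -/
def isLow (m : ℕ) (e : ℕ × ℕ) : Bool := decide (e.2 ≤ m)

theorem act_filter_low {m : ℕ} {u : List (ℕ × ℕ)} (hu : ∀ e ∈ u, (e.1 ≤ m ↔ e.2 ≤ m))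
    {x : ℕ} (hx : x ≤ m) : act (u.filter (isLow m)) x = act u x := by
  induction u generalizing x with
  | nil => rfl
  | cons e u ih =>
    have he := hu e (by simp)
    have ih' := fun {y : ℕ} (hy : y ≤ m) => ih (fun e he => hu e (by simp [he])) hy
    by_cases h : e.2 ≤ m
    · rw [List.filter_cons_of_pos (by simp [isLow, h]), act, act, Equiv.Perm.mul_apply,
        Equiv.Perm.mul_apply, ih']
      rw [Equiv.swap_apply_def]
      split_ifs <;> lia
    · rw [List.filter_cons_of_neg (by simp [isLow, h]), act, Equiv.Perm.mul_apply,
        Equiv.swap_apply_of_ne_of_ne (by lia) (by lia), ih' hx]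

theorem act_filter_high {m : ℕ} {u : List (ℕ × ℕ)} (hu : ∀ e ∈ u, (e.1 ≤ m ↔ e.2 ≤ m))
    {x : ℕ} (hx : m < x) : act (u.filter fun e => !isLow m e) x = act u x := by
  induction u generalizing x with
  | nil => rfl
  | cons e u ih =>
    have he := hu e (by simp)
    have ih' := fun {y : ℕ} (hy : m < y) => ih (fun e he => hu e (by simp [he])) hy
    by_cases h : e.2 ≤ m
    · rw [List.filter_cons_of_neg (by simp [isLow, h]), act, Equiv.Perm.mul_apply,
        Equiv.swap_apply_of_ne_of_ne (by lia) (by lia), ih' hx]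
    · rw [List.filter_cons_of_pos (by simp [isLow, h]), act, act, Equiv.Perm.mul_apply,
        Equiv.Perm.mul_apply, ih']
      rw [Equiv.swap_apply_def]
      split_ifs <;> lia

theorem isSplit_iff_filter {m N : ℕ} {u : List (ℕ × ℕ)} (hu : ∀ e ∈ u, (e.1 ≤ m ↔ e.2 ≤ m))
    (hm : m < N) : IsSplit m N u ↔
      IsCyc 0 m (u.filter (isLow m)) ∧ IsCyc (m + 1) N (u.filter fun e => !isLow m e) := by
  refine and_congr (and_congr (forall_congr' fun x => ?_) ?_)
    (and_congr (forall_congr' fun x => ?_) ?_)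
  · exact imp_congr_right fun _ => imp_congr_right fun h => by rw [act_filter_low hu h.le]
  · rw [act_filter_low hu le_rfl]
  · exact imp_congr_right fun h => imp_congr_right fun _ => by rw [act_filter_high hu h]
  · rw [act_filter_high hu hm]

/-- Translation of a pair by `s`. -/
def shift (s : ℕ) : ℕ × ℕ ↪ ℕ × ℕ :=
  ⟨fun e => (e.1 + s, e.2 + s), fun e f h => by
    simp only [Prod.mk.injEq, add_left_inj] at h
    exact Prod.ext h.1 h.2⟩

@[simp]
theorem shift_apply (s : ℕ) (e : ℕ × ℕ) : shift s e = (e.1 + s, e.2 + s) := rfl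

theorem act_map_shift (s : ℕ) (u : List (ℕ × ℕ)) (x : ℕ) :
    act (u.map (shift s)) (x + s) = act u x + s := by
  induction u generalizing x with
  | nil => rfl
  | cons e u ih =>
    rw [List.map_cons, act, act, Equiv.Perm.mul_apply, Equiv.Perm.mul_apply, ← ih]
    congr 1
    simp only [shift_apply, Equiv.swap_apply_def, add_left_inj]
    split_ifs <;> rfl

theorem isCyc_map_shift {s k : ℕ} {u : List (ℕ × ℕ)} :
    IsCyc s (k + s) (u.map (shift s)) ↔ IsCyc 0 k u := by
  rw [IsCyc, IsCyc, act_map_shift]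
  refine and_congr ⟨fun h x _ hx => ?_, fun h x hx hx' => ?_⟩ (by lia)
  · have := h (x + s) (by lia) (by lia)
    rw [act_map_shift] at this
    lia
  · obtain ⟨y, rfl⟩ := Nat.exists_eq_add_of_le' hx
    rw [act_map_shift, h y (by lia) (by lia)]
    lia

theorem lowSum_append (u v : List (ℕ × ℕ)) : lowSum (u ++ v) = lowSum u + lowSum v := by
  simp [lowSum]

theorem highSum_append (u v : List (ℕ × ℕ)) : highSum (u ++ v) = highSum u + highSum v := by
  simp [highSum]

theorem lowSum_cons (e : ℕ × ℕ) (u : List (ℕ × ℕ)) : lowSum (e :: u) = e.1 + lowSum u := by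
  simp [lowSum]

theorem highSum_cons (e : ℕ × ℕ) (u : List (ℕ × ℕ)) : highSum (e :: u) = e.2 + highSum u := by
  simp [highSum]

theorem lowSum_filter (p : ℕ × ℕ → Bool) (u : List (ℕ × ℕ)) :
    lowSum (u.filter p) + lowSum (u.filter fun e => !p e) = lowSum u := by
  induction u with
  | nil => rfl
  | cons e u ih => cases h : p e <;> simp [h, lowSum_cons, ← ih] <;> lia

theorem highSum_filter (p : ℕ × ℕ → Bool) (u : List (ℕ × ℕ)) :
    highSum (u.filter p) + highSum (u.filter fun e => !p e) = highSum u := by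
  induction u with
  | nil => rfl
  | cons e u ih => cases h : p e <;> simp [h, highSum_cons, ← ih] <;> lia

theorem lowSum_map_shift (s : ℕ) (u : List (ℕ × ℕ)) :
    lowSum (u.map (shift s)) = lowSum u + s * u.length := by
  induction u with
  | nil => rfl
  | cons e u ih => simp [lowSum_cons, ih]; ring

theorem highSum_map_shift (s : ℕ) (u : List (ℕ × ℕ)) :
    highSum (u.map (shift s)) = highSum u + s * u.length := by
  induction u with
  | nil => rfl
  | cons e u ih => simp [highSum_cons, ih]; ring

theorem length_filter_add (p : ℕ × ℕ → Bool) (u : List (ℕ × ℕ)) :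
    (u.filter p).length + (u.filter fun e => !p e).length = u.length := by
  induction u with
  | nil => rfl
  | cons e u ih => cases h : p e <;> simp [h, ← ih] <;> lia

theorem choose_two_succ_add (m k : ℕ) :
    (m + k + 1).choose 2 = m.choose 2 + k.choose 2 + m * k + (m + k) := by
  have h : (((m + k + 1).choose 2 : ℕ) : ℚ) = (m.choose 2 + k.choose 2 + m * k + (m + k) : ℕ) := by
    push_cast [Nat.cast_choose_two]
    ring
  exact_mod_cast h

theorem exists_map_shift {s : ℕ} {u : List (ℕ × ℕ)} (hu : ∀ e ∈ u, s ≤ e.1 ∧ s ≤ e.2) :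
    ∃ v : List (ℕ × ℕ), u = v.map (shift s) := by
  refine ⟨u.map fun e => (e.1 - s, e.2 - s), ?_⟩
  rw [List.map_map]
  refine (List.map_id u).symm.trans (List.map_congr_left fun e he => ?_)
  have := hu e he
  ext <;> simp <;> lia

theorem exists_start_ne {u : List (ℕ × ℕ)} (hu : start u ≠ 0) :
    ∃ r e l, u = r ++ e :: l ∧ start (e :: l) ≠ start l := by
  induction u with
  | nil => exact absurd rfl hu
  | cons e u ih =>
    by_cases h : start (e :: u) = start u
    · obtain ⟨r, f, l, rfl, hl⟩ := ih (h ▸ hu)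
      exact ⟨e :: r, f, l, rfl, hl⟩
    · exact ⟨[], e, u, rfl, h⟩

theorem IsSplit.length_filter {m N : ℕ} {u : List (ℕ × ℕ)} (h : IsSplit m N u) (hm : m < N)
    (hN : N = u.length + 1) (hu : ∀ e ∈ u, e ∈ letters N) :
    (u.filter (isLow m)).length = m ∧
      (u.filter fun e => !isLow m e).length = N - (m + 1) := by
  have hf := (isSplit_iff_filter (h.same_side hN hu) hm).1 h
  have h1 := hf.1.le_length
  have h2 := hf.2.le_length
  have h3 := length_filter_add (isLow m) u
  lia

/-- The areas of a factorization of a full cycle are nonnegative. -/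
theorem IsCyc.choose_two_bounds {N : ℕ} {u : List (ℕ × ℕ)} (hc : IsCyc 0 N u)
    (hN : u.length = N) (hu : ∀ e ∈ u, e ∈ letters N) :
    lowSum u ≤ N.choose 2 ∧ N.choose 2 ≤ highSum u := by
  induction N using Nat.strong_induction_on generalizing u with
  | _ N ih =>
  rcases Nat.eq_zero_or_pos N with rfl | hpos
  · rw [List.length_eq_zero_iff] at hN
    subst hN
    exact ⟨le_rfl, le_rfl⟩
  obtain ⟨r, e, l, rfl, hs⟩ := exists_start_ne (u := u) (by rw [hc.start_eq]; lia)
  have hN' : N = (r ++ l).length + 1 := by simp at hN ⊢; lia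
  have hu' : ∀ e ∈ r ++ l, e ∈ letters N := fun f hf => hu f (by simp at hf ⊢; tauto)
  obtain ⟨m, hm, hsplit, he⟩ := exists_isSplit_of_insert hN' hu' (hu e (by simp)) hc hs
  obtain ⟨h1, h2, h3, -, -⟩ := hsplit.insert hm hN' hu'
  have hside := hsplit.same_side hN' hu'
  obtain ⟨hlow, hhigh⟩ := (isSplit_iff_filter hside hm).1 hsplit
  obtain ⟨len1, len2⟩ := hsplit.length_filter hm hN' hu'
  obtain ⟨k, rfl⟩ := Nat.exists_eq_add_of_lt hm
  obtain ⟨v, hv⟩ := exists_map_shift (s := m + 1) (u := (r ++ l).filter fun e => !isLow m e) (by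
    intro f hf
    have h4 := hside f (List.mem_of_mem_filter hf)
    have h5 : ¬ f.2 ≤ m := by simpa [isLow] using List.of_mem_filter hf
    lia)
  have hL := lowSum_filter (isLow m) (r ++ l)
  have hH := highSum_filter (isLow m) (r ++ l)
  rw [hv, show m + k + 1 = k + (m + 1) by lia] at hhigh
  rw [hv, List.length_map] at len2
  rw [hv, lowSum_map_shift] at hL
  rw [hv, highSum_map_shift] at hH
  have b1 := ih m hm hlow len1 (by
    intro f hf
    have h4 := mem_letters.1 (hu' f (List.mem_of_mem_filter hf))
    have h5 : f.2 ≤ m := by simpa [isLow] using List.of_mem_filter hf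
    exact mem_letters.2 ⟨h4.1, h5⟩)
  have len2' : v.length = k := by lia
  have b2 := ih k (by lia) (isCyc_map_shift.1 hhigh) len2' (by
    intro f hf
    have h6 : shift (m + 1) f ∈ (r ++ l).filter fun e => !isLow m e :=
      hv ▸ List.mem_map_of_mem hf
    have h4 := mem_letters.1 (hu' _ (List.mem_of_mem_filter h6))
    simp only [shift_apply] at h4
    exact mem_letters.2 ⟨by lia, by lia⟩)
  rw [len2'] at hL hH
  have hmul : (m + 1) * k = m * k + k := by ring
  rw [choose_two_succ_add]
  rw [lowSum_append] at hL
  rw [highSum_append] at hH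
  rw [lowSum_append, highSum_append, lowSum_cons, highSum_cons, he]
  dsimp only
  lia

section Enumerators

variable {R : Type*} [CommRing R]

theorem sum_insert_eq_sum_split {N : ℕ} {r l : List (ℕ × ℕ)}
    (hN : N = (r ++ l).length + 1) (hu : ∀ e ∈ r ++ l, e ∈ letters N) (K : ℕ × ℕ → R)
    (hK : ∀ e, start (e :: l) = start l → K e = 0) :
    (∑ e ∈ letters N, if IsCyc 0 N (r ++ e :: l) then K e else 0) =
      ∑ m ∈ range N, if IsSplit m N (r ++ l) then K (start l, (act l).symm (m + 1)) else 0 := by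
  symm
  refine Finset.sum_bij_ne_zero (fun m _ _ => (start l, (act l).symm (m + 1))) ?_ ?_ ?_ ?_
  · intro m hm h
    have hs : IsSplit m N (r ++ l) := by by_contra hs; simp [hs] at h
    obtain ⟨h1, h2, h3, -, -⟩ := hs.insert (Finset.mem_range.1 hm) hN hu
    exact mem_letters.2 ⟨by dsimp; lia, h3⟩
  · intro m hm h m' hm' h' heq
    simpa using heq
  · intro e he h
    have hc : IsCyc 0 N (r ++ e :: l) := by by_contra hc; simp [hc] at h
    rw [if_pos hc] at h
    obtain ⟨m, hm, hs, rfl⟩ := exists_isSplit_of_insert hN hu he hc fun hs => h (hK _ hs)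
    exact ⟨m, Finset.mem_range.2 hm, by rwa [if_pos hs], rfl⟩
  · intro m hm h
    have hs : IsSplit m N (r ++ l) := by by_contra hs; simp [hs] at h
    obtain ⟨-, -, -, h4, -⟩ := hs.insert (Finset.mem_range.1 hm) hN hu
    rw [if_pos hs, if_pos h4]

variable (q t : R)

/-- The monomial recording both areas of a word. -/
def areaWeight (N : ℕ) (u : List (ℕ × ℕ)) : R :=
  q ^ (N.choose 2 - lowSum u) * t ^ (highSum u - N.choose 2)

/-- The contribution to the path enumerator of the word `r ++ l`, if that is a factorization of
`(0 1 ⋯ N)`. -/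
noncomputable def pathTerm (N : ℕ) (z w : R) (r l : List (ℕ × ℕ)) : R :=
  if IsCyc 0 N (r ++ l) then
    areaWeight q t N (r ++ l) * (z ^ start l * w ^ (N - start l)) else 0

/-- The enumerator of the factorizations of `(0 1 ⋯ a+b)` by areas and by the point which the
last `b` factors move to `0`. -/
noncomputable def pathEnum (a b : ℕ) (z w : R) : R :=
  wordSum (letters (a + b)) a fun r => wordSum (letters (a + b)) b fun l =>
    pathTerm q t (a + b) z w r l

theorem filter_letters_low {m N : ℕ} (hm : m ≤ N) :
    ((letters N).filter fun e => e.1 ≤ m ↔ e.2 ≤ m).filter (fun e => isLow m e = true) =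
      letters m := by
  ext e
  simp only [Finset.mem_filter, mem_letters, isLow, decide_eq_true_eq]
  lia

theorem filter_letters_high {m k : ℕ} :
    ((letters (m + k + 1)).filter fun e => e.1 ≤ m ↔ e.2 ≤ m).filter
      (fun e => ¬ isLow m e = true) = (letters k).map (shift (m + 1)) := by
  ext ⟨i, j⟩
  simp only [Finset.mem_filter, mem_letters, isLow, decide_eq_true_eq, Finset.mem_map,
    shift_apply, Prod.mk.injEq, Prod.exists]
  constructor
  · intro h
    exact ⟨i - (m + 1), j - (m + 1), by lia⟩
  · rintro ⟨i', j', h⟩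
    lia

theorem start_filter_low {m : ℕ} {u : List (ℕ × ℕ)} (hu : ∀ e ∈ u, (e.1 ≤ m ↔ e.2 ≤ m)) :
    start (u.filter (isLow m)) = start u := by
  rw [start, Equiv.symm_apply_eq, act_filter_low hu, act_start]
  rw [← act_le_iff hu, act_start]
  lia

theorem symm_filter_high {m : ℕ} {u : List (ℕ × ℕ)} (hu : ∀ e ∈ u, (e.1 ≤ m ↔ e.2 ≤ m)) :
    (act (u.filter fun e => !isLow m e)).symm (m + 1) = (act u).symm (m + 1) := by
  rw [Equiv.symm_apply_eq, act_filter_high hu, Equiv.apply_symm_apply]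
  rw [← not_le, ← act_le_iff hu, Equiv.apply_symm_apply]
  lia

theorem symm_map_shift {s : ℕ} {u : List (ℕ × ℕ)} :
    (act (u.map (shift s))).symm s = start u + s := by
  rw [Equiv.symm_apply_eq, act_map_shift, act_start, zero_add]

/-- Splitting two words over an alphabet of non-crossing letters into their low and high parts. -/
theorem wordSum_wordSum_split (m k a b : ℕ)
    (G : List (ℕ × ℕ) → List (ℕ × ℕ) → List (ℕ × ℕ) → List (ℕ × ℕ) → R) :
    (wordSum ((letters (m + k + 1)).filter fun e => e.1 ≤ m ↔ e.2 ≤ m) a fun r =>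
      wordSum ((letters (m + k + 1)).filter fun e => e.1 ≤ m ↔ e.2 ≤ m) b fun l =>
        G (r.filter (isLow m)) (l.filter (isLow m))
          (r.filter fun e => !isLow m e) (l.filter fun e => !isLow m e)) =
      ∑ i ∈ HasAntidiagonal.antidiagonal a, ∑ j ∈ HasAntidiagonal.antidiagonal b,
        (a.choose i.1 : R) * (b.choose j.1 : R) *
          wordSum (letters m) i.1 fun r₁ => wordSum (letters m) j.1 fun l₁ =>
            wordSum (letters k) i.2 fun r₂ => wordSum (letters k) j.2 fun l₂ =>
              G r₁ l₁ (r₂.map (shift (m + 1))) (l₂.map (shift (m + 1))) := by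
  set X := (letters (m + k + 1)).filter fun e => e.1 ≤ m ↔ e.2 ≤ m with hX
  have inner := fun r₁ r₂ => wordSum_filter X (isLow m) b fun l₁ l₂ => G r₁ l₁ r₂ l₂
  simp_rw [inner]
  refine (wordSum_filter X (isLow m) a fun r₁ r₂ =>
    ∑ j ∈ HasAntidiagonal.antidiagonal b, (b.choose j.1 : R) *
      wordSum (X.filter fun x => isLow m x = true) j.1 fun l₁ =>
        wordSum (X.filter fun x => ¬ isLow m x = true) j.2 fun l₂ => G r₁ l₁ r₂ l₂).trans ?_
  rw [hX]
  simp only [filter_letters_low (show m ≤ m + k + 1 by lia), filter_letters_high]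
  simp only [wordSum_sum, wordSum_mul_left, Finset.mul_sum, wordSum_map, mul_assoc]
  refine Finset.sum_congr rfl fun i _ => Finset.sum_congr rfl fun j _ => ?_
  congr 2
  refine wordSum_congr fun r₁ _ _ => ?_
  rw [wordSum_comm]

/-- The contribution of a word which acts as a product of two cycles, in terms of its low parts
`r₁, l₁` and its high parts `r₂, l₂`. -/
noncomputable def splitTerm (m N : ℕ) (z w : R) (r₁ l₁ r₂ l₂ : List (ℕ × ℕ)) : R :=
  if IsCyc 0 m (r₁ ++ l₁) ∧ IsCyc (m + 1) N (r₂ ++ l₂) then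
    q ^ (N.choose 2 - (lowSum (r₁ ++ l₁) + lowSum (r₂ ++ l₂) + start l₁)) *
      t ^ (highSum (r₁ ++ l₁) + highSum (r₂ ++ l₂) + (act l₂).symm (m + 1) - N.choose 2) *
      (z ^ start l₁ * w ^ (N - start l₁) -
        z ^ (act l₂).symm (m + 1) * w ^ (N - (act l₂).symm (m + 1)))
  else 0

theorem splitTerm_map_shift {m k : ℕ} {r₁ l₁ r₂ l₂ : List (ℕ × ℕ)} (z w : R)
    (h₁ : (r₁ ++ l₁).length = m) (h₂ : (r₂ ++ l₂).length = k)
    (hu₁ : ∀ e ∈ r₁ ++ l₁, e ∈ letters m) (hu₂ : ∀ e ∈ r₂ ++ l₂, e ∈ letters k) :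
    splitTerm q t m (m + k + 1) z w r₁ l₁ (r₂.map (shift (m + 1))) (l₂.map (shift (m + 1))) =
      t * (w * (pathTerm q t m z (q * w) r₁ l₁ * pathTerm q t k (t * w) w r₂ l₂) -
        z * (pathTerm q t m z (q * z) r₁ l₁ * pathTerm q t k (t * z) w r₂ l₂)) := by
  have hiff : IsCyc (m + 1) (m + k + 1) (r₂.map (shift (m + 1)) ++ l₂.map (shift (m + 1))) ↔
      IsCyc 0 k (r₂ ++ l₂) := by
    rw [← List.map_append, show m + k + 1 = k + (m + 1) by lia, isCyc_map_shift]
  rw [splitTerm, hiff, symm_map_shift, ← List.map_append, lowSum_map_shift, highSum_map_shift, h₂]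
  simp only [pathTerm, areaWeight]
  by_cases hc₁ : IsCyc 0 m (r₁ ++ l₁)
  swap
  · simp [hc₁]
  by_cases hc₂ : IsCyc 0 k (r₂ ++ l₂)
  swap
  · simp [hc₂]
  simp only [hc₁, hc₂, and_self, if_true]
  obtain ⟨x₁, y₁⟩ := hc₁.choose_two_bounds h₁ hu₁
  obtain ⟨x₂, y₂⟩ := hc₂.choose_two_bounds h₂ hu₂
  have s₁ : start l₁ ≤ m := start_le fun e he => hu₁ e (by simp [he])
  have s₂ : start l₂ ≤ k := start_le fun e he => hu₂ e (by simp [he])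
  have hmul : (m + 1) * k = m * k + k := by ring
  rw [choose_two_succ_add, hmul]
  generalize lowSum (r₁ ++ l₁) = L₁ at *
  generalize lowSum (r₂ ++ l₂) = L₂ at *
  generalize highSum (r₁ ++ l₁) = H₁ at *
  generalize highSum (r₂ ++ l₂) = H₂ at *
  generalize start l₁ = d at *
  generalize start l₂ = c at *
  obtain ⟨x, hx⟩ := Nat.exists_eq_add_of_le x₁
  obtain ⟨x', hx'⟩ := Nat.exists_eq_add_of_le x₂
  obtain ⟨y, hy⟩ := Nat.exists_eq_add_of_le y₁
  obtain ⟨y', hy'⟩ := Nat.exists_eq_add_of_le y₂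
  obtain ⟨d', rfl⟩ := Nat.exists_eq_add_of_le s₁
  obtain ⟨c', rfl⟩ := Nat.exists_eq_add_of_le s₂
  have e₁ : (d + d').choose 2 + (c + c').choose 2 + (d + d') * (c + c') + (d + d' + (c + c')) -
      (L₁ + (L₂ + ((d + d') * (c + c') + (c + c'))) + d) = x + x' + d' := by lia
  have e₂ : H₁ + (H₂ + ((d + d') * (c + c') + (c + c'))) + (c + (d + d' + 1)) -
      ((d + d').choose 2 + (c + c').choose 2 + (d + d') * (c + c') + (d + d' + (c + c'))) =
      y + y' + c + 1 := by lia
  have e₃ : d + d' + (c + c') + 1 - d = d' + c + c' + 1 := by lia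
  have e₄ : d + d' + (c + c') + 1 - (c + (d + d' + 1)) = c' := by lia
  rw [e₁, e₂, e₃, e₄, Nat.sub_eq_of_eq_add' hx, Nat.sub_eq_of_eq_add' hx',
    Nat.sub_eq_of_eq_add' hy, Nat.sub_eq_of_eq_add' hy', Nat.add_sub_cancel_left,
    Nat.add_sub_cancel_left]
  ring

/-- The split sum over words of a fixed cut point. -/
theorem wordSum_splitTerm (m k a b : ℕ) (hab : m + k = a + b) (z w : R) :
    (wordSum (letters (m + k + 1)) a fun r => wordSum (letters (m + k + 1)) b fun l =>
      if IsSplit m (m + k + 1) (r ++ l) then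
        areaWeight q t (m + k + 1) (r ++ (start l, (act l).symm (m + 1)) :: l) *
          (z ^ start l * w ^ (m + k + 1 - start l) -
            z ^ (act l).symm (m + 1) * w ^ (m + k + 1 - (act l).symm (m + 1)))
      else 0) =
      ∑ i ∈ HasAntidiagonal.antidiagonal a, ∑ j ∈ HasAntidiagonal.antidiagonal b,
        (a.choose i.1 : R) * (b.choose j.1 : R) *
          wordSum (letters m) i.1 fun r₁ => wordSum (letters m) j.1 fun l₁ =>
            wordSum (letters k) i.2 fun r₂ => wordSum (letters k) j.2 fun l₂ =>
              splitTerm q t m (m + k + 1) z w r₁ l₁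
                (r₂.map (shift (m + 1))) (l₂.map (shift (m + 1))) := by
  rw [← wordSum_wordSum_split m k a b]
  have hsub := Finset.filter_subset (fun e : ℕ × ℕ => e.1 ≤ m ↔ e.2 ≤ m) (letters (m + k + 1))
  rw [wordSum_subset hsub]
  swap
  · intro r hr hru hne x hx
    refine Finset.mem_filter.2 ⟨hru x hx, ?_⟩
    by_contra hside
    refine hne ((wordSum_congr fun l hl hlu => if_neg fun hsplit => hside ?_).trans
      (wordSum_zero (letters (m + k + 1)) b))
    refine hsplit.same_side (by simp; lia) ?_ x (by simp [hx])
    intro e he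
    rcases List.mem_append.1 he with h | h
    exacts [hru e h, hlu e h]
  refine wordSum_congr fun r hr hru => ?_
  rw [wordSum_subset hsub]
  swap
  · intro l hl hlu hne x hx
    refine Finset.mem_filter.2 ⟨hlu x hx, ?_⟩
    by_contra hside
    refine hne (if_neg fun hsplit => hside ?_)
    refine hsplit.same_side (by simp; lia) ?_ x (by simp [hx])
    intro e he
    rcases List.mem_append.1 he with h | h
    exacts [hsub (hru e h), hlu e h]
  refine wordSum_congr fun l hl hlu => ?_
  have hr' : ∀ e ∈ r, (e.1 ≤ m ↔ e.2 ≤ m) := fun e he => (Finset.mem_filter.1 (hru e he)).2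
  have hl' : ∀ e ∈ l, (e.1 ≤ m ↔ e.2 ≤ m) := fun e he => (Finset.mem_filter.1 (hlu e he)).2
  have hrl : ∀ e ∈ r ++ l, (e.1 ≤ m ↔ e.2 ≤ m) := by
    intro e he
    rcases List.mem_append.1 he with h | h
    exacts [hr' e h, hl' e h]
  rw [splitTerm, start_filter_low hl', symm_filter_high hl', ← List.filter_append,
    ← List.filter_append, lowSum_filter, highSum_filter]
  simp only [isSplit_iff_filter hrl (show m < m + k + 1 by lia), areaWeight]
  refine if_congr Iff.rfl ?_ rfl
  simp only [lowSum_append, highSum_append, lowSum_cons, highSum_cons]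
  congr 4 <;> lia

theorem wordSum_splitTerm_eq_zero {m k a₁ b₁ a₂ b₂ : ℕ} (z w : R)
    (h : a₁ + b₁ < m ∨ a₂ + b₂ < k) :
    (wordSum (letters m) a₁ fun r₁ => wordSum (letters m) b₁ fun l₁ =>
      wordSum (letters k) a₂ fun r₂ => wordSum (letters k) b₂ fun l₂ =>
        splitTerm q t m (m + k + 1) z w r₁ l₁
          (r₂.map (shift (m + 1))) (l₂.map (shift (m + 1)))) = 0 := by
  rw [← wordSum_zero (letters m) a₁]
  refine wordSum_congr fun r₁ hr₁ _ => ?_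
  rw [← wordSum_zero (letters m) b₁]
  refine wordSum_congr fun l₁ hl₁ _ => ?_
  rw [← wordSum_zero (letters k) a₂]
  refine wordSum_congr fun r₂ hr₂ _ => ?_
  rw [← wordSum_zero (letters k) b₂]
  refine wordSum_congr fun l₂ hl₂ _ => if_neg fun hc => ?_
  have h₁ := hc.1.le_length
  have h₂ := hc.2.le_length
  simp at h₁ h₂
  lia

theorem wordSum_splitTerm_eq_mul (a₁ b₁ a₂ b₂ : ℕ) (z w : R) :
    (wordSum (letters (a₁ + b₁)) a₁ fun r₁ => wordSum (letters (a₁ + b₁)) b₁ fun l₁ =>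
      wordSum (letters (a₂ + b₂)) a₂ fun r₂ => wordSum (letters (a₂ + b₂)) b₂ fun l₂ =>
        splitTerm q t (a₁ + b₁) (a₁ + b₁ + (a₂ + b₂) + 1) z w r₁ l₁
          (r₂.map (shift (a₁ + b₁ + 1))) (l₂.map (shift (a₁ + b₁ + 1)))) =
      t * (w * (pathEnum q t a₁ b₁ z (q * w) * pathEnum q t a₂ b₂ (t * w) w) -
        z * (pathEnum q t a₁ b₁ z (q * z) * pathEnum q t a₂ b₂ (t * z) w)) := by
  refine Eq.trans (wordSum_congr fun r₁ hr₁ hr₁' => wordSum_congr fun l₁ hl₁ hl₁' =>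
    wordSum_congr fun r₂ hr₂ hr₂' => wordSum_congr fun l₂ hl₂ hl₂' =>
      splitTerm_map_shift q t z w (by simp [*]) (by simp [*]) (fun e he => ?_)
        (fun e he => ?_)) ?_
  · exact (List.mem_append.1 he).elim (hr₁' e) (hl₁' e)
  · exact (List.mem_append.1 he).elim (hr₂' e) (hl₂' e)
  · simp only [pathEnum, wordSum_sub, wordSum_mul_left, wordSum_mul_right]

theorem pathEnum_sub_eq_sum_split (a b : ℕ) (z w : R) :
    pathEnum q t (a + 1) b z w - pathEnum q t a (b + 1) z w =
      ∑ m ∈ range (a + b + 1),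
        wordSum (letters (a + b + 1)) a fun r => wordSum (letters (a + b + 1)) b fun l =>
          if IsSplit m (a + b + 1) (r ++ l) then
            areaWeight q t (a + b + 1) (r ++ (start l, (act l).symm (m + 1)) :: l) *
              (z ^ start l * w ^ (a + b + 1 - start l) -
                z ^ (act l).symm (m + 1) * w ^ (a + b + 1 - (act l).symm (m + 1)))
          else 0 := by
  rw [pathEnum, pathEnum, show a + 1 + b = a + b + 1 by lia, show a + (b + 1) = a + b + 1 by lia,
    wordSum_succ_snoc]
  simp only [← wordSum_sum, wordSum, ← wordSum_sub, ← Finset.sum_sub_distrib]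
  refine wordSum_congr fun r hr hru => wordSum_congr fun l hl hlu => ?_
  have hN : a + b + 1 = (r ++ l).length + 1 := by simp [*]
  have hu : ∀ e ∈ r ++ l, e ∈ letters (a + b + 1) := by
    intro e he
    rcases List.mem_append.1 he with h | h
    exacts [hru e h, hlu e h]
  have key := sum_insert_eq_sum_split hN hu (fun e => areaWeight q t (a + b + 1) (r ++ e :: l) *
    (z ^ start l * w ^ (a + b + 1 - start l) -
      z ^ start (e :: l) * w ^ (a + b + 1 - start (e :: l)))) (fun e he => by
        simp only [he, sub_self, mul_zero])
  refine Eq.trans (Finset.sum_congr rfl fun e _ => ?_) (key.trans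
    (Finset.sum_congr rfl fun m hm => ?_))
  · rw [pathTerm, pathTerm, List.append_assoc, List.singleton_append]
    split_ifs <;> ring
  · by_cases hs : IsSplit m (a + b + 1) (r ++ l)
    · rw [if_pos hs, if_pos hs, (hs.insert (Finset.mem_range.1 hm) hN hu).2.2.2.2]
    · rw [if_neg hs, if_neg hs]

theorem pathEnum_sub (a b : ℕ) (z w : R) :
    pathEnum q t (a + 1) b z w - pathEnum q t a (b + 1) z w =
      ∑ i ∈ HasAntidiagonal.antidiagonal a, ∑ j ∈ HasAntidiagonal.antidiagonal b,
        (a.choose i.1 : R) * (b.choose j.1 : R) *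
          (t * (w * (pathEnum q t i.1 j.1 z (q * w) * pathEnum q t i.2 j.2 (t * w) w) -
            z * (pathEnum q t i.1 j.1 z (q * z) * pathEnum q t i.2 j.2 (t * z) w))) := by
  have step := fun m (hm : m ∈ range (a + b + 1)) =>
    wordSum_splitTerm q t m (a + b - m) a b (by have := Finset.mem_range.1 hm; lia) z w
  have cast : ∀ m ∈ range (a + b + 1), m + (a + b - m) = a + b := fun m hm => by
    have := Finset.mem_range.1 hm; lia
  have hsum := Finset.sum_congr rfl step
  rw [pathEnum_sub_eq_sum_split]
  refine Eq.trans (Finset.sum_congr rfl fun m hm => ?_) (hsum.trans ?_)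
  · rw [cast m hm]
  rw [Finset.sum_comm]
  refine Finset.sum_congr rfl fun i hi => ?_
  rw [Finset.sum_comm]
  refine Finset.sum_congr rfl fun j hj => ?_
  have hi' := HasAntidiagonal.mem_antidiagonal.1 hi
  have hj' := HasAntidiagonal.mem_antidiagonal.1 hj
  rw [← Finset.mul_sum, ← wordSum_splitTerm_eq_mul]
  rw [Finset.sum_eq_single (i.1 + j.1)]
  · rw [show a + b - (i.1 + j.1) = i.2 + j.2 by lia]
  · intro m hm hne
    exact wordSum_splitTerm_eq_zero q t z w (by have := Finset.mem_range.1 hm; lia)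
  · intro h
    exact absurd (Finset.mem_range.2 (by lia)) h

/-- The enumerator of the factorizations of `(0 1 ⋯ N)` by their areas. -/
noncomputable def areaEnum (N : ℕ) : R :=
  wordSum (letters N) N fun u => if IsCyc 0 N u then areaWeight q t N u else 0

theorem pathEnum_zero_left (N : ℕ) (z w : R) :
    pathEnum q t 0 N z w = areaEnum q t N * z ^ N := by
  rw [pathEnum, wordSum, zero_add, areaEnum, ← wordSum_mul_right]
  refine wordSum_congr fun l _ _ => ?_
  rw [pathTerm, List.nil_append]
  split_ifs with h
  · rw [h.start_eq, Nat.sub_self, pow_zero, mul_one]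
  · rw [zero_mul]

theorem pathEnum_zero_right (N : ℕ) (z w : R) :
    pathEnum q t N 0 z w = areaEnum q t N * w ^ N := by
  rw [pathEnum, add_zero, areaEnum, ← wordSum_mul_right]
  refine wordSum_congr fun r _ _ => ?_
  rw [wordSum, pathTerm, List.append_nil, show start [] = 0 from rfl, Nat.sub_zero, pow_zero,
    one_mul]
  split_ifs
  · rfl
  · rw [zero_mul]

theorem areaEnum_zero : areaEnum q t 0 = 1 := by
  have h : IsCyc 0 0 [] := ⟨fun x _ hx => absurd hx (Nat.not_lt_zero x), rfl⟩
  rw [areaEnum, wordSum, if_pos h]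
  simp [areaWeight, highSum]

theorem pathEnum_mul_mul (a b : ℕ) (s z w : R) :
    pathEnum q t a b (s * z) (s * w) = s ^ (a + b) * pathEnum q t a b z w := by
  rw [pathEnum, pathEnum, ← wordSum_mul_left]
  refine wordSum_congr fun r _ _ => ?_
  rw [← wordSum_mul_left]
  refine wordSum_congr fun l _ hl => ?_
  rw [pathTerm, pathTerm]
  split_ifs
  · obtain ⟨c, hc⟩ := Nat.exists_eq_add_of_le (start_le hl)
    rw [hc, Nat.add_sub_cancel_left]
    ring
  · rw [mul_zero]

end Enumerators

/-! ### Binomial convolution -/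

section BinomConv

variable {R : Type*} [CommRing R]

theorem sum_antidiagonal_choose_succ (f : ℕ → ℕ → R) (n : ℕ) :
    ∑ i ∈ HasAntidiagonal.antidiagonal (n + 1), ((n + 1).choose i.1 : R) * f i.1 i.2 =
      ∑ i ∈ HasAntidiagonal.antidiagonal n,
        (n.choose i.1 : R) * (f (i.1 + 1) i.2 + f i.1 (i.2 + 1)) := by
  rw [Finset.sum_antidiagonal_choose_succ_mul f n, add_comm, ← Finset.sum_add_distrib]
  refine Finset.sum_congr rfl fun i hi => ?_
  rw [← HasAntidiagonal.mem_antidiagonal.1 hi, Nat.choose_symm_add, mul_add]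

/-- Vandermonde's identity, in summed form. -/
theorem sum_choose_mul_choose (a b : ℕ) (H : ℕ → R) :
    ∑ i ∈ HasAntidiagonal.antidiagonal a, ∑ j ∈ HasAntidiagonal.antidiagonal b,
      (a.choose i.1 : R) * (b.choose j.1 : R) * H (i.1 + j.1) =
      ∑ i ∈ HasAntidiagonal.antidiagonal (a + b), ((a + b).choose i.1 : R) * H i.1 := by
  induction a generalizing H with
  | zero => simp
  | succ a ih =>
    simp only [mul_assoc, ← Finset.mul_sum] at ih ⊢
    rw [sum_antidiagonal_choose_succ fun i _ =>
      ∑ j ∈ HasAntidiagonal.antidiagonal b, (b.choose j.1 : R) * H (i + j.1),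
      Nat.succ_add, sum_antidiagonal_choose_succ fun i _ => H i]
    simp only [mul_add, Finset.sum_add_distrib]
    rw [← ih fun k => H (k + 1), ← ih H]
    simp only [add_right_comm]

/-- The binomial convolution of two arrays. -/
def binomConv (f g : ℕ → ℕ → R) (a b : ℕ) : R :=
  ∑ i ∈ HasAntidiagonal.antidiagonal a, ∑ j ∈ HasAntidiagonal.antidiagonal b,
    (a.choose i.1 : R) * (b.choose j.1 : R) * (f i.1 j.1 * g i.2 j.2)

/-- The antidiagonal difference of an array. -/
def antidiff (f : ℕ → ℕ → R) (a b : ℕ) : R := f (a + 1) b - f a (b + 1)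

theorem antidiff_binomConv (f g : ℕ → ℕ → R) :
    antidiff (binomConv f g) = binomConv (antidiff f) g + binomConv f (antidiff g) := by
  ext a b
  have h₁ : binomConv f g (a + 1) b =
      ∑ i ∈ HasAntidiagonal.antidiagonal a, ∑ j ∈ HasAntidiagonal.antidiagonal b,
        (a.choose i.1 : R) * (b.choose j.1 : R) *
          (f (i.1 + 1) j.1 * g i.2 j.2 + f i.1 j.1 * g (i.2 + 1) j.2) := by
    simp only [binomConv, mul_assoc, ← Finset.mul_sum, mul_add, Finset.sum_add_distrib]
    rw [sum_antidiagonal_choose_succ (fun i i' => ∑ j ∈ HasAntidiagonal.antidiagonal b,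
      (b.choose j.1 : R) * (f i j.1 * g i' j.2)) a]
    simp only [mul_add, Finset.sum_add_distrib]
  have h₂ : binomConv f g a (b + 1) =
      ∑ i ∈ HasAntidiagonal.antidiagonal a, ∑ j ∈ HasAntidiagonal.antidiagonal b,
        (a.choose i.1 : R) * (b.choose j.1 : R) *
          (f i.1 (j.1 + 1) * g i.2 j.2 + f i.1 j.1 * g i.2 (j.2 + 1)) := by
    simp only [binomConv, mul_assoc, ← Finset.mul_sum]
    exact Finset.sum_congr rfl fun i _ => congrArg _
      (sum_antidiagonal_choose_succ (fun j j' => f i.1 j * g i.2 j') b)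
  rw [antidiff, h₁, h₂, Pi.add_apply, Pi.add_apply, binomConv, binomConv]
  simp only [← Finset.sum_sub_distrib, ← Finset.sum_add_distrib, antidiff]
  refine Finset.sum_congr rfl fun i _ => Finset.sum_congr rfl fun j _ => ?_
  ring

variable [Algebra ℚ R]

/-- The exponential generating function of an array. -/
noncomputable def egf (f : ℕ → ℕ → R) : PowerSeries (PowerSeries R) :=
  PowerSeries.mk fun a => PowerSeries.mk fun b =>
    algebraMap ℚ R ((a.factorial * b.factorial : ℚ)⁻¹) * f a b

theorem egf_injective : Function.Injective (egf : (ℕ → ℕ → R) → _) := by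
  intro f g h
  ext a b
  have h' := congrArg (fun F => PowerSeries.coeff b (PowerSeries.coeff a F)) h
  simp only [egf, PowerSeries.coeff_mk] at h'
  have hu : IsUnit (algebraMap ℚ R ((a.factorial * b.factorial : ℚ)⁻¹)) := by
    refine IsUnit.map _ (isUnit_iff_ne_zero.2 ?_)
    positivity
  exact hu.mul_left_cancel h'

theorem egf_sub (f g : ℕ → ℕ → R) : egf (f - g) = egf f - egf g := by
  ext a b
  simp [egf, mul_sub]

theorem egf_add (f g : ℕ → ℕ → R) : egf (f + g) = egf f + egf g := by
  ext a b
  simp [egf, mul_add]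

theorem egf_smul (r : R) (f : ℕ → ℕ → R) :
    egf (r • f) = PowerSeries.C (PowerSeries.C r) * egf f := by
  ext a b
  simp [egf]
  ring

theorem choose_mul_inv_factorial (i j : ℕ) :
    ((i + j).factorial : ℚ)⁻¹ * (i + j).choose i = (i.factorial : ℚ)⁻¹ * (j.factorial : ℚ)⁻¹ := by
  rw [← Nat.add_choose_mul_factorial_mul_factorial, Nat.choose_symm_add]
  have := (Nat.choose_pos (Nat.le_add_left j i)).ne'
  have := i.factorial_ne_zero
  have := j.factorial_ne_zero
  push_cast
  field_simp

theorem egf_binomConv (f g : ℕ → ℕ → R) : egf (binomConv f g) = egf f * egf g := by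
  ext a b
  simp only [egf, PowerSeries.coeff_mul, PowerSeries.coeff_mk, map_sum, binomConv, Finset.mul_sum]
  refine Finset.sum_congr rfl fun i hi => Finset.sum_congr rfl fun j hj => ?_
  rw [← HasAntidiagonal.mem_antidiagonal.1 hi, ← HasAntidiagonal.mem_antidiagonal.1 hj]
  have h : (((i.1 + i.2).factorial * (j.1 + j.2).factorial : ℚ)⁻¹) *
      ((i.1 + i.2).choose i.1 * (j.1 + j.2).choose j.1) =
      (i.1.factorial * j.1.factorial : ℚ)⁻¹ * (i.2.factorial * j.2.factorial : ℚ)⁻¹ := by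
    have h₁ := choose_mul_inv_factorial i.1 i.2
    have h₂ := choose_mul_inv_factorial j.1 j.2
    simp only [mul_inv]
    linear_combination ((j.1 + j.2).factorial : ℚ)⁻¹ * (j.1 + j.2).choose j.1 * h₁ +
      (i.1.factorial : ℚ)⁻¹ * (i.2.factorial : ℚ)⁻¹ * h₂
  have h' := congrArg (algebraMap ℚ R) h
  simp only [map_mul, map_natCast] at h' ⊢
  linear_combination (f i.1 j.1 * g i.2 j.2) * h'

end BinomConv

/-! ### The recursion -/

section Recursion

variable {R : Type*} [CommRing R]

theorem binomConv_eq_zero {f g : ℕ → ℕ → R} {a b : ℕ}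
    (h : ∀ i ∈ HasAntidiagonal.antidiagonal a, ∀ j ∈ HasAntidiagonal.antidiagonal b,
      f i.1 j.1 * g i.2 j.2 = 0) : binomConv f g a b = 0 :=
  Finset.sum_eq_zero fun i hi => Finset.sum_eq_zero fun j hj => by rw [h i hi j hj, mul_zero]

theorem antidiff_sub (f g : ℕ → ℕ → R) : antidiff (f - g) = antidiff f - antidiff g := by
  ext a b
  simp only [antidiff, Pi.sub_apply]
  ring

variable (q t : R)

/-- The array of all path enumerators. -/
noncomputable def pathArray (z w : R) (a b : ℕ) : R := pathEnum q t a b z w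

theorem antidiff_pathArray (z w : R) :
    antidiff (pathArray q t z w) =
      t • (w • binomConv (pathArray q t z (q * w)) (pathArray q t (t * w) w) -
        z • binomConv (pathArray q t z (q * z)) (pathArray q t (t * z) w)) := by
  ext a b
  rw [antidiff, pathArray, pathArray, pathEnum_sub]
  simp only [Pi.smul_apply, Pi.sub_apply, smul_eq_mul, binomConv, Finset.mul_sum,
    ← Finset.sum_sub_distrib, pathArray]
  refine Finset.sum_congr rfl fun i _ => Finset.sum_congr rfl fun j _ => ?_
  ring

/-- The failure of the path enumerators to factor. -/
noncomputable def pathDefect (z w : R) : ℕ → ℕ → R :=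
  pathArray q t z w - binomConv (pathArray q t z 0) (pathArray q t 0 w)

theorem pathDefect_zero_left (N : ℕ) (z w : R) : pathDefect q t z w 0 N = 0 := by
  rw [pathDefect, Pi.sub_apply, Pi.sub_apply, sub_eq_zero, binomConv,
    Finset.Nat.antidiagonal_zero, Finset.sum_singleton, Finset.sum_eq_single (N, 0)]
  · simp [pathArray, pathEnum_zero_left, areaEnum_zero]
  · intro j hj hne
    have hj' := HasAntidiagonal.mem_antidiagonal.1 hj
    have h : j.2 ≠ 0 := fun h => hne (Prod.ext (by dsimp; lia) h)
    simp [pathArray, pathEnum_zero_left, h]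
  · simp

variable [Algebra ℚ R]

theorem antidiff_pathDefect (z w : R) :
    antidiff (pathDefect q t z w) =
      t • (w • binomConv (pathDefect q t z (q * w)) (pathArray q t (t * w) w) -
        z • binomConv (pathArray q t z (q * z)) (pathDefect q t (t * z) w)) := by
  rw [pathDefect, antidiff_sub, antidiff_binomConv, antidiff_pathArray, antidiff_pathArray,
    antidiff_pathArray]
  apply egf_injective
  simp only [pathDefect, egf_sub, egf_add, egf_smul, egf_binomConv, map_zero, mul_zero, zero_mul]
  ring

theorem pathDefect_eq_zero (z w : R) : pathDefect q t z w = 0 := by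
  suffices H : ∀ N a b, a + b = N → ∀ z w, pathDefect q t z w a b = 0 by
    ext a b
    exact H _ a b rfl z w
  intro N
  induction N using Nat.strong_induction_on with
  | _ N ih =>
  intro a
  induction a with
  | zero => exact fun b _ => pathDefect_zero_left q t b
  | succ a iha =>
    intro b hab z w
    have h := congrFun (congrFun (antidiff_pathDefect q t z w) a) b
    rw [antidiff, iha (b + 1) (by lia), sub_zero] at h
    rw [h]
    have hz : ∀ i ∈ HasAntidiagonal.antidiagonal a, ∀ j ∈ HasAntidiagonal.antidiagonal b,
        ∀ z w, pathDefect q t z w i.1 j.1 = 0 ∧ pathDefect q t z w i.2 j.2 = 0 := by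
      intro i hi j hj z w
      have hi' := HasAntidiagonal.mem_antidiagonal.1 hi
      have hj' := HasAntidiagonal.mem_antidiagonal.1 hj
      exact ⟨ih _ (by lia) _ _ rfl z w, ih _ (by lia) _ _ rfl z w⟩
    simp only [Pi.smul_apply, Pi.sub_apply]
    rw [binomConv_eq_zero fun i hi j hj => by rw [(hz i hi j hj _ _).1, zero_mul],
      binomConv_eq_zero fun i hi j hj => by rw [(hz i hi j hj _ _).2, mul_zero]]
    simp

theorem egf_pathArray (z w : R) :
    egf (pathArray q t z w) = egf (pathArray q t z 0) * egf (pathArray q t 0 w) := by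
  rw [← egf_binomConv, ← sub_eq_zero, ← egf_sub]
  have h := pathDefect_eq_zero q t z w
  rw [pathDefect] at h
  rw [h]
  ext
  simp [egf]

theorem antidiff_pathArray_self :
    antidiff (pathArray q t t q) =
      t • (q • binomConv (pathArray q t (q * t) (q * q)) (pathArray q t t q) -
        t • binomConv (pathArray q t (t * t) (t * q)) (pathArray q t t q)) := by
  rw [antidiff_pathArray]
  apply egf_injective
  simp only [egf_sub, egf_smul, egf_binomConv]
  rw [egf_pathArray q t t (q * q), egf_pathArray q t (t * q) q, egf_pathArray q t (q * t) (q * q),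
    egf_pathArray q t t q, egf_pathArray q t t (q * t), egf_pathArray q t (t * t) q,
    egf_pathArray q t (t * t) (t * q), mul_comm t q]
  ring

/-- The right-hand side of the recursion for the area enumerators. -/
noncomputable def recSum (n : ℕ) : R :=
  ∑ i ∈ range (n + 1), (n.choose i : R) * t * (∑ j ∈ range (i + 1), t ^ (i - j) * q ^ j) *
    areaEnum q t i * areaEnum q t (n - i)

theorem pathEnum_sub_self {a b n : ℕ} (hn : a + b = n)
    (ih : ∀ i j, i + j ≤ n → pathEnum q t i j t q = areaEnum q t (i + j) * (q ^ i * t ^ j)) :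
    pathEnum q t (a + 1) b t q - pathEnum q t a (b + 1) t q =
      recSum q t n * (q ^ (a + 1) * t ^ b - q ^ a * t ^ (b + 1)) := by
  have h := congrFun (congrFun (antidiff_pathArray_self q t) a) b
  simp only [antidiff, pathArray, Pi.smul_apply, Pi.sub_apply, smul_eq_mul, binomConv,
    pathEnum_mul_mul, Finset.mul_sum, ← Finset.sum_sub_distrib] at h
  rw [h]
  set H : ℕ → R := fun i => (q ^ (i + 1) - t ^ (i + 1)) * (areaEnum q t i * areaEnum q t (n - i))
    with hH
  have hsum : recSum q t n * (q ^ (a + 1) * t ^ b - q ^ a * t ^ (b + 1)) =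
      t * q ^ a * t ^ b * ∑ i ∈ HasAntidiagonal.antidiagonal n, (n.choose i.1 : R) * H i.1 := by
    rw [Finset.Nat.sum_antidiagonal_eq_sum_range_succ (fun i _ => (n.choose i : R) * H i), recSum,
      Finset.sum_mul, Finset.mul_sum]
    refine Finset.sum_congr rfl fun i _ => ?_
    have hg : q ^ (i + 1) - t ^ (i + 1) =
        (q - t) * ∑ j ∈ range (i + 1), t ^ (i - j) * q ^ j := by
      rw [← (Commute.all q t).mul_geom_sum₂ (i + 1)]
      congr 1
      refine Finset.sum_congr rfl fun j _ => ?_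
      rw [mul_comm, Nat.add_sub_cancel]
    rw [hH]
    dsimp only
    rw [hg]
    ring
  rw [hsum, ← hn, ← sum_choose_mul_choose, Finset.mul_sum]
  refine Finset.sum_congr rfl fun i hi => ?_
  rw [Finset.mul_sum]
  refine Finset.sum_congr rfl fun j hj => ?_
  have hi' := HasAntidiagonal.mem_antidiagonal.1 hi
  have hj' := HasAntidiagonal.mem_antidiagonal.1 hj
  rw [ih i.1 j.1 (by lia), ih i.2 j.2 (by lia), hH]
  dsimp only
  rw [show n - (i.1 + j.1) = i.2 + j.2 by lia, ← hi', ← hj']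
  ring

theorem areaEnum_succ [IsDomain R] (hqt : ∀ n, q ^ (n + 1) ≠ t ^ (n + 1)) (n : ℕ) :
    areaEnum q t (n + 1) = recSum q t n := by
  suffices H : ∀ n, (∀ a b, a + b = n →
      pathEnum q t a b t q = areaEnum q t n * (q ^ a * t ^ b)) ∧
      ∀ k, n = k + 1 → areaEnum q t n = recSum q t k from (H (n + 1)).2 n rfl
  intro n
  induction n using Nat.strong_induction_on with
  | _ n ih =>
  rcases n with _ | n
  · refine ⟨fun a b hab => ?_, fun k hk => by lia⟩
    obtain ⟨rfl, rfl⟩ : a = 0 ∧ b = 0 := by lia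
    simp [pathEnum_zero_left]
  have step : ∀ a b, a + b = n + 1 → pathEnum q t a b t q - recSum q t n * (q ^ a * t ^ b) =
      (areaEnum q t (n + 1) - recSum q t n) * t ^ (n + 1) := by
    intro a
    induction a with
    | zero =>
      intro b hb
      obtain rfl : b = n + 1 := by lia
      rw [pathEnum_zero_left]
      ring
    | succ a iha =>
      intro b hb
      rw [← iha (b + 1) (by lia)]
      have h := pathEnum_sub_self q t (a := a) (b := b) (n := n) (by lia)
        fun i j hij => (ih (i + j) (by lia)).1 i j rfl
      linear_combination h
  have heq : areaEnum q t (n + 1) = recSum q t n := by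
    have h := step (n + 1) 0 rfl
    rw [pathEnum_zero_right] at h
    have h' : (areaEnum q t (n + 1) - recSum q t n) * (q ^ (n + 1) - t ^ (n + 1)) = 0 := by
      linear_combination h
    exact sub_eq_zero.1 ((mul_eq_zero.1 h').resolve_right (sub_ne_zero.2 (hqt n)))
  refine ⟨fun a b hab => ?_, fun k hk => ?_⟩
  · have h := step a b hab
    rw [heq, sub_self, zero_mul, sub_eq_zero] at h
    rw [h, heq]
  · obtain rfl : n = k := by lia
    exact heq

end Recursion

/-! ### Words and factorizations into transpositions -/

section Bridge

theorem wordSum_eq_sum_piFinset {α R : Type*} [AddCommMonoid R] (X : Finset α) (n : ℕ)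
    (G : List α → R) :
    wordSum X n G = ∑ f ∈ Fintype.piFinset (fun _ : Fin n => X), G (List.ofFn f) := by
  induction n generalizing G with
  | zero => simp [wordSum]
  | succ n ih =>
    simp only [wordSum, ih]
    rw [← Finset.sum_product']
    refine Finset.sum_bij' (fun p _ => Fin.cons p.1 p.2) (fun f _ => (f 0, Fin.tail f))
      ?_ ?_ ?_ ?_ ?_
    · intro p hp
      obtain ⟨h₁, h₂⟩ := Finset.mem_product.1 hp
      refine Fintype.mem_piFinset.2 fun i => Fin.cases ?_ (fun i => ?_) i
      · simpa using h₁
      · simpa using Fintype.mem_piFinset.1 h₂ i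
    · intro f hf
      rw [Fintype.mem_piFinset] at hf
      exact Finset.mem_product.2 ⟨hf 0, Fintype.mem_piFinset.2 fun i => hf i.succ⟩
    · intro p _
      simp
    · intro f _
      simp
    · intro p _
      simp [List.ofFn_succ]

theorem wordSum_image {α β R : Type*} [AddCommMonoid R] [DecidableEq β] (X : Finset α) {φ : α → β}
    (hφ : Set.InjOn φ X) (n : ℕ) (G : List β → R) :
    wordSum (X.image φ) n G = wordSum X n fun l => G (l.map φ) := by
  induction n generalizing G with
  | zero => rfl
  | succ n ih => simp only [wordSum, ih, Finset.sum_image hφ, List.map_cons]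

/-- The pair of endpoints of a transposition. -/
def endpoints {m : ℕ} (τ : Equiv.Perm (Fin m)) : ℕ × ℕ := (swapLow τ, swapHigh τ)

theorem endpoints_swap {m : ℕ} {i j : Fin m} (h : i < j) :
    endpoints (Equiv.swap i j) = (i.val, j.val) := by
  have h' : i.val < j.val := h
  simp only [endpoints, swapLow, swapHigh, Equiv.Perm.support_swap h.ne, Finset.image_insert,
    Finset.image_singleton, Finset.min_insert, Finset.max_insert, Finset.min_singleton,
    Finset.max_singleton, ← WithTop.coe_min, ← WithBot.coe_max, min_eq_left h'.le,
    max_eq_right h'.le]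
  rfl

theorem Equiv.Perm.IsSwap.exists_lt {m : ℕ} {τ : Equiv.Perm (Fin m)} (h : τ.IsSwap) :
    ∃ i j, i < j ∧ τ = Equiv.swap i j := by
  obtain ⟨i, j, hij, rfl⟩ := h
  rcases lt_or_gt_of_ne hij with h | h
  · exact ⟨i, j, h, rfl⟩
  · exact ⟨j, i, h, Equiv.swap_comm i j⟩

theorem image_endpoints (n : ℕ) :
    (Finset.univ.filter fun τ : Equiv.Perm (Fin (n + 1)) => τ.IsSwap).image endpoints =
      letters n := by
  ext ⟨i, j⟩
  rw [mem_letters, Finset.mem_image]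
  constructor
  · rintro ⟨τ, hτ, h⟩
    obtain ⟨a, b, hab, rfl⟩ := (Finset.mem_filter.1 hτ).2.exists_lt
    rw [endpoints_swap hab] at h
    obtain ⟨rfl, rfl⟩ := Prod.mk.injEq _ _ _ _ ▸ h
    exact ⟨hab, by have := b.2; dsimp; lia⟩
  · rintro ⟨h₁, h₂⟩
    dsimp at h₁ h₂
    have hlt : (⟨i, by lia⟩ : Fin (n + 1)) < ⟨j, by lia⟩ := h₁
    exact ⟨Equiv.swap ⟨i, by lia⟩ ⟨j, by lia⟩,
      Finset.mem_filter.2 ⟨Finset.mem_univ _, _, _, hlt.ne, rfl⟩, endpoints_swap hlt⟩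

theorem injOn_endpoints (m : ℕ) :
    Set.InjOn endpoints {τ : Equiv.Perm (Fin m) | τ.IsSwap} := by
  intro τ hτ τ' hτ' h
  obtain ⟨a, b, hab, rfl⟩ := Equiv.Perm.IsSwap.exists_lt hτ
  obtain ⟨a', b', hab', rfl⟩ := Equiv.Perm.IsSwap.exists_lt hτ'
  rw [endpoints_swap hab, endpoints_swap hab', Prod.mk.injEq, Fin.val_inj, Fin.val_inj] at h
  rw [h.1, h.2]

theorem act_map_endpoints {m : ℕ} {u : List (Equiv.Perm (Fin m))} (hu : ∀ τ ∈ u, τ.IsSwap)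
    (x : Fin m) : act (u.map endpoints) x = (u.reverse.prod x : Fin m) := by
  induction u generalizing x with
  | nil => rfl
  | cons τ u ih =>
    obtain ⟨i, j, hij, rfl⟩ := (hu τ (by simp)).exists_lt
    rw [List.map_cons, act, endpoints_swap hij, List.reverse_cons, List.prod_append,
      List.prod_singleton, Equiv.Perm.mul_apply, Equiv.Perm.mul_apply,
      ← ih fun τ hτ => hu τ (by simp [hτ])]
    congr 1
    simp only [Equiv.swap_apply_def, Fin.ext_iff]
    split_ifs <;> rfl

theorem prod_eq_finRotate_iff {n : ℕ} {u : List (Equiv.Perm (Fin (n + 1)))}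
    (hu : ∀ τ ∈ u, τ.IsSwap) :
    u.reverse.prod = finRotate (n + 1) ↔ IsCyc 0 n (u.map endpoints) := by
  have hact := act_map_endpoints hu
  constructor
  · intro h
    rw [h] at hact
    constructor
    · intro x _ hx
      have h' := hact ⟨x, by lia⟩
      rwa [coe_finRotate_of_ne_last (by simp [Fin.ext_iff]; lia)] at h'
    · have h' := hact (Fin.last n)
      rwa [finRotate_last] at h'
  · intro h
    ext x
    rw [← hact]
    rcases eq_or_ne x (Fin.last n) with rfl | hx
    · rw [finRotate_last]
      exact h.2
    · rw [coe_finRotate_of_ne_last hx]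
      exact h.1 x (Nat.zero_le _) (Fin.val_lt_last hx)

theorem Fpoly_eq_areaEnum (n : ℕ) : Fpoly n = areaEnum (X 0) (X 1) n := by
  have hinj : Set.InjOn endpoints (SetLike.coe
      (Finset.univ.filter fun τ : Equiv.Perm (Fin (n + 1)) => τ.IsSwap)) :=
    (injOn_endpoints _).mono fun τ hτ => (Finset.mem_filter.1 hτ).2
  rw [areaEnum, ← image_endpoints, wordSum_image _ hinj, wordSum_eq_sum_piFinset,
    ← Finset.sum_filter, Fpoly,
    ← Finset.sum_subtype (Finset.univ.filter fun f => f ∈ FactSet n) (fun f => by simp)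
      fun f => (X 0 ^ areaL f * X 1 ^ areaU f : MvPolynomial (Fin 2) ℤ)]
  refine Finset.sum_congr (Finset.ext fun f => ?_) fun f _ => ?_
  · rw [Finset.mem_filter, Finset.mem_filter, Fintype.mem_piFinset]
    simp only [Finset.mem_univ, true_and, Finset.mem_filter, FactSet, Set.mem_ofPred_eq]
    refine and_congr_right fun h => prod_eq_finRotate_iff fun τ hτ => ?_
    obtain ⟨i, rfl⟩ := List.mem_ofFn.1 hτ
    exact h i
  · rw [areaWeight, lowSum, highSum, List.map_ofFn, List.map_ofFn, List.map_ofFn, List.sum_ofFn,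
      List.sum_ofFn]
    rfl

theorem map_areaEnum {R S : Type*} [CommRing R] [CommRing S] (φ : R →+* S) (q t : R) (n : ℕ) :
    φ (areaEnum q t n) = areaEnum (φ q) (φ t) n := by
  simp only [areaEnum, wordSum_eq_sum_piFinset, map_sum, apply_ite φ, map_zero, areaWeight,
    map_mul, map_pow]

end Bridge

/-- The bivariate area enumerators of minimal factorizations satisfy `F_0(q,t) = 1` and
`F_{n+1}(q,t) = ∑_{i=0}^n C(n,i) · t · (tⁱ + t^{i-1}q + ⋯ + qⁱ) · F_i(q,t) · F_{n-i}(q,t)`. -/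
theorem Fpoly_recursion :
    Fpoly 0 = 1 ∧
    ∀ n : ℕ, Fpoly (n+1) =
      ∑ i ∈ Finset.range (n+1),
        (n.choose i : MvPolynomial (Fin 2) ℤ) * X 1 *
          (∑ j ∈ Finset.range (i+1), X 1 ^ (i - j) * X 0 ^ j) *
          Fpoly i * Fpoly (n - i) := by
  refine ⟨by rw [Fpoly_eq_areaEnum, areaEnum_zero], fun n => ?_⟩
  apply MvPolynomial.map_injective (Int.castRingHom ℚ) Int.cast_injective
  have h := areaEnum_succ (X 0 : MvPolynomial (Fin 2) ℚ) (X 1) (fun n h => ?_) n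
  · simpa only [Fpoly_eq_areaEnum, map_areaEnum, map_sum, map_mul, map_pow, map_natCast, map_X,
      recSum] using h
  · have h' := congrArg (MvPolynomial.eval (Pi.single 0 1)) h
    simp at h'
end
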